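/- Let n ≥ 2 and let V = (ℤ/2ℤ)^n, and suppose 2^n − 1 is prime. A subgroup H of GL(V) acts transitively on V \ {0} if and only if one of the following holds: (i) H = GL(V); (ii) H is cyclic of order 2^n − 1; (iii) H has order n·(2^n − 1) and contains a normal cyclic subgroup of order 2^n − 1. -/

import Mathlib

set_option linter.unusedSectionVars false

/-- The nontrivial additive character of the field with two elements, with integer values. -/
def signChar (a : ZMod 2) : ℤ := if a = 0 then 1 else -1

theorem signChar_add (a b : ZMod 2) : signChar (a + b) = signChar a * signChar b := by
  revert a b; decide

theorem signChar_zero : signChar 0 = 1 := rfl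

theorem signChar_one : signChar 1 = -1 := by decide

theorem zmod_two_ne_zero {a : ZMod 2} : a ≠ 0 ↔ a = 1 := by
  revert a; decide

theorem zmod_two_ne_one {a : ZMod 2} : a ≠ 1 ↔ a = 0 := by
  revert a; decide

theorem zmod_two_cases (a : ZMod 2) : a = 0 ∨ a = 1 := by
  revert a; decide

section Elementary

variable {V : Type*} [AddCommGroup V] [Module (ZMod 2) V]

theorem add_self_two (x : V) : x + x = 0 := by
  rw [← two_smul (ZMod 2) x, show (2 : ZMod 2) = 0 from rfl, zero_smul]

theorem neg_two (x : V) : -x = x := by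
  rw [neg_eq_iff_add_eq_zero, add_self_two]

theorem sub_two (x y : V) : x - y = x + y := by
  rw [sub_eq_add_neg, neg_two]

theorem add_eq_zero_two {x y : V} : x + y = 0 ↔ x = y := by
  rw [← sub_two, sub_eq_zero]

theorem add_add_cancel_two (x y : V) : x + y + y = x := by
  rw [add_assoc, add_self_two, add_zero]

theorem add_add_cancel_left_two (x y : V) : x + (x + y) = y := by
  rw [← add_assoc, add_self_two, zero_add]

theorem eq_add_two {x y z : V} : x = y + z ↔ x + z = y := by
  constructor
  · rintro rfl; rw [add_add_cancel_two]
  · rintro rfl; rw [add_add_cancel_two]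

/-- A nonempty additively closed set in a vector space over the field with two elements. -/
def submoduleTwo (s : Set V) (h0 : 0 ∈ s) (hadd : ∀ x ∈ s, ∀ y ∈ s, x + y ∈ s) :
    Submodule (ZMod 2) V where
  carrier := s
  zero_mem' := h0
  add_mem' := fun {a b} ha hb => hadd a ha b hb
  smul_mem' := by
    intro c x hx
    rcases zmod_two_cases c with rfl | rfl
    · simpa using h0
    · simpa using hx

@[simp] theorem mem_submoduleTwo (s : Set V) (h0 : 0 ∈ s)
    (hadd : ∀ x ∈ s, ∀ y ∈ s, x + y ∈ s) (x : V) : x ∈ submoduleTwo s h0 hadd ↔ x ∈ s := Iff.rfl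

theorem mem_span_one {x y : V} : y ∈ Submodule.span (ZMod 2) {x} ↔ y = 0 ∨ y = x := by
  rw [Submodule.mem_span_singleton]
  constructor
  · rintro ⟨a, rfl⟩
    rcases zmod_two_cases a with rfl | rfl
    · simp
    · simp
  · rintro (rfl | rfl)
    · exact ⟨0, by simp⟩
    · exact ⟨1, by simp⟩

theorem mem_span_two {x y z : V} :
    z ∈ Submodule.span (ZMod 2) {x, y} ↔ z = 0 ∨ z = x ∨ z = y ∨ z = x + y := by
  rw [Submodule.mem_span_pair]
  constructor
  · rintro ⟨a, b, rfl⟩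
    rcases zmod_two_cases a with rfl | rfl <;> rcases zmod_two_cases b with rfl | rfl <;> simp
  · rintro (rfl | rfl | rfl | rfl)
    · exact ⟨0, 0, by simp⟩
    · exact ⟨1, 0, by simp⟩
    · exact ⟨0, 1, by simp⟩
    · exact ⟨1, 1, by simp⟩

theorem card_submodule_two_pow [Finite V] (A : Submodule (ZMod 2) V) :
    ∃ k, Nat.card A = 2 ^ k := by
  have := Module.natCard_eq_pow_finrank (K := ZMod 2) (V := A)
  refine ⟨Module.finrank (ZMod 2) A, ?_⟩
  rw [this, Nat.card_zmod]

theorem sum_signChar [Fintype V] (A : Submodule (ZMod 2) V) [Fintype A] (f : V →ₗ[ZMod 2] ZMod 2)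
    [Decidable (∀ v ∈ A, f v = 0)] :
    ∑ v : A, signChar (f v) = if ∀ v ∈ A, f v = 0 then (Nat.card A : ℤ) else 0 := by
  split_ifs with h
  · rw [Finset.sum_congr rfl (g := fun _ => 1) (fun v _ => by rw [h v v.2, signChar_zero])]
    simp
  · push Not at h
    obtain ⟨v0, hv0, h1⟩ := h
    rw [zmod_two_ne_zero] at h1
    have := Fintype.sum_equiv (Equiv.addRight (⟨v0, hv0⟩ : A)) (fun v : A => signChar (f (v + v0)))
      (fun v => signChar (f v)) (fun v => by simp)
    simp only [map_add, signChar_add, h1, signChar_one] at this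
    rw [← Finset.sum_mul] at this
    linarith

end Elementary

section Pairing

variable {V V' : Type*} [AddCommGroup V] [Module (ZMod 2) V] [AddCommGroup V']
  [Module (ZMod 2) V'] (p : V →ₗ[ZMod 2] V' →ₗ[ZMod 2] ZMod 2)

/-- The orthogonal of a set under a pairing. -/
def perpS (s : Set V) : Submodule (ZMod 2) V' :=
  submoduleTwo {ξ | ∀ x ∈ s, p x ξ = 0} (by simp) (by
    intro ξ hξ η hη x hx
    rw [map_add, hξ x hx, hη x hx, add_zero])

variable {p}

theorem mem_perpS {s : Set V} {ξ : V'} : ξ ∈ perpS p s ↔ ∀ x ∈ s, p x ξ = 0 := Iff.rfl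

theorem perpS_anti {s t : Set V} (h : s ⊆ t) : perpS p t ≤ perpS p s :=
  fun _ hξ x hx => hξ x (h hx)

theorem mem_perpS_perpS {s : Set V} {x : V} (hx : x ∈ s) : x ∈ perpS p.flip (perpS p s) :=
  fun _ hξ => hξ x hx

/-- A pairing is nondegenerate on both sides. -/
structure Nondeg (p : V →ₗ[ZMod 2] V' →ₗ[ZMod 2] ZMod 2) : Prop where
  left : ∀ x, (∀ ξ, p x ξ = 0) → x = 0
  right : ∀ ξ, (∀ x, p x ξ = 0) → ξ = 0

theorem Nondeg.flip (h : Nondeg p) : Nondeg p.flip := ⟨h.right, h.left⟩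

theorem Nondeg.exists_one (h : Nondeg p) {x : V} (hx : x ≠ 0) : ∃ ξ, p x ξ = 1 := by
  by_contra hc
  push Not at hc
  exact hx (h.left x fun ξ => zmod_two_ne_one.1 (hc ξ))

variable [Finite V] [Finite V']

theorem Nondeg.card_mul (h : Nondeg p) (A : Submodule (ZMod 2) V) :
    Nat.card A * Nat.card (perpS p A) = Nat.card V' := by
  classical
  have := Fintype.ofFinite V
  have := Fintype.ofFinite V'
  have h1 : ∑ v : A, ∑ ξ : (⊤ : Submodule (ZMod 2) V'), signChar (p v ξ) = (Nat.card V' : ℤ) := by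
    rw [Finset.sum_congr rfl (fun (v : A) _ => sum_signChar ⊤ (p (v : V)))]
    rw [Finset.sum_eq_single 0]
    · simp
    · intro b _ hb
      rw [if_neg]
      intro hc
      exact hb (Subtype.ext (h.left b fun ξ => hc ξ trivial))
    · simp
  have h2 : ∑ ξ : (⊤ : Submodule (ZMod 2) V'), ∑ v : A, signChar (p.flip ξ v) =
      (Nat.card A * Nat.card (perpS p A) : ℤ) := by
    rw [Finset.sum_congr rfl (fun (ξ : (⊤ : Submodule (ZMod 2) V')) _ =>
      sum_signChar A (p.flip (ξ : V')))]
    rw [Finset.sum_ite, Finset.sum_const, Finset.sum_const_zero, add_zero, nsmul_eq_mul, mul_comm]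
    congr 2
    rw [Nat.card_eq_fintype_card, Fintype.card_subtype]
    refine Finset.card_bij (fun a _ => (a : V')) ?_ ?_ ?_
    · intro a ha
      exact Finset.mem_filter.2 ⟨Finset.mem_univ _, (Finset.mem_filter.1 ha).2⟩
    · intro a _ b _ hab
      exact Subtype.ext hab
    · intro b hb
      exact ⟨⟨b, trivial⟩, Finset.mem_filter.2 ⟨Finset.mem_univ _, (Finset.mem_filter.1 hb).2⟩, rfl⟩
  have h3 := Finset.sum_comm (s := (Finset.univ : Finset A))
    (t := (Finset.univ : Finset (⊤ : Submodule (ZMod 2) V'))) (f := fun v ξ => signChar (p v ξ))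
  rw [h1] at h3
  have h4 := h3.trans h2
  exact_mod_cast h4.symm

theorem Nondeg.card_eq (h : Nondeg p) : Nat.card V = Nat.card V' := by
  have h1 := h.card_mul ⊤
  have h2 : perpS p ((⊤ : Submodule (ZMod 2) V) : Set V) = ⊥ := by
    rw [eq_bot_iff]
    intro ξ hξ
    exact h.right ξ fun x => hξ x trivial
  rw [h2] at h1
  simpa using h1

theorem submodule_eq_of_card {A B : Submodule (ZMod 2) V} (h : A ≤ B)
    (hc : Nat.card B ≤ Nat.card A) : A = B := by
  apply SetLike.coe_injective
  apply Set.eq_of_subset_of_ncard_le h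
  rwa [← Nat.card_coe_set_eq, ← Nat.card_coe_set_eq]

theorem card_submodule_mono {A B : Submodule (ZMod 2) V} (h : A ≤ B) :
    Nat.card A ≤ Nat.card B :=
  Nat.card_mono (Set.toFinite _) h

theorem Nondeg.perp_perp (h : Nondeg p) (A : Submodule (ZMod 2) V) :
    perpS p.flip (perpS p (A : Set V)) = A := by
  symm
  apply submodule_eq_of_card
  · intro x hx
    exact mem_perpS_perpS hx
  · have h1 := h.card_mul A
    have h2 := h.flip.card_mul (perpS p (A : Set V))
    have h3 := h.card_eq
    have h4 : 0 < Nat.card (perpS p (A : Set V)) := Nat.card_pos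
    rw [← h3] at h1
    rw [← h1, mul_comm] at h2
    exact (Nat.eq_of_mul_eq_mul_right h4 h2).le

end Pairing

section Action

variable {Γ : Type*} [Group Γ]

/-- A subgroup is transitive on a set. -/
def TransOn {α : Type*} [MulAction Γ α] (H : Subgroup Γ) (T : Set α) : Prop :=
  ∀ a ∈ T, ∀ b ∈ T, ∃ h ∈ H, h • a = b

theorem orbit_eq_of_transOn {α : Type*} [MulAction Γ α] {H : Subgroup Γ} {T : Set α}
    (ht : TransOn H T) (hi : ∀ h ∈ H, ∀ a ∈ T, h • a ∈ T) {a : α} (ha : a ∈ T) :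
    MulAction.orbit H a = T := by
  ext b
  constructor
  · rintro ⟨h, rfl⟩
    exact hi h h.2 a ha
  · intro hb
    obtain ⟨h, hh, rfl⟩ := ht a ha b hb
    exact ⟨⟨h, hh⟩, rfl⟩

theorem transOn_prod_of_coprime [Finite Γ] {α β : Type*} [MulAction Γ α] [MulAction Γ β]
    {H : Subgroup Γ} {A : Set α} {B : Set β} (hA : TransOn H A) (hB : TransOn H B)
    (iA : ∀ h ∈ H, ∀ a ∈ A, h • a ∈ A) (iB : ∀ h ∈ H, ∀ b ∈ B, h • b ∈ B)
    (hco : Nat.Coprime A.ncard B.ncard) {a a' : α} {b b' : β} (ha : a ∈ A) (ha' : a' ∈ A)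
    (hb : b ∈ B) (hb' : b' ∈ B) : ∃ h ∈ H, h • a = a' ∧ h • b = b' := by
  have eA := orbit_eq_of_transOn hA iA ha
  have eB := orbit_eq_of_transOn hB iB hb
  have fA : A.Finite := by rw [← eA]; exact Set.finite_range _
  have fB : B.Finite := by rw [← eB]; exact Set.finite_range _
  have h1 : A.ncard ∣ (MulAction.orbit H (a, b)).ncard := by
    rw [← eA, ← MulAction.index_stabilizer, ← MulAction.index_stabilizer]
    apply Subgroup.index_dvd_of_le
    intro g hg
    exact congrArg Prod.fst (hg : g • (a, b) = (a, b))
  have h2 : B.ncard ∣ (MulAction.orbit H (a, b)).ncard := by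
    rw [← eB, ← MulAction.index_stabilizer, ← MulAction.index_stabilizer]
    apply Subgroup.index_dvd_of_le
    intro g hg
    exact congrArg Prod.snd (hg : g • (a, b) = (a, b))
  have h3 := Nat.Coprime.mul_dvd_of_dvd_of_dvd hco h1 h2
  have h4 : MulAction.orbit H (a, b) ⊆ A ×ˢ B := by
    rintro _ ⟨h, rfl⟩
    exact ⟨iA h h.2 a ha, iB h h.2 b hb⟩
  have h5 : MulAction.orbit H (a, b) = A ×ˢ B := by
    apply Set.eq_of_subset_of_ncard_le h4 _ (fA.prod fB)
    rw [Set.ncard_prod]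
    apply Nat.le_of_dvd _ h3
    refine (Set.ncard_pos (Set.finite_range _)).2 ?_
    exact ⟨_, MulAction.mem_orbit_self _⟩
  have h6 : (a', b') ∈ MulAction.orbit H (a, b) := by rw [h5]; exact ⟨ha', hb'⟩
  obtain ⟨h, hh⟩ := h6
  exact ⟨h, h.2, congrArg Prod.fst hh, congrArg Prod.snd hh⟩

theorem transOn_sylow [Finite Γ] {α : Type*} [MulAction Γ α] (S : Sylow 2 Γ) {H : Subgroup Γ}
    (hSH : (S : Subgroup Γ) ≤ H) {T : Set α} (hT : TransOn H T)
    (iT : ∀ h ∈ H, ∀ a ∈ T, h • a ∈ T) {k : ℕ} (hk : T.ncard = 2 ^ k) :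
    TransOn (S : Subgroup Γ) T := by
  intro a ha b hb
  have e1 : ∀ K : Subgroup Γ, (MulAction.orbit K a).ncard =
      (MulAction.stabilizer Γ a).relIndex K := by
    intro K
    rw [← MulAction.index_stabilizer, Subgroup.relIndex]
    congr 1
  have eT := orbit_eq_of_transOn hT iT ha
  have h1 : 2 ^ k = (MulAction.stabilizer Γ a).relIndex H := by rw [← e1, eT, hk]
  set K := MulAction.stabilizer Γ a with hK
  have h2 := Subgroup.relIndex_mul_relIndex (K ⊓ S) (S : Subgroup Γ) H inf_le_right hSH
  have h3 := Subgroup.relIndex_mul_relIndex (K ⊓ S) (K ⊓ H) H (inf_le_inf_left _ hSH) inf_le_right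
  rw [Subgroup.inf_relIndex_right] at h2 h3
  rw [← h3, ← h1] at h2
  have h4 : (2 : ℕ).Coprime ((S : Subgroup Γ).relIndex H) := by
    rw [Nat.Prime.coprime_iff_not_dvd Nat.prime_two]
    intro hd
    exact S.not_dvd_index (hd.trans (Subgroup.relIndex_dvd_index_of_le hSH))
  have h5 : 2 ^ k ∣ K.relIndex (S : Subgroup Γ) := by
    apply (Nat.Coprime.pow_left k h4).dvd_of_dvd_mul_right
    rw [h2]
    exact Dvd.intro_left _ rfl
  have fT : T.Finite := by rw [← eT]; exact Set.finite_range _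
  have h6 : MulAction.orbit (S : Subgroup Γ) a = T := by
    apply Set.eq_of_subset_of_ncard_le _ _ fT
    · rintro _ ⟨h, rfl⟩
      exact iT h (hSH h.2) a ha
    · rw [hk, e1]
      apply Nat.le_of_dvd _ h5
      rw [← e1]
      refine (Set.ncard_pos (Set.finite_range _)).2 ?_
      exact ⟨_, MulAction.mem_orbit_self _⟩
  rw [← h6] at hb
  obtain ⟨h, hh⟩ := hb
  exact ⟨h, h.2, hh⟩

end Action

section Brauer

variable {Γ V V' : Type*} [Group Γ] [AddCommGroup V] [Module (ZMod 2) V] [AddCommGroup V']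
  [Module (ZMod 2) V'] [DistribMulAction Γ V] [DistribMulAction Γ V']
  {p : V →ₗ[ZMod 2] V' →ₗ[ZMod 2] ZMod 2}

/-- The map `x ↦ g x + x`, whose kernel is the fixed space of `g`. -/
def displacement (V : Type*) [AddCommGroup V] [Module (ZMod 2) V] [DistribMulAction Γ V] (g : Γ) :
    V →ₗ[ZMod 2] V :=
  (DistribSMul.toAddMonoidHom V g + AddMonoidHom.id V).toZModLinearMap 2

theorem displacement_apply (g : Γ) (x : V) : displacement V g x = g • x + x := rfl

theorem card_range_mul_card_ker {M N : Type*} [AddCommGroup M] [Module (ZMod 2) M]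
    [AddCommGroup N] [Module (ZMod 2) N] (f : M →ₗ[ZMod 2] N) :
    Nat.card (LinearMap.range f) * Nat.card (LinearMap.ker f) = Nat.card M := by
  rw [Submodule.card_eq_card_quotient_mul_card (LinearMap.ker f),
    Nat.card_congr f.quotKerEquivRange.toEquiv, mul_comm]

variable [Finite V] [Finite V']

theorem card_fixedBy_eq (hp : Nondeg p) (hinv : ∀ (g : Γ) x ξ, p (g • x) (g • ξ) = p x ξ) (g : Γ) :
    Nat.card (MulAction.fixedBy V g) = Nat.card (MulAction.fixedBy V' g) := by
  have h1 := card_range_mul_card_ker (displacement V' g)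
  have h2 := hp.flip.card_mul (LinearMap.range (displacement V' g))
  have h3 : Nat.card (MulAction.fixedBy V g) =
      Nat.card (perpS p.flip (LinearMap.range (displacement V' g) : Set V')) := by
    apply Nat.card_congr
    apply Equiv.setCongr
    ext x
    rw [MulAction.mem_fixedBy]
    constructor
    · rintro hx _ ⟨ξ, rfl⟩
      rw [displacement_apply, LinearMap.flip_apply, map_add]
      nth_rw 1 [← hx]
      rw [hinv, add_self_two]
    · intro hx
      rw [← add_eq_zero_two]
      apply hp.left
      intro ξ
      have := hx _ ⟨g⁻¹ • ξ, rfl⟩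
      rw [displacement_apply, LinearMap.flip_apply, map_add, smul_inv_smul] at this
      rw [map_add, LinearMap.add_apply, add_comm, ← this]
      nth_rw 2 [← smul_inv_smul g ξ]
      rw [hinv]
  have h4 : Nat.card (MulAction.fixedBy V' g) = Nat.card (LinearMap.ker (displacement V' g)) := by
    apply Nat.card_congr
    apply Equiv.setCongr
    ext x
    rw [MulAction.mem_fixedBy, SetLike.mem_coe, LinearMap.mem_ker, displacement_apply,
      add_eq_zero_two]
  rw [h3, h4]
  rw [hp.card_eq, ← h1] at h2
  exact Nat.eq_of_mul_eq_mul_left Nat.card_pos h2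

theorem orbit_transfer [Finite Γ] (hp : Nondeg p)
    (hinv : ∀ (g : Γ) x ξ, p (g • x) (g • ξ) = p x ξ)
    (H : Subgroup Γ) {ι : Type*} [Finite ι] (c : V → ι)
    (hc : ∀ a b, c a = c b → ∃ h ∈ H, h • a = b) (c' : V' → ι) (hs : Function.Surjective c')
    (hi : ∀ h ∈ H, ∀ ξ, c' (h • ξ) = c' ξ) (ξ η : V') (h : c' ξ = c' η) : ∃ h ∈ H, h • ξ = η := by
  classical
  have := Fintype.ofFinite V
  have := Fintype.ofFinite V'
  have := Fintype.ofFinite Γ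
  have := Fintype.ofFinite ι
  let O := Quotient (MulAction.orbitRel H V)
  let O' := Quotient (MulAction.orbitRel H V')
  have : Fintype O := Fintype.ofFinite _
  have : Fintype O' := Fintype.ofFinite _
  have b1 := MulAction.sum_card_fixedBy_eq_card_orbits_mul_card_group H V
  have b2 := MulAction.sum_card_fixedBy_eq_card_orbits_mul_card_group H V'
  have b3 : Fintype.card O = Fintype.card O' := by
    have : ∀ g : H, Fintype.card (MulAction.fixedBy V g) = Fintype.card (MulAction.fixedBy V' g) := by
      intro g
      rw [← Nat.card_eq_fintype_card, ← Nat.card_eq_fintype_card]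
      exact card_fixedBy_eq hp hinv (g : Γ)
    rw [Finset.sum_congr rfl (fun g _ => this g), b2] at b1
    exact (Nat.eq_of_mul_eq_mul_right Fintype.card_pos b1).symm
  have b4 : Fintype.card O ≤ Fintype.card ι := by
    apply Fintype.card_le_of_injective (fun o : O => c o.out)
    intro o o' hoo
    obtain ⟨g, hg, e⟩ := hc _ _ hoo
    rw [← Quotient.out_eq o, ← Quotient.out_eq o']
    apply Quotient.sound
    exact ⟨⟨g, hg⟩⁻¹, by rw [← e]; exact inv_smul_smul (⟨g, hg⟩ : H) _⟩
  let f : O' → ι := Quotient.lift c' (by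
    rintro a b ⟨g, rfl⟩
    exact hi g g.2 b)
  have b5 : Function.Surjective f := by
    intro i
    obtain ⟨ξ, rfl⟩ := hs i
    exact ⟨Quotient.mk _ ξ, rfl⟩
  have b6 : Function.Bijective f := by
    rw [Fintype.bijective_iff_surjective_and_card]
    exact ⟨b5, le_antisymm (b3 ▸ b4) (Fintype.card_le_of_surjective f b5)⟩
  have b7 : (Quotient.mk _ η : O') = Quotient.mk _ ξ := b6.1 h.symm
  obtain ⟨g, hg⟩ := Quotient.exact b7
  exact ⟨g, g.2, hg⟩

end Brauer

section Fourier

variable {V V' : Type*} [AddCommGroup V] [Module (ZMod 2) V] [AddCommGroup V']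
  [Module (ZMod 2) V'] {p : V →ₗ[ZMod 2] V' →ₗ[ZMod 2] ZMod 2} [Fintype V] [Fintype V']

theorem Nondeg.sum_signChar (hp : Nondeg p) [DecidableEq V] (v : V) :
    ∑ ξ, signChar (p v ξ) = if v = 0 then (Nat.card V : ℤ) else 0 := by
  split_ifs with h
  · subst h
    simp only [map_zero, LinearMap.zero_apply, signChar_zero, hp.card_eq]
    simp
  · obtain ⟨ξ, hξ⟩ := hp.exists_one h
    have := Fintype.sum_equiv (Equiv.addRight ξ) (fun η => signChar (p v (η + ξ)))
      (fun η => signChar (p v η)) (fun η => by simp)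
    simp only [map_add, signChar_add, hξ, signChar_one] at this
    rw [← Finset.sum_mul] at this
    linarith

theorem Nondeg.fourier_inversion (hp : Nondeg p) (f : V → ℤ) (u : V) :
    ∑ ξ, (∑ v, f v * signChar (p v ξ)) * signChar (p u ξ) = Nat.card V * f u := by
  classical
  simp only [Finset.sum_mul, mul_assoc, ← signChar_add, ← LinearMap.add_apply, ← map_add]
  rw [Finset.sum_comm]
  simp only [← Finset.mul_sum, hp.sum_signChar, add_eq_zero_two]
  simp [mul_comm]

end Fourier

section Translation

variable {V V' : Type*} [AddCommGroup V] [Module (ZMod 2) V] [AddCommGroup V']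
  [Module (ZMod 2) V'] {p : V →ₗ[ZMod 2] V' →ₗ[ZMod 2] ZMod 2} [Finite V] [Finite V']

theorem exists_translation {Γ : Type*} [Group Γ] [DistribMulAction Γ V] [DistribMulAction Γ V']
    (hp : Nondeg p) (hinv : ∀ (g : Γ) x ξ, p (g • x) (g • ξ) = p x ξ)
    (H : Subgroup Γ) (E : Submodule (ZMod 2) V) (hE : ∀ h ∈ H, ∀ e ∈ E, h • e = e)
    (htr : ∀ ξ ξ', (∀ e ∈ E, p e ξ = p e ξ') → (∃ e ∈ E, p e ξ ≠ 0) → ∃ h ∈ H, h • ξ = ξ')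
    {w : V} (hw : w ∉ E) {e : V} (he : e ∈ E) : ∃ h ∈ H, h • w = w + e := by
  classical
  have := Fintype.ofFinite V
  have := Fintype.ofFinite V'
  let f : V → ℤ := fun v => if ∃ h ∈ H, h • w = v then 1 else 0
  let F : V' → ℤ := fun ξ => ∑ v, f v * signChar (p v ξ)
  have hf : ∀ h ∈ H, ∀ v, f (h • v) = f v := by
    intro h hh v
    have : (∃ k ∈ H, k • w = h • v) ↔ ∃ k ∈ H, k • w = v := by
      constructor
      · rintro ⟨k, hk, e⟩
        exact ⟨h⁻¹ * k, H.mul_mem (H.inv_mem hh) hk, by rw [mul_smul, e, inv_smul_smul]⟩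
      · rintro ⟨k, hk, e⟩
        exact ⟨h * k, H.mul_mem hh hk, by rw [mul_smul, e]⟩
    simp only [f, this]
  have hF : ∀ h ∈ H, ∀ ξ, F (h • ξ) = F ξ := by
    intro h hh ξ
    exact (Fintype.sum_equiv (MulAction.toPerm h) (fun v => f v * signChar (p v ξ)) _
      (fun v => by simp [hf h hh, hinv])).symm
  have hF0 : ∀ ξ, (∃ e ∈ E, p e ξ ≠ 0) → F ξ = 0 := by
    intro ξ hξ
    have h1 : ∑ η : perpS p (E : Set V), F (ξ + η) = 0 := by
      simp only [F, map_add, signChar_add]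
      rw [Finset.sum_comm]
      apply Finset.sum_eq_zero
      intro v _
      rw [← Finset.mul_sum, ← Finset.mul_sum, sum_signChar (perpS p (E : Set V)) (p v)]
      by_cases hv : ∃ h ∈ H, h • w = v
      · rw [if_neg]
        · simp
        · intro hc
          have : v ∈ E := by
            rw [← hp.perp_perp E]
            exact hc
          obtain ⟨h, hh, rfl⟩ := hv
          apply hw
          have := hE h⁻¹ (H.inv_mem hh) _ this
          rw [inv_smul_smul] at this
          rwa [this]
      · simp [f, hv]
    have h2 : ∀ η : perpS p (E : Set V), F (ξ + η) = F ξ := by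
      intro η
      obtain ⟨h, hh, e⟩ := htr ξ (ξ + η) (fun e he => by
        rw [map_add, η.2 e he, add_zero]) hξ
      rw [← e, hF h hh]
    rw [Finset.sum_congr rfl (fun η _ => h2 η), Finset.sum_const, nsmul_eq_mul] at h1
    rcases mul_eq_zero.1 h1 with h | h
    · simp at h
    · exact h
  have h3 : (Nat.card V : ℤ) * f (w + e) = Nat.card V * f w := by
    rw [← hp.fourier_inversion f, ← hp.fourier_inversion f]
    apply Finset.sum_congr rfl
    intro ξ _
    by_cases hξ : ∃ e ∈ E, p e ξ ≠ 0
    · have := hF0 ξ hξ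
      simp only [F] at this
      rw [this, zero_mul, zero_mul]
    · push Not at hξ
      rw [map_add, LinearMap.add_apply, hξ e he, add_zero]
  have h4 : f w = 1 := if_pos ⟨1, H.one_mem, one_smul _ _⟩
  have h5 : f (w + e) = 1 := by
    rw [h4] at h3
    apply mul_left_cancel₀ _ h3
    have : 0 < Nat.card V := Nat.card_pos
    positivity
  by_contra hc
  simp [f, hc] at h5

theorem mem_of_count_const (hp : Nondeg p) (A : Submodule (ZMod 2) V) (P : Set V)
    (hPA : ∀ y ∈ P, ∀ a ∈ A, y + a ∈ P) (hdis : ∀ y ∈ P, y ∉ A) (hne : P.Nonempty) (c : ℕ)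
    (hc : ∀ η, (∀ a ∈ A, p a η = 0) → (∃ y ∈ P, p y η = 1) → {y ∈ P | p y η = 1}.ncard = c)
    {u : V} (hu : u ∉ A) (hu' : ∀ η, (∀ y ∈ P, p y η = 0) → (∀ a ∈ A, p a η = 0) → p u η = 0) :
    u ∈ P := by
  classical
  have := Fintype.ofFinite V
  have := Fintype.ofFinite V'
  let f : V → ℤ := fun v => if v ∈ P then 1 else 0
  let F : V' → ℤ := fun ξ => ∑ v, f v * signChar (p v ξ)
  have hF0 : ∀ ξ, ξ ∉ perpS p (A : Set V) → F ξ = 0 := by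
    intro ξ hξ
    rw [mem_perpS] at hξ
    push Not at hξ
    obtain ⟨a, ha, h1⟩ := hξ
    rw [zmod_two_ne_zero] at h1
    have hfa : ∀ v, f (v + a) = f v := by
      intro v
      have : v + a ∈ P ↔ v ∈ P := by
        constructor
        · intro h
          have := hPA _ h a ha
          rwa [add_add_cancel_two] at this
        · intro h
          exact hPA _ h a ha
      simp only [f, this]
    have := Fintype.sum_equiv (Equiv.addRight a) (fun v => f (v + a) * signChar (p (v + a) ξ))
      (fun v => f v * signChar (p v ξ)) (fun v => by simp)
    simp only [map_add, LinearMap.add_apply, signChar_add, h1, signChar_one, hfa, ← mul_assoc] at this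
    rw [← Finset.sum_mul] at this
    change F ξ * -1 = F ξ at this
    linarith
  let D : Submodule (ZMod 2) V' := perpS p (P ∪ A)
  have hFD : ∀ ξ ∈ D, F ξ = P.ncard := by
    intro ξ hξ
    rw [Set.ncard_eq_toFinset_card']
    simp only [F, f, ite_mul, one_mul, zero_mul, ← Finset.sum_filter]
    rw [Finset.sum_congr rfl (g := fun _ => 1)]
    · simp [Set.toFinset]
    · intro v hv
      rw [hξ v (Or.inl (Finset.mem_filter.1 hv).2), signChar_zero]
  have hFs : ∀ ξ ∈ perpS p (A : Set V), ξ ∉ D → F ξ = P.ncard - 2 * c := by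
    intro ξ hξ hD
    have h1 : ∃ y ∈ P, p y ξ = 1 := by
      by_contra hcon
      push Not at hcon
      apply hD
      rintro y (hy | hy)
      · exact zmod_two_ne_one.1 (hcon y hy)
      · exact hξ y hy
    rw [← hc ξ hξ h1, Set.ncard_eq_toFinset_card', Set.ncard_eq_toFinset_card']
    simp only [F, f, ite_mul, one_mul, zero_mul, ← Finset.sum_filter]
    have : ∀ a : ZMod 2, signChar a = 1 - 2 * (if a = 1 then 1 else 0) := by decide
    simp only [this, Finset.sum_sub_distrib, ← Finset.mul_sum, ← Finset.sum_filter,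
      Finset.filter_filter]
    simp [Set.toFinset, Fintype.card_subtype]
  have key : ∀ u, u ∉ A → u ∈ perpS p.flip D → (Nat.card V : ℤ) * f u = 2 * c * Nat.card D := by
    intro u hu hu'
    rw [← hp.fourier_inversion f]
    change ∑ ξ, F ξ * signChar (p u ξ) = _
    have e1 : ∀ ξ, F ξ * signChar (p u ξ) =
        (if ξ ∈ perpS p (A : Set V) then (P.ncard - 2 * c : ℤ) * signChar (p u ξ) else 0) +
        if ξ ∈ D then (2 * c : ℤ) else 0 := by
      intro ξ
      by_cases h1 : ξ ∈ D
      · have h2 : ξ ∈ perpS p (A : Set V) := perpS_anti Set.subset_union_right h1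
        rw [hFD ξ h1, if_pos h2, if_pos h1, show p u ξ = 0 from hu' ξ h1, signChar_zero]
        ring
      · by_cases h2 : ξ ∈ perpS p (A : Set V)
        · rw [hFs ξ h2 h1, if_pos h2, if_neg h1, add_zero]
        · rw [hF0 ξ h2, if_neg h2, if_neg h1, zero_mul, add_zero]
    rw [Finset.sum_congr rfl (fun ξ _ => e1 ξ), Finset.sum_add_distrib, ← Finset.sum_filter,
      ← Finset.sum_filter, ← Finset.mul_sum]
    have e2 : ∑ ξ ∈ Finset.univ.filter (· ∈ perpS p (A : Set V)), signChar (p u ξ) = 0 := by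
      rw [Finset.sum_subtype (p := (· ∈ perpS p (A : Set V))) _ (fun x => by simp),
        sum_signChar (perpS p (A : Set V)) (p u), if_neg]
      intro hcon
      apply hu
      rw [← hp.perp_perp A]
      exact hcon
    have e3 : (Finset.univ.filter (· ∈ D)).card = Nat.card D := by
      rw [Nat.card_eq_fintype_card, Fintype.card_subtype]
    rw [e2, mul_zero, zero_add, Finset.sum_const, nsmul_eq_mul, mul_comm, e3]
  obtain ⟨y, hy⟩ := hne
  have hcard : 0 < Nat.card V := Nat.card_pos
  have h1 := key y (hdis y hy) (mem_perpS.2 fun ξ hξ => hξ y (Or.inl hy))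
  have h2 := key u hu (mem_perpS.2 fun ξ hξ => hu' ξ (fun y hy => hξ y (Or.inl hy))
    (fun a ha => hξ a (Or.inr ha)))
  rw [← h1] at h2
  have h3 : f u = f y := by
    apply mul_left_cancel₀ _ h2
    positivity
  have h4 : f y = 1 := if_pos hy
  by_contra hcon
  simp [f, hcon, hy] at h3

end Translation

section Span

variable {V V' : Type*} [AddCommGroup V] [Module (ZMod 2) V] [AddCommGroup V']
  [Module (ZMod 2) V'] {p : V →ₗ[ZMod 2] V' →ₗ[ZMod 2] ZMod 2}

theorem perpS_span (s : Set V) : perpS p (Submodule.span (ZMod 2) s : Set V) = perpS p s := by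
  apply le_antisymm (perpS_anti Submodule.subset_span)
  intro ξ hξ x hx
  have : Submodule.span (ZMod 2) s ≤ LinearMap.ker (p.flip ξ) :=
    Submodule.span_le.2 fun y hy => hξ y hy
  exact this hx

theorem Nondeg.perp_perp_set [Finite V] [Finite V'] (hp : Nondeg p) (s : Set V) :
    perpS p.flip (perpS p s : Set V') = Submodule.span (ZMod 2) s := by
  rw [← perpS_span s, hp.perp_perp]

theorem card_span_one {x : V} (hx : x ≠ 0) : Nat.card (Submodule.span (ZMod 2) {x}) = 2 := by
  have : (Submodule.span (ZMod 2) {x} : Set V) = {0, x} := by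
    ext y
    simp [mem_span_one]
  rw [← SetLike.coe_sort_coe, this, Nat.card_coe_set_eq, Set.ncard_pair hx.symm]

theorem card_span_two {x y : V} (hx : x ≠ 0) (hy : y ≠ 0) (hxy : x ≠ y) :
    Nat.card (Submodule.span (ZMod 2) {x, y}) = 4 := by
  classical
  have : (Submodule.span (ZMod 2) {x, y} : Set V) = (({0, x, y, x + y} : Finset V) : Set V) := by
    ext z
    simp [mem_span_two]
  rw [← SetLike.coe_sort_coe, this, Nat.card_coe_set_eq, Set.ncard_coe_finset]
  rw [Finset.card_insert_of_notMem, Finset.card_insert_of_notMem, Finset.card_pair]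
  · simpa using hx
  · simp [hxy, hy]
  · simp only [Finset.mem_insert, Finset.mem_singleton, not_or]
    refine ⟨hx.symm, hy.symm, fun h => hxy (add_eq_zero_two.1 h.symm)⟩

theorem exists_mem_notMem [Finite V] {A B : Submodule (ZMod 2) V} (h : Nat.card A < Nat.card B) :
    ∃ b ∈ B, b ∉ A := by
  by_contra hc
  push Not at hc
  exact absurd (card_submodule_mono (show B ≤ A from hc)) (by omega)

theorem Nondeg.two_mul_card_perp_one [Finite V] [Finite V'] (hp : Nondeg p) {x : V} (hx : x ≠ 0) :
    2 * Nat.card (perpS p {x}) = Nat.card V := by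
  rw [hp.card_eq, ← hp.card_mul (Submodule.span (ZMod 2) {x}), card_span_one hx, perpS_span]

theorem Nondeg.four_mul_card_perp_two [Finite V] [Finite V'] (hp : Nondeg p) {x y : V}
    (hx : x ≠ 0) (hy : y ≠ 0) (hxy : x ≠ y) :
    4 * Nat.card (perpS p {x, y}) = Nat.card V := by
  rw [hp.card_eq, ← hp.card_mul (Submodule.span (ZMod 2) {x, y}), card_span_two hx hy hxy,
    perpS_span]

theorem mem_perpS_one {x : V} {ξ : V'} : ξ ∈ perpS p {x} ↔ p x ξ = 0 := by
  simp [mem_perpS]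

theorem mem_perpS_two {x y : V} {ξ : V'} : ξ ∈ perpS p {x, y} ↔ p x ξ = 0 ∧ p y ξ = 0 := by
  simp [mem_perpS]

end Span

/-- A group acting on a pair of dual spaces of dimension at least three, transitively on ordered
pairs of distinct nonzero vectors of either space. -/
structure TwoTrans (Γ : Type*) {V V' : Type*} [Group Γ] [AddCommGroup V] [Module (ZMod 2) V]
    [AddCommGroup V'] [Module (ZMod 2) V'] [DistribMulAction Γ V] [DistribMulAction Γ V']
    (p : V →ₗ[ZMod 2] V' →ₗ[ZMod 2] ZMod 2) (N : ℕ) : Prop where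
  nondeg : Nondeg p
  inv : ∀ (g : Γ) x ξ, p (g • x) (g • ξ) = p x ξ
  card : Nat.card V = 2 ^ N
  le : 3 ≤ N
  pair : ∀ x y x' y' : V, x ≠ 0 → y ≠ 0 → x ≠ y → x' ≠ 0 → y' ≠ 0 → x' ≠ y' →
    ∃ g : Γ, g • x = x' ∧ g • y = y'
  pair' : ∀ x y x' y' : V', x ≠ 0 → y ≠ 0 → x ≠ y → x' ≠ 0 → y' ≠ 0 → x' ≠ y' →
    ∃ g : Γ, g • x = x' ∧ g • y = y'
  flag : ∀ (x x' : V) (ξ ξ' : V'), x ≠ 0 → x' ≠ 0 → ξ ≠ 0 → ξ' ≠ 0 → p x ξ = p x' ξ' →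
    ∃ g : Γ, g • x = x' ∧ g • ξ = ξ'

section TwoTrans

variable {Γ V V' : Type*} [Group Γ] [AddCommGroup V] [Module (ZMod 2) V]
    [AddCommGroup V'] [Module (ZMod 2) V'] [DistribMulAction Γ V] [DistribMulAction Γ V']
    {p : V →ₗ[ZMod 2] V' →ₗ[ZMod 2] ZMod 2} {N : ℕ} [Finite Γ] [Finite V] [Finite V']

theorem TwoTrans.flip (h : TwoTrans Γ p N) : TwoTrans Γ p.flip N where
  nondeg := h.nondeg.flip
  inv g x ξ := h.inv g ξ x
  card := by rw [← h.nondeg.card_eq, h.card]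
  le := h.le
  pair := h.pair'
  pair' := h.pair
  flag x x' ξ ξ' h1 h2 h3 h4 h5 := by
    obtain ⟨g, a, b⟩ := h.flag ξ ξ' x x' h3 h4 h1 h2 h5
    exact ⟨g, b, a⟩

theorem exists_ne_two (hc : 4 ≤ Nat.card V) (x : V) : ∃ y, y ≠ 0 ∧ y ≠ x := by
  by_contra hcon
  push Not at hcon
  have h1 : (Set.univ : Set V) ⊆ {0, x} := by
    intro y _
    by_cases hy : y = 0
    · simp [hy]
    · simp [hcon y hy]
  have h2 := Set.ncard_le_ncard h1
  have h3 : ({0, x} : Set V).ncard ≤ 2 := Set.ncard_insert_le _ _ |>.trans (by simp)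
  rw [Set.ncard_univ] at h2
  omega

theorem smul_ne_zero_iff' {g : Γ} {x : V} : g • x ≠ 0 ↔ x ≠ 0 := by
  rw [not_iff_not]
  constructor
  · intro h
    rw [← inv_smul_smul g x, h, smul_zero]
  · rintro rfl
    exact smul_zero g

theorem TwoTrans.of_pair (hp : Nondeg p) (hinv : ∀ (g : Γ) x ξ, p (g • x) (g • ξ) = p x ξ)
    (hcard : Nat.card V = 2 ^ N) (hN : 3 ≤ N)
    (pair : ∀ x y x' y' : V, x ≠ 0 → y ≠ 0 → x ≠ y → x' ≠ 0 → y' ≠ 0 → x' ≠ y' →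
      ∃ g : Γ, g • x = x' ∧ g • y = y') : TwoTrans Γ p N := by
  classical
  have h8 : 8 ≤ Nat.card V := by
    rw [hcard]
    calc 8 = 2 ^ 3 := by norm_num
      _ ≤ 2 ^ N := Nat.pow_le_pow_right (by norm_num) hN
  have one : ∀ x x' : V, x ≠ 0 → x' ≠ 0 → ∃ g : Γ, g • x = x' := by
    intro x x' hx hx'
    obtain ⟨y, hy, hyx⟩ := exists_ne_two (by omega) x
    obtain ⟨y', hy', hyx'⟩ := exists_ne_two (by omega) x'
    obtain ⟨g, hg, -⟩ := pair x y x' y' hx hy hyx.symm hx' hy' hyx'.symm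
    exact ⟨g, hg⟩
  have flag1 : ∀ (x : V) (ξ ξ' : V'), x ≠ 0 → ξ ≠ 0 → ξ' ≠ 0 → p x ξ = p x ξ' →
      ∃ g ∈ MulAction.stabilizer Γ x, g • ξ = ξ' := by
    intro x ξ ξ' hx hξ hξ' he
    refine orbit_transfer (ι := Fin 3) hp hinv (MulAction.stabilizer Γ x)
      (fun v => if v = 0 then 0 else if v = x then 1 else 2) ?_
      (fun ξ => if ξ = 0 then 0 else if p x ξ = 0 then 1 else 2) ?_ ?_ ξ ξ' ?_
    · intro a b hab
      by_cases ha : a = 0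
      · subst ha
        refine ⟨1, one_mem _, ?_⟩
        by_cases hb : b = 0
        · simp [hb]
        · by_cases hbx : b = x <;> simp [hb, hbx, hx] at hab
      by_cases hax : a = x
      · subst hax
        refine ⟨1, one_mem _, ?_⟩
        by_cases hb : b = 0
        · simp [hb, hx] at hab
        · by_cases hbx : b = a <;> simp [hb, hbx, hx] at hab ⊢
      by_cases hb : b = 0
      · simp [ha, hax, hb] at hab
      by_cases hbx : b = x
      · simp [ha, hax, hbx, hx] at hab
      obtain ⟨g, h1, h2⟩ := pair x a x b hx ha (Ne.symm hax) hx hb (Ne.symm hbx)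
      exact ⟨g, h1, h2⟩
    · intro i
      fin_cases i
      · exact ⟨0, by simp⟩
      · have := hp.two_mul_card_perp_one hx
        obtain ⟨ξ, h1, h2⟩ := exists_mem_notMem (A := (⊥ : Submodule (ZMod 2) V'))
          (B := perpS p {x}) (by simp only [Nat.card_unique]; omega)
        have h3 : ξ ≠ 0 := h2
        exact ⟨ξ, by simp [h3, mem_perpS_one.1 h1]⟩
      · obtain ⟨ξ, hξ⟩ := hp.exists_one hx
        have h3 : ξ ≠ 0 := by rintro rfl; simp at hξ
        exact ⟨ξ, by simp [h3, hξ]⟩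
    · intro h hh η
      have h1 : h • x = x := hh
      have h2 : p x (h • η) = p x η := by
        conv_lhs => rw [← h1]
        rw [hinv]
      have h3 : h • η = 0 ↔ η = 0 := not_iff_not.1 smul_ne_zero_iff'
      simp only [h2, h3]
    · simp [hξ, hξ', he]
  have flag : ∀ (x x' : V) (ξ ξ' : V'), x ≠ 0 → x' ≠ 0 → ξ ≠ 0 → ξ' ≠ 0 → p x ξ = p x' ξ' →
      ∃ g : Γ, g • x = x' ∧ g • ξ = ξ' := by
    intro x x' ξ ξ' hx hx' hξ hξ' he
    obtain ⟨g, hg⟩ := one x x' hx hx'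
    obtain ⟨k, hk, e⟩ := flag1 x' (g • ξ) ξ' hx' (smul_ne_zero_iff'.2 hξ) hξ' (by
      conv_lhs => rw [← hg]
      rw [hinv, he])
    refine ⟨k * g, ?_, ?_⟩
    · rw [mul_smul, hg]; exact hk
    · rw [mul_smul, e]
  have one' : ∀ ξ ξ' : V', ξ ≠ 0 → ξ' ≠ 0 → ∃ g : Γ, g • ξ = ξ' := by
    intro ξ ξ' hξ hξ'
    obtain ⟨x, hx⟩ := hp.flip.exists_one hξ
    obtain ⟨x', hx'⟩ := hp.flip.exists_one hξ'
    rw [LinearMap.flip_apply] at hx hx'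
    obtain ⟨g, -, hg⟩ := flag x x' ξ ξ' (by rintro rfl; simp at hx) (by rintro rfl; simp at hx')
      hξ hξ' (by rw [hx, hx'])
    exact ⟨g, hg⟩
  refine ⟨hp, hinv, hcard, hN, pair, ?_, flag⟩
  intro ξ η ξ' η' hξ hη hne hξ' hη' hne'
  obtain ⟨g, hg⟩ := one' ξ ξ' hξ hξ'
  have : ∃ k ∈ MulAction.stabilizer Γ ξ', k • (g • η) = η' := by
    refine orbit_transfer (ι := Fin 3) hp hinv (MulAction.stabilizer Γ ξ')
      (fun v => if v = 0 then 0 else if p v ξ' = 0 then 1 else 2) ?_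
      (fun ξ => if ξ = 0 then 0 else if ξ = ξ' then 1 else 2) ?_ ?_ _ _ ?_
    · intro a b hab
      by_cases ha : a = 0
      · subst ha
        refine ⟨1, one_mem _, ?_⟩
        by_cases hb : b = 0
        · simp [hb]
        · by_cases hbx : p b ξ' = 0 <;> simp [hb, hbx] at hab
      by_cases hb : b = 0
      · by_cases hax : p a ξ' = 0 <;> simp [ha, hb, hax] at hab
      have : p a ξ' = p b ξ' := by
        rcases zmod_two_cases (p a ξ') with h1 | h1 <;> rcases zmod_two_cases (p b ξ') with h2 | h2
          <;> simp [ha, hb, h1, h2] at hab ⊢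
      obtain ⟨k, h1, h2⟩ := flag a b ξ' ξ' ha hb hξ' hξ' this
      exact ⟨k, h2, h1⟩
    · intro i
      fin_cases i
      · exact ⟨0, by simp⟩
      · exact ⟨ξ', by simp [hξ']⟩
      · obtain ⟨ζ, h1, h2⟩ := exists_ne_two (V := V') (by rw [← hp.card_eq]; omega) ξ'
        exact ⟨ζ, by simp [h1, h2]⟩
    · intro k hk ζ
      have h1 : k • ξ' = ξ' := hk
      have h2 : k • ζ = 0 ↔ ζ = 0 := not_iff_not.1 smul_ne_zero_iff'
      have h3 : k • ζ = ξ' ↔ ζ = ξ' := by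
        conv_lhs => rw [← h1]
        exact smul_left_cancel_iff k
      simp only [h2, h3]
    · have h1 : g • η ≠ 0 := smul_ne_zero_iff'.2 hη
      have h2 : g • η ≠ ξ' := by
        rw [← hg]
        exact fun h => hne (smul_left_cancel g h).symm
      simp [h1, h2, hη', hne'.symm]
  obtain ⟨k, hk, e⟩ := this
  refine ⟨k * g, ?_, by rw [mul_smul, e]⟩
  rw [mul_smul, hg]
  exact hk

end TwoTrans

theorem dvd_ncard_of_orbits {S α : Type*} [Group S] [MulAction S α] (m : ℕ) :
    ∀ (n : ℕ) (T : Set α), T.Finite → T.ncard = n → (∀ s : S, ∀ a ∈ T, s • a ∈ T) →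
      (∀ a ∈ T, m ∣ (MulAction.orbit S a).ncard) → m ∣ T.ncard := by
  intro n
  induction n using Nat.strong_induction_on with
  | _ n ih =>
    intro T hf hn hi hd
    rcases T.eq_empty_or_nonempty with rfl | ⟨a, ha⟩
    · simp
    have hsub : MulAction.orbit S a ⊆ T := by
      rintro _ ⟨s, rfl⟩
      exact hi s a ha
    rw [← Set.ncard_sdiff_add_ncard_of_subset hsub hf]
    refine dvd_add ?_ (hd a ha)
    have hlt : (T \ MulAction.orbit S a).ncard < n := by
      rw [← hn]
      apply Set.ncard_lt_ncard _ hf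
      refine ⟨Set.sdiff_subset, fun h => (h ha).2 (MulAction.mem_orbit_self a)⟩
    refine ih _ hlt _ (hf.subset Set.sdiff_subset) rfl ?_ (fun b hb => hd b hb.1)
    rintro s b ⟨hb, hb'⟩
    refine ⟨hi s b hb, fun h => hb' ?_⟩
    obtain ⟨t, ht⟩ := h
    exact ⟨s⁻¹ * t, by
      change (s⁻¹ * t) • a = b
      rw [mul_smul, show t • a = s • b from ht, inv_smul_smul]⟩

theorem exists_small_orbit {S α : Type*} [Group S] [Finite S] [MulAction S α]
    (hS : IsPGroup 2 S) (T : Set α) (hf : T.Finite) (hi : ∀ s : S, ∀ a ∈ T, s • a ∈ T) (k : ℕ)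
    (hk : ¬ 2 ^ (k + 1) ∣ T.ncard) : ∃ a ∈ T, (MulAction.orbit S a).ncard ∣ 2 ^ k := by
  by_contra hc
  push Not at hc
  apply hk
  apply dvd_ncard_of_orbits (2 ^ (k + 1)) _ T hf rfl hi
  intro a ha
  have h1 := hc a ha
  obtain ⟨j, hj⟩ := hS.exists_card_eq
  have h2 : (MulAction.orbit S a).ncard ∣ 2 ^ j := by
    rw [← hj, ← MulAction.index_stabilizer]
    exact Subgroup.index_dvd_card _
  obtain ⟨i, -, h3⟩ := (Nat.dvd_prime_pow Nat.prime_two).1 h2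
  rw [h3] at h1 ⊢
  apply pow_dvd_pow
  by_contra hlt
  exact h1 (pow_dvd_pow _ (by omega))

theorem smul_eq_of_ncard_orbit {S α : Type*} [Group S] [MulAction S α] {a : α}
    (ha : (MulAction.orbit S a).ncard ∣ 2 ^ 0) (s : S) : s • a = a := by
  rw [pow_zero, Nat.dvd_one, Set.ncard_eq_one] at ha
  obtain ⟨b, hb⟩ := ha
  have h1 : s • a ∈ MulAction.orbit S a := MulAction.mem_orbit a s
  have h2 : a ∈ MulAction.orbit S a := MulAction.mem_orbit_self a
  rw [hb] at h1 h2
  rw [Set.mem_singleton_iff] at h1 h2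
  rw [h1, ← h2]

section TwoTrans

variable {Γ V V' : Type*} [Group Γ] [AddCommGroup V] [Module (ZMod 2) V]
    [AddCommGroup V'] [Module (ZMod 2) V'] [DistribMulAction Γ V] [DistribMulAction Γ V']
    {p : V →ₗ[ZMod 2] V' →ₗ[ZMod 2] ZMod 2} {N : ℕ} [Finite Γ] [Finite V] [Finite V']

theorem ncard_submodule (A : Submodule (ZMod 2) V) : (A : Set V).ncard = Nat.card A := rfl

theorem ncard_ker_of_ne (h : TwoTrans Γ p N) {ξ : V'} (hξ : ξ ≠ 0) :
    {x | p x ξ = 0}.ncard = 2 ^ (N - 1) := by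
  have h1 := h.nondeg.flip.two_mul_card_perp_one hξ
  have h2 : {x | p x ξ = 0} = (perpS p.flip {ξ} : Set V) := by
    ext x
    exact (mem_perpS_one (p := p.flip)).symm
  have h3 := h.le
  rw [h2, ncard_submodule]
  rw [h.flip.card, show N = (N - 1) + 1 by omega, pow_succ] at h1
  omega

theorem ncard_compl_ker_of_ne (h : TwoTrans Γ p N) {ξ : V'} (hξ : ξ ≠ 0) :
    {x | p x ξ = 1}.ncard = 2 ^ (N - 1) := by
  have h1 := ncard_ker_of_ne h hξ
  have h2 := Set.ncard_add_ncard_compl {x | p x ξ = 0}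
  have h3 : {x | p x ξ = 0}ᶜ = {x | p x ξ = 1} := by
    ext x
    simp [zmod_two_ne_zero]
  have h4 := h.le
  rw [h3, h.card, h1] at h2
  have h5 : 2 ^ N = 2 ^ (N - 1) + 2 ^ (N - 1) := by
    rw [← two_mul, ← pow_succ']
    congr 1
    omega
  omega

theorem exists_sylow_flag (h : TwoTrans Γ p N) : ∃ (S : Sylow 2 Γ) (x y : V) (ξ : V'),
    x ≠ 0 ∧ y ≠ 0 ∧ x ≠ y ∧ ξ ≠ 0 ∧ p x ξ = 0 ∧ p y ξ = 0 ∧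
    ∀ s ∈ S, s • x = x ∧ s • ξ = ξ ∧ (s • y = y ∨ s • y = y + x) := by
  classical
  have hN := h.le
  obtain ⟨M, rfl⟩ : ∃ M, N = M + 3 := ⟨N - 3, by omega⟩
  let S : Sylow 2 Γ := default
  have hS : IsPGroup 2 (S : Subgroup Γ) := S.isPGroup'
  have hinv : ∀ (s : (S : Subgroup Γ)) (x : V) (ξ : V'), p (s • x) (s • ξ) = p x ξ :=
    fun s x ξ => h.inv s x ξ
  obtain ⟨ξ, hξ, hξo⟩ := exists_small_orbit hS ({0}ᶜ : Set V') (Set.toFinite _)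
    (fun s a ha => by
      simp only [Set.mem_compl_iff, Set.mem_singleton_iff] at ha ⊢
      exact fun hc => ha (by rw [← inv_smul_smul s a, hc, smul_zero])) 0 (by
      have := Set.ncard_add_ncard_compl ({0} : Set V')
      rw [h.flip.card, Set.ncard_singleton, pow_succ] at this
      omega)
  have hξf := smul_eq_of_ncard_orbit hξo
  have hξ : ξ ≠ 0 := hξ
  have hker := ncard_ker_of_ne h hξ
  rw [show M + 3 - 1 = M + 2 by omega] at hker
  have hkinv : ∀ (s : (S : Subgroup Γ)) (x : V), p (s • x) ξ = p x ξ := by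
    intro s x
    conv_lhs => rw [← hξf s]
    exact hinv s x ξ
  obtain ⟨x, ⟨hxξ, hx⟩, hxo⟩ := exists_small_orbit hS ({x | p x ξ = 0} \ {0}) (Set.toFinite _)
    (fun s a ha => by
      refine ⟨(hkinv s a).trans ha.1, ?_⟩
      have ha := ha.2
      simp only [Set.mem_singleton_iff] at ha ⊢
      exact fun hc => ha (by rw [← inv_smul_smul s a, hc, smul_zero])) 0 (by
      have := Set.ncard_sdiff_singleton_add_one (s := {x | p x ξ = 0}) (a := 0) (by simp)
      rw [hker, pow_succ] at this
      omega)
  have hxf := smul_eq_of_ncard_orbit hxo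
  have hx : x ≠ 0 := hx
  have hxξ : p x ξ = 0 := hxξ
  obtain ⟨y, ⟨⟨hyξ, hy⟩, hyx⟩, hyo⟩ := exists_small_orbit hS (({x | p x ξ = 0} \ {0}) \ {x})
    (Set.toFinite _) (fun s a ha => by
      refine ⟨⟨(hkinv s a).trans ha.1.1, ?_⟩, ?_⟩
      · have ha := ha.1.2
        simp only [Set.mem_singleton_iff] at ha ⊢
        exact fun hc => ha (by rw [← inv_smul_smul s a, hc, smul_zero])
      · have ha := ha.2
        simp only [Set.mem_singleton_iff] at ha ⊢
        exact fun hc => ha (by rw [← inv_smul_smul s a, hc, ← hxf s, inv_smul_smul, hxf])) 1 (by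
      have h1 := Set.ncard_sdiff_singleton_add_one (s := {x | p x ξ = 0}) (a := 0) (by simp)
      have h2 := Set.ncard_sdiff_singleton_add_one (s := {x | p x ξ = 0} \ {0}) (a := x)
        ⟨hxξ, hx⟩
      rw [hker, pow_add] at h1
      omega)
  have hy : y ≠ 0 := hy
  have hyx : y ≠ x := hyx
  have hyξ : p y ξ = 0 := hyξ
  rw [pow_one, Nat.dvd_prime Nat.prime_two] at hyo
  rcases hyo with hyo | hyo
  · have hyf := smul_eq_of_ncard_orbit (S := (S : Subgroup Γ)) (a := y) (by rw [hyo, pow_zero])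
    exact ⟨S, x, y, ξ, hx, hy, hyx.symm, hξ, hxξ, hyξ, fun s hs =>
      ⟨hxf ⟨s, hs⟩, hξf ⟨s, hs⟩, Or.inl (hyf ⟨s, hs⟩)⟩⟩
  · obtain ⟨u, v, huv, he⟩ := Set.ncard_eq_two.1 hyo
    obtain ⟨z, hyz, he⟩ : ∃ z, y ≠ z ∧ MulAction.orbit (S : Subgroup Γ) y = {y, z} := by
      have h2 : y ∈ MulAction.orbit (S : Subgroup Γ) y := ⟨1, one_smul _ _⟩
      rw [he] at h2
      rcases h2 with h2 | h2
      · exact ⟨v, by rw [h2]; exact huv, by rw [he, h2]⟩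
      · rw [Set.mem_singleton_iff] at h2
        exact ⟨u, by rw [h2]; exact huv.symm, by rw [he, h2, Set.pair_comm]⟩
    have hsy : ∀ s : (S : Subgroup Γ), s • y = y ∨ s • y = z := by
      intro s
      have : s • y ∈ MulAction.orbit (S : Subgroup Γ) y := ⟨s, rfl⟩
      rw [he] at this
      exact this
    obtain ⟨t, ht⟩ : z ∈ MulAction.orbit (S : Subgroup Γ) y := by rw [he]; simp
    have ht : t • y = z := ht
    have hsz : ∀ s : (S : Subgroup Γ), s • z = y ∨ s • z = z := by
      intro s
      have := hsy (s * t)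
      rwa [mul_smul, ht] at this
    have hzξ : p z ξ = 0 := by rw [← ht, hkinv, hyξ]
    have hz : z ≠ 0 := by
      rw [← ht]
      exact fun hc => hy (by rw [← inv_smul_smul t y, hc, smul_zero])
    refine ⟨S, y + z, y, ξ, fun hc => hyz (add_eq_zero_two.1 hc), hy, ?_, hξ, ?_, hyξ, ?_⟩
    · intro hc
      exact hz (by rw [← add_add_cancel_left_two y z, hc, add_self_two])
    · rw [map_add, LinearMap.add_apply, hyξ, hzξ, add_zero]
    · intro s hs
      refine ⟨?_, hξf ⟨s, hs⟩, ?_⟩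
      · have h1 := hsy ⟨s, hs⟩
        have h2 := hsz ⟨s, hs⟩
        change s • y = y ∨ s • y = z at h1
        change s • z = y ∨ s • z = z at h2
        rw [smul_add]
        rcases h1 with h1 | h1 <;> rcases h2 with h2 | h2
        · exact absurd (smul_left_cancel s (h1.trans h2.symm)) hyz
        · rw [h1, h2]
        · rw [h1, h2, add_comm]
        · exact absurd (smul_left_cancel s (h1.trans h2.symm)) hyz
      · have h1 := hsy ⟨s, hs⟩
        change s • y = y ∨ s • y = z at h1
        rwa [add_add_cancel_left_two]

end TwoTrans

section TwoTrans

variable {Γ V V' : Type*} [Group Γ] [AddCommGroup V] [Module (ZMod 2) V]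
    [AddCommGroup V'] [Module (ZMod 2) V'] [DistribMulAction Γ V] [DistribMulAction Γ V']
    {p : V →ₗ[ZMod 2] V' →ₗ[ZMod 2] ZMod 2} {N : ℕ}

/-- The group fixing `x` and the class of `y` modulo `x`. -/
def flagStab (Γ : Type*) {V : Type*} [Group Γ] [AddCommGroup V] [Module (ZMod 2) V]
    [DistribMulAction Γ V] (x y : V) : Subgroup Γ where
  carrier := {g | g • x = x ∧ (g • y = y ∨ g • y = y + x)}
  one_mem' := ⟨one_smul _ _, Or.inl (one_smul _ _)⟩
  mul_mem' := by
    rintro a b ⟨h1, h2⟩ ⟨h3, h4⟩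
    refine ⟨by rw [mul_smul, h3, h1], ?_⟩
    rw [mul_smul]
    rcases h4 with h4 | h4 <;> rcases h2 with h2 | h2 <;>
      simp [h4, h2, h1, add_assoc, add_self_two]
  inv_mem' := by
    rintro a ⟨h1, h2⟩
    refine ⟨by rw [inv_smul_eq_iff, h1], ?_⟩
    rw [inv_smul_eq_iff, inv_smul_eq_iff, smul_add, h1]
    rcases h2 with h2 | h2
    · exact Or.inl h2.symm
    · exact Or.inr (by rw [h2, add_add_cancel_two])

theorem pairing_smul_left (hinv : ∀ (g : Γ) x ξ, p (g • x) (g • ξ) = p x ξ) {g : Γ} {x : V}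
    (hg : g • x = x) (ξ : V') : p x (g • ξ) = p x ξ := by
  conv_lhs => rw [← hg]
  exact hinv g x ξ

theorem pairing_smul_right (hinv : ∀ (g : Γ) x ξ, p (g • x) (g • ξ) = p x ξ) {g : Γ} {ξ : V'}
    (hg : g • ξ = ξ) (x : V) : p (g • x) ξ = p x ξ := by
  conv_lhs => rw [← hg]
  exact hinv g x ξ

variable [Finite Γ] [Finite V] [Finite V']

theorem TwoTrans.flag_trans (h : TwoTrans Γ p N) {x : V} {ξ : V'} (hx : x ≠ 0) (hξ : ξ ≠ 0)
    (hxξ : p x ξ = 0) {w w' : V} (hw : p w ξ = 1) (hw' : p w' ξ = 1) :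
    ∃ g : Γ, g • x = x ∧ g • ξ = ξ ∧ g • w = w' := by
  obtain ⟨S, x0, y0, ξ0, hx0, -, -, hξ0, hxξ0, -, hS⟩ := exists_sylow_flag h
  obtain ⟨k, hk1, hk2⟩ := h.flag x x0 ξ ξ0 hx hx0 hξ hξ0 (by rw [hxξ, hxξ0])
  have ht : TransOn (MulAction.stabilizer Γ ξ0) {w : V | p w ξ0 = 1} := by
    intro a ha b hb
    obtain ⟨g, h1, h2⟩ := h.flag a b ξ0 ξ0 (by rintro rfl; simp at ha) (by rintro rfl; simp at hb)
      hξ0 hξ0 (ha.trans hb.symm)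
    exact ⟨g, h2, h1⟩
  have ht' := transOn_sylow S (fun s hs => (hS s hs).2.1) ht
    (fun g hg a ha => (pairing_smul_right h.inv hg a).trans ha) (ncard_compl_ker_of_ne h hξ0)
  obtain ⟨s, hs, e⟩ := ht' (k • w) (by rw [Set.mem_ofPred_eq, ← hk2, h.inv, hw]) (k • w')
    (by rw [Set.mem_ofPred_eq, ← hk2, h.inv, hw'])
  obtain ⟨s1, s2, -⟩ := hS s hs
  refine ⟨k⁻¹ * s * k, ?_, ?_, ?_⟩
  · rw [mul_smul, mul_smul, hk1, s1, ← hk1, inv_smul_smul]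
  · rw [mul_smul, mul_smul, hk2, s2, ← hk2, inv_smul_smul]
  · rw [mul_smul, mul_smul, e, inv_smul_smul]

theorem TwoTrans.dual_trans_aux (h : TwoTrans Γ p N) {x y : V} {ξ ξ' : V'} (hy : y ≠ 0)
    (h1 : p x ξ = 1) (h1' : p x ξ' = 1) (h2 : p y ξ = 0) (h2' : p y ξ' = 0) :
    ∃ g : Γ, g • x = x ∧ g • y = y ∧ g • ξ = ξ' := by
  have hξ : ξ ≠ 0 := by rintro rfl; simp at h1
  have hξ' : ξ' ≠ 0 := by rintro rfl; simp at h1'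
  obtain ⟨k, hk1, hk2⟩ := h.flag y y ξ ξ' hy hy hξ hξ' (by rw [h2, h2'])
  obtain ⟨g, hg1, hg2, hg3⟩ := h.flag_trans hy hξ' h2' (w := k • x) (w' := x)
    (by rw [← hk2, h.inv, h1]) h1'
  exact ⟨g * k, by rw [mul_smul, hg3], by rw [mul_smul, hk1, hg1], by rw [mul_smul, hk2, hg2]⟩

theorem TwoTrans.dual_trans (h : TwoTrans Γ p N) {x y : V} {ξ ξ' : V'} (hx : x ≠ 0) (hy : y ≠ 0)
    (hxy : x ≠ y) (h1 : p x ξ = p x ξ') (h2 : p y ξ = p y ξ') (hne : p x ξ ≠ 0 ∨ p y ξ ≠ 0) :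
    ∃ g : Γ, g • x = x ∧ g • y = y ∧ g • ξ = ξ' := by
  rcases zmod_two_cases (p x ξ) with hx0 | hx1
  · have hy1 : p y ξ = 1 := zmod_two_ne_zero.1 (by simpa [hx0] using hne)
    obtain ⟨g, a, b, c⟩ := h.dual_trans_aux (x := y) (y := x) hx hy1 (by rw [← h2, hy1]) hx0
      (by rw [← h1, hx0])
    exact ⟨g, b, a, c⟩
  · rcases zmod_two_cases (p y ξ) with hy0 | hy1
    · exact h.dual_trans_aux hy hx1 (by rw [← h1, hx1]) hy0 (by rw [← h2, hy0])
    · obtain ⟨g, a, b, c⟩ := h.dual_trans_aux (x := x) (y := x + y) (ξ := ξ) (ξ' := ξ')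
        (fun hc => hxy (add_eq_zero_two.1 hc)) hx1 (by rw [← h1, hx1])
        (by rw [map_add, LinearMap.add_apply, hx1, hy1]; rfl)
        (by rw [map_add, LinearMap.add_apply, ← h1, ← h2, hx1, hy1]; rfl)
      refine ⟨g, a, ?_, c⟩
      rw [smul_add, a] at b
      exact add_left_cancel b

theorem TwoTrans.translation (h : TwoTrans Γ p N) {x y w e : V} (hx : x ≠ 0) (hy : y ≠ 0)
    (hxy : x ≠ y) (hw : w ∉ Submodule.span (ZMod 2) {x, y})
    (he : e ∈ Submodule.span (ZMod 2) {x, y}) :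
    ∃ g : Γ, g • x = x ∧ g • y = y ∧ g • w = w + e := by
  obtain ⟨g, ⟨h1, h2⟩, h3⟩ := exists_translation h.nondeg h.inv
    (MulAction.stabilizer Γ x ⊓ MulAction.stabilizer Γ y) (Submodule.span (ZMod 2) {x, y})
    (by
      rintro g ⟨h1, h2⟩ e he
      have h1 : g • x = x := h1
      have h2 : g • y = y := h2
      rcases mem_span_two.1 he with rfl | rfl | rfl | rfl
      · exact smul_zero g
      · exact h1
      · exact h2
      · rw [smul_add, h1, h2])
    (by
      rintro ξ ξ' hξ ⟨e, he, hne⟩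
      obtain ⟨g, a, b, c⟩ := h.dual_trans (ξ := ξ) (ξ' := ξ') hx hy hxy
        (hξ x (Submodule.subset_span (by simp))) (hξ y (Submodule.subset_span (by simp))) (by
          by_contra hcon
          push Not at hcon
          apply hne
          rcases mem_span_two.1 he with rfl | rfl | rfl | rfl
          · simp
          · exact hcon.1
          · exact hcon.2
          · rw [map_add, LinearMap.add_apply, hcon.1, hcon.2, add_zero])
      exact ⟨g, ⟨a, b⟩, c⟩) hw he
  exact ⟨g, h1, h2, h3⟩

theorem ncard_zero_one (h : TwoTrans Γ p N) {x y : V} (hx : x ≠ 0) (hy : y ≠ 0) (hxy : x ≠ y) :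
    {η | p x η = 0 ∧ p y η = 1}.ncard = 2 ^ (N - 2) := by
  have h1 := h.nondeg.four_mul_card_perp_two hx hy hxy
  have h2 := h.nondeg.two_mul_card_perp_one hx
  have h3 : (perpS p {x, y} : Set V') ⊆ (perpS p {x} : Set V') := perpS_anti (by simp)
  have h4 := Set.ncard_sdiff_add_ncard_of_subset h3
  have h5 : (perpS p {x} : Set V') \ perpS p {x, y} = {η | p x η = 0 ∧ p y η = 1} := by
    ext η
    simp only [Set.mem_sdiff, SetLike.mem_coe, mem_perpS_one, mem_perpS_two, Set.mem_ofPred_eq]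
    constructor
    · rintro ⟨a, b⟩
      exact ⟨a, zmod_two_ne_zero.1 fun hc => b ⟨a, hc⟩⟩
    · rintro ⟨a, b⟩
      exact ⟨a, fun hc => by simp [hc.2] at b⟩
  rw [h5, ncard_submodule, ncard_submodule] at h4
  obtain ⟨M, rfl⟩ : ∃ M, N = M + 3 := ⟨N - 3, by have := h.le; omega⟩
  rw [h.card] at h1 h2
  rw [show M + 3 - 2 = M + 1 by omega]
  rw [pow_add] at h1 h2
  rw [pow_succ]
  omega

/-- A relation between two vectors and a covector, modelled on the configurations fixed by a Sylow
subgroup: `y` only matters modulo `x`. -/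
structure SylowRel (Γ : Type*) {V V' : Type*} [Group Γ] [AddCommGroup V] [Module (ZMod 2) V]
    [AddCommGroup V'] [Module (ZMod 2) V'] [DistribMulAction Γ V] [DistribMulAction Γ V']
    (p : V →ₗ[ZMod 2] V' →ₗ[ZMod 2] ZMod 2) (T : V → V → V' → Prop) : Prop where
  ne : ∀ x y ξ, T x y ξ → x ≠ 0 ∧ y ≠ 0 ∧ x ≠ y ∧ ξ ≠ 0 ∧ p x ξ = 0 ∧ p y ξ = 0
  smul : ∀ (g : Γ) x y ξ, T x y ξ → T (g • x) (g • y) (g • ξ)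
  conj : ∀ x y ξ x' y' ξ', T x y ξ → T x' y' ξ' →
    ∃ g : Γ, g • x = x' ∧ (g • y = y' ∨ g • y = y' + x') ∧ g • ξ = ξ'
  shift : ∀ x y ξ, T x y ξ → T x (y + x) ξ
  exists_rel : ∃ x y ξ, T x y ξ
  trans_left : ∀ x y ξ, T x y ξ → ∀ w w', p w ξ = 1 → p w' ξ = 1 →
    ∃ g : Γ, g ∈ flagStab Γ x y ∧ g • ξ = ξ ∧ g • w = w'
  trans_right : ∀ x y ξ, T x y ξ → ∀ η η', p x η = 0 → p y η = 1 → p x η' = 0 → p y η' = 1 →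
    ∃ g : Γ, g ∈ flagStab Γ x y ∧ g • ξ = ξ ∧ g • η = η'

theorem flagStab_conj {k g : Γ} {x y : V} (hg : g ∈ flagStab Γ (k • x) (k • y)) :
    k⁻¹ * g * k ∈ flagStab Γ x y := by
  obtain ⟨h1, h2⟩ := hg
  refine ⟨by rw [mul_smul, mul_smul, h1, inv_smul_smul], ?_⟩
  rcases h2 with h2 | h2
  · left; rw [mul_smul, mul_smul, h2, inv_smul_smul]
  · right; rw [mul_smul, mul_smul, h2, smul_add, inv_smul_smul, inv_smul_smul]

theorem TwoTrans.exists_sylowRel (h : TwoTrans Γ p N) : ∃ T, SylowRel Γ p T := by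
  obtain ⟨S, x0, y0, ξ0, hx0, hy0, hxy0, hξ0, hxξ0, hyξ0, hS⟩ := exists_sylow_flag h
  have hSf : ∀ s ∈ S, s ∈ flagStab Γ x0 y0 := fun s hs => ⟨(hS s hs).1, (hS s hs).2.2⟩
  have t1 : TransOn (S : Subgroup Γ) {w : V | p w ξ0 = 1} := by
    refine transOn_sylow S (H := MulAction.stabilizer Γ ξ0) (fun s hs => (hS s hs).2.1) ?_
      (fun g hg a ha => (pairing_smul_right h.inv hg a).trans ha) (ncard_compl_ker_of_ne h hξ0)
    intro a ha b hb
    obtain ⟨g, -, h1, h2⟩ := h.flag_trans hx0 hξ0 hxξ0 ha hb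
    exact ⟨g, h1, h2⟩
  have t2 : TransOn (S : Subgroup Γ) {η : V' | p x0 η = 0 ∧ p y0 η = 1} := by
    refine transOn_sylow S (H := flagStab Γ x0 y0) hSf ?_ ?_ (ncard_zero_one h hx0 hy0 hxy0)
    · rintro a ⟨ha1, ha2⟩ b ⟨hb1, hb2⟩
      obtain ⟨g, h1, h2, h3⟩ := h.dual_trans hx0 hy0 hxy0 (ha1.trans hb1.symm)
        (ha2.trans hb2.symm) (Or.inr (by simp [ha2]))
      exact ⟨g, ⟨h1, Or.inl h2⟩, h3⟩
    · rintro g hg a ⟨ha1, ha2⟩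
      have h1 : p x0 (g • a) = 0 := (pairing_smul_left h.inv hg.1 a).trans ha1
      refine ⟨h1, ?_⟩
      obtain ⟨-, h2 | h2⟩ := (flagStab Γ x0 y0).inv_mem hg
      · rw [← ha2, ← h.inv g⁻¹, inv_smul_smul, h2]
      · rw [← h.inv g⁻¹, inv_smul_smul, h2, map_add, LinearMap.add_apply, ha1, ha2, add_zero]
  refine ⟨fun x y ξ => ∃ k : Γ, k • x = x0 ∧ (k • y = y0 ∨ k • y = y0 + x0) ∧ k • ξ = ξ0, ?_⟩
  constructor
  · rintro x y ξ ⟨k, h1, h2, h3⟩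
    refine ⟨?_, ?_, ?_, ?_, ?_, ?_⟩
    · rintro rfl; exact hx0 (by rw [← h1, smul_zero])
    · rintro rfl
      rw [smul_zero] at h2
      rcases h2 with h2 | h2
      · exact hy0 h2.symm
      · exact hxy0 (add_eq_zero_two.1 h2.symm).symm
    · rintro rfl
      rw [h1] at h2
      rcases h2 with h2 | h2
      · exact hxy0 h2
      · exact hy0 (by simpa using h2)
    · rintro rfl; exact hξ0 (by rw [← h3, smul_zero])
    · rw [← h.inv k, h1, h3, hxξ0]
    · rw [← h.inv k, h3]
      rcases h2 with h2 | h2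
      · rw [h2, hyξ0]
      · rw [h2, map_add, LinearMap.add_apply, hyξ0, hxξ0, add_zero]
  · rintro g x y ξ ⟨k, h1, h2, h3⟩
    refine ⟨k * g⁻¹, ?_, ?_, ?_⟩ <;> simpa only [mul_smul, inv_smul_smul]
  · rintro x y ξ x' y' ξ' ⟨k, h1, h2, h3⟩ ⟨k', h1', h2', h3'⟩
    refine ⟨k'⁻¹ * k, ?_, ?_, ?_⟩
    · rw [mul_smul, h1, inv_smul_eq_iff, h1']
    · rw [mul_smul, inv_smul_eq_iff, inv_smul_eq_iff, smul_add, h1']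
      rcases h2 with h2 | h2 <;> rcases h2' with h2' | h2' <;>
        simp [h2, h2', add_add_cancel_two]
    · rw [mul_smul, h3, inv_smul_eq_iff, h3']
  · rintro x y ξ ⟨k, h1, h2, h3⟩
    refine ⟨k, h1, ?_, h3⟩
    rw [smul_add, h1]
    rcases h2 with h2 | h2 <;> simp [h2, add_add_cancel_two]
  · exact ⟨x0, y0, ξ0, 1, one_smul _ _, Or.inl (one_smul _ _), one_smul _ _⟩
  · have key : ∀ x y ξ (k : Γ), k • x = x0 → (k • y = y0 ∨ k • y = y0 + x0) → k • ξ = ξ0 →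
        ∀ s ∈ S, k⁻¹ * s * k ∈ flagStab Γ x y ∧ (k⁻¹ * s * k) • ξ = ξ := by
      intro x y ξ k h1 h2 h3 s hs
      refine ⟨flagStab_conj ?_, ?_⟩
      · have h4 := hSf s hs
        rw [h1]
        rcases h2 with h2 | h2
        · rwa [h2]
        · rw [h2]
          refine ⟨h4.1, ?_⟩
          rw [smul_add, h4.1]
          rcases h4.2 with h5 | h5 <;> simp [h5]
      · rw [mul_smul, mul_smul, h3, (hS s hs).2.1, ← h3, inv_smul_smul]
    rintro x y ξ ⟨k, h1, h2, h3⟩ w w' hw hw'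
    obtain ⟨s, hs, e⟩ := t1 (k • w) (by rw [Set.mem_ofPred_eq, ← h3, h.inv, hw]) (k • w')
      (by rw [Set.mem_ofPred_eq, ← h3, h.inv, hw'])
    obtain ⟨a, b⟩ := key x y ξ k h1 h2 h3 s hs
    exact ⟨_, a, b, by rw [mul_smul, mul_smul, e, inv_smul_smul]⟩
  · have key : ∀ x y ξ (k : Γ), k • x = x0 → (k • y = y0 ∨ k • y = y0 + x0) → k • ξ = ξ0 →
        ∀ s ∈ S, k⁻¹ * s * k ∈ flagStab Γ x y ∧ (k⁻¹ * s * k) • ξ = ξ := by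
      intro x y ξ k h1 h2 h3 s hs
      refine ⟨flagStab_conj ?_, ?_⟩
      · have h4 := hSf s hs
        rw [h1]
        rcases h2 with h2 | h2
        · rwa [h2]
        · rw [h2]
          refine ⟨h4.1, ?_⟩
          rw [smul_add, h4.1]
          rcases h4.2 with h5 | h5 <;> simp [h5]
      · rw [mul_smul, mul_smul, h3, (hS s hs).2.1, ← h3, inv_smul_smul]
    rintro x y ξ ⟨k, h1, h2, h3⟩ η η' hxη hyη hxη' hyη'
    have aux : ∀ η : V', p x η = 0 → p y η = 1 → p x0 (k • η) = 0 ∧ p y0 (k • η) = 1 := by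
      intro η ha hb
      have hc : p x0 (k • η) = 0 := by rw [← h1, h.inv, ha]
      refine ⟨hc, ?_⟩
      rw [← h.inv k] at hb
      rcases h2 with h2 | h2
      · rwa [h2] at hb
      · rwa [h2, map_add, LinearMap.add_apply, hc, add_zero] at hb
    obtain ⟨s, hs, e⟩ := t2 (k • η) (aux η hxη hyη) (k • η') (aux η' hxη' hyη')
    obtain ⟨a, b⟩ := key x y ξ k h1 h2 h3 s hs
    exact ⟨_, a, b, by rw [mul_smul, mul_smul, e, inv_smul_smul]⟩

end TwoTrans

theorem LinearMap.exists_common_one {U : Type*} [AddCommGroup U] [Module (ZMod 2) U]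
    {f g : U →ₗ[ZMod 2] ZMod 2} {a b : U} (ha : f a = 1) (hb : g b = 1) :
    ∃ c, (c = a ∨ c = b ∨ c = a + b) ∧ f c = 1 ∧ g c = 1 := by
  rcases zmod_two_cases (g a) with h1 | h1
  · rcases zmod_two_cases (f b) with h2 | h2
    · exact ⟨a + b, by simp, by simp [ha, h2], by simp [hb, h1]⟩
    · exact ⟨b, by simp, h2, hb⟩
  · exact ⟨a, by simp, ha, h1⟩

section SylowRel

variable {Γ V V' : Type*} [Group Γ] [AddCommGroup V] [Module (ZMod 2) V]
    [AddCommGroup V'] [Module (ZMod 2) V'] [DistribMulAction Γ V] [DistribMulAction Γ V']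
    {p : V →ₗ[ZMod 2] V' →ₗ[ZMod 2] ZMod 2} {N : ℕ} {T : V → V → V' → Prop}

/-- The covectors related to the pair `x, y`, together with zero. -/
def relN (T : V → V → V' → Prop) (x y : V) : Submodule (ZMod 2) V' :=
  Submodule.span (ZMod 2) {ξ | T x y ξ}

/-- The common kernel of the covectors related to the pair `x, y`. -/
def relY (p : V →ₗ[ZMod 2] V' →ₗ[ZMod 2] ZMod 2) (T : V → V → V' → Prop) (x y : V) :
    Submodule (ZMod 2) V :=
  perpS p.flip {ξ | T x y ξ}

/-- The vectors related to `x` and `ξ`, together with the span of `x`. -/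
def relZ (T : V → V → V' → Prop) (x : V) (ξ : V') : Submodule (ZMod 2) V :=
  Submodule.span (ZMod 2) (insert x {y | T x y ξ})

theorem mem_relY {x y w : V} : w ∈ relY p T x y ↔ ∀ ξ, T x y ξ → p w ξ = 0 := Iff.rfl

theorem notMem_relY {x y w : V} : w ∉ relY p T x y ↔ ∃ ξ, T x y ξ ∧ p w ξ = 1 := by
  rw [mem_relY]
  push Not
  simp only [zmod_two_ne_zero]

variable [Finite Γ] [Finite V] [Finite V']

theorem flagStab_smul (s : SylowRel Γ p T) {x y : V} {ξ : V'} {g : Γ}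
    (hg : g ∈ flagStab Γ x y) (hT : T x y ξ) : T x y (g • ξ) := by
  have h1 := s.smul g x y ξ hT
  rw [hg.1] at h1
  rcases hg.2 with h2 | h2
  · rwa [h2] at h1
  · rw [h2] at h1
    simpa [add_add_cancel_two] using s.shift _ _ _ h1

theorem SylowRel.flagStab_trans (s : SylowRel Γ p T) {x y w w' : V}
    (hw : w ∉ relY p T x y) (hw' : w' ∉ relY p T x y) : ∃ g ∈ flagStab Γ x y, g • w = w' := by
  obtain ⟨ξ, h1, h2⟩ := notMem_relY.1 hw
  obtain ⟨ξ', h1', h2'⟩ := notMem_relY.1 hw'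
  obtain ⟨v, -, h3, h4⟩ := LinearMap.exists_common_one (f := p.flip ξ) (g := p.flip ξ') h2 h2'
  obtain ⟨g, ha, -, hb⟩ := s.trans_left _ _ _ h1 w v h2 h3
  obtain ⟨g', ha', -, hb'⟩ := s.trans_left _ _ _ h1' v w' h4 h2'
  exact ⟨g' * g, mul_mem ha' ha, by rw [mul_smul, hb, hb']⟩

theorem ncard_smul_setOf {α : Type*} [MulAction Γ α] (g : Γ) {P Q : α → Prop}
    (h : ∀ a, P a ↔ Q (g • a)) : {a | P a}.ncard = {a | Q a}.ncard := by
  have : {a | Q a} = (fun a => g • a) '' {a | P a} := by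
    ext a
    simp only [Set.mem_ofPred_eq, Set.mem_image, h]
    exact ⟨fun ha => ⟨g⁻¹ • a, by simpa using ha, by simp⟩, by rintro ⟨b, hb, rfl⟩; exact hb⟩
  rw [this, Set.ncard_image_of_injective _ (MulAction.injective g)]

theorem mem_relN (t : TwoTrans Γ p N) (s : SylowRel Γ p T) {x y : V} {ξ : V'} :
    ξ ∈ relN T x y ↔ ξ = 0 ∨ T x y ξ := by
  constructor
  · intro hξ
    by_cases h0 : ξ = 0
    · exact Or.inl h0
    right
    have hne : {ξ | T x y ξ}.Nonempty := by
      by_contra hc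
      rw [Set.not_nonempty_iff_eq_empty] at hc
      rw [relN, hc] at hξ
      simp at hξ
      exact h0 hξ
    have hz : ∃ c, ∀ w, w ∉ relY p T x y → {η | T x y η ∧ p w η = 1}.ncard = c := by
      by_cases hw : ∃ w, w ∉ relY p T x y
      · obtain ⟨w, hw⟩ := hw
        refine ⟨{η | T x y η ∧ p w η = 1}.ncard, fun w' hw' => ?_⟩
        obtain ⟨g, hg, e⟩ := s.flagStab_trans hw' hw
        refine ncard_smul_setOf g fun η => ?_
        rw [← e, t.inv]
        refine and_congr_left fun _ => ⟨flagStab_smul s hg, fun h => ?_⟩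
        simpa using flagStab_smul s (inv_mem hg) h
      · push Not at hw
        exact ⟨0, fun w' hw' => absurd (hw w') hw'⟩
    obtain ⟨c, hc⟩ := hz
    refine mem_of_count_const t.nondeg.flip ⊥ {ξ | T x y ξ} ?_ ?_ hne c ?_ (by simpa using h0) ?_
    · intro η hη a ha
      rw [Submodule.mem_bot] at ha
      simpa [ha] using hη
    · intro η hη
      exact (s.ne _ _ _ hη).2.2.2.1
    · rintro w - ⟨η, h1, h2⟩
      exact hc w (notMem_relY.2 ⟨η, h1, h2⟩)
    · intro w h1 _
      have h2 : Submodule.span (ZMod 2) {ξ | T x y ξ} ≤ LinearMap.ker (p w) :=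
        Submodule.span_le.2 h1
      exact h2 hξ
  · rintro (rfl | h)
    · exact zero_mem _
    · exact Submodule.subset_span h

theorem SylowRel.flag_trans_right (s : SylowRel Γ p T) {x y y' : V} {ξ η η' : V'}
    (h : T x y ξ) (h' : T x y' ξ) (h1 : p x η = 0) (h2 : p y η = 1) (h1' : p x η' = 0)
    (h2' : p y' η' = 1) : ∃ g : Γ, g • x = x ∧ g • ξ = ξ ∧ g • η = η' := by
  obtain ⟨v, hv, h3, h4⟩ := LinearMap.exists_common_one (f := p y) (g := p y') h2 h2'
  have h5 : p x v = 0 := by rcases hv with rfl | rfl | rfl <;> simp [h1, h1']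
  obtain ⟨g, ha, hb, hc⟩ := s.trans_right _ _ _ h η v h1 h2 h5 h3
  obtain ⟨g', ha', hb', hc'⟩ := s.trans_right _ _ _ h' v η' h5 h4 h1' h2'
  exact ⟨g' * g, by rw [mul_smul, ha.1, ha'.1], by rw [mul_smul, hb, hb'],
    by rw [mul_smul, hc, hc']⟩

theorem SylowRel.smul_iff (s : SylowRel Γ p T) (g : Γ) {x y : V} {ξ : V'} :
    T (g • x) (g • y) (g • ξ) ↔ T x y ξ :=
  ⟨fun h => by simpa using s.smul g⁻¹ _ _ _ h, s.smul g x y ξ⟩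

theorem mem_relZ (t : TwoTrans Γ p N) (s : SylowRel Γ p T) {x y : V} {ξ : V'} :
    y ∈ relZ T x ξ ↔ y = 0 ∨ y = x ∨ T x y ξ := by
  constructor
  · intro hy
    by_cases h0 : y ∈ Submodule.span (ZMod 2) {x}
    · rcases mem_span_one.1 h0 with h | h
      · exact Or.inl h
      · exact Or.inr (Or.inl h)
    right; right
    have hne : {y | T x y ξ}.Nonempty := by
      by_contra hc
      rw [Set.not_nonempty_iff_eq_empty] at hc
      rw [relZ, hc] at hy
      exact h0 (by simpa using hy)
    have hz : ∃ c, ∀ η, p x η = 0 → (∃ y, T x y ξ ∧ p y η = 1) →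
        {y | T x y ξ ∧ p y η = 1}.ncard = c := by
      by_cases hw : ∃ η, p x η = 0 ∧ ∃ y, T x y ξ ∧ p y η = 1
      · obtain ⟨η, h1, y1, h2, h3⟩ := hw
        refine ⟨{y | T x y ξ ∧ p y η = 1}.ncard, ?_⟩
        rintro η' h1' ⟨y1', h2', h3'⟩
        obtain ⟨g, ha, hb, hc⟩ := s.flag_trans_right h2' h2 h1' h3' h1 h3
        refine ncard_smul_setOf g fun y => ?_
        rw [← hc, t.inv, ← s.smul_iff g, ha, hb]
      · push Not at hw
        exact ⟨0, fun η h1 ⟨y, h2, h3⟩ => absurd h3 (hw η h1 y h2)⟩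
    obtain ⟨c, hc⟩ := hz
    refine mem_of_count_const t.nondeg (Submodule.span (ZMod 2) {x}) {y | T x y ξ} ?_ ?_ hne c ?_
      h0 ?_
    · intro y hy a ha
      rcases mem_span_one.1 ha with rfl | rfl
      · simpa using hy
      · exact s.shift _ _ _ hy
    · intro y hy hs
      have h1 := s.ne _ _ _ hy
      rcases mem_span_one.1 hs with rfl | rfl
      · exact h1.2.1 rfl
      · exact h1.2.2.1 rfl
    · intro η h1 h2
      exact hc η (h1 x (Submodule.mem_span_singleton_self x)) h2
    · intro η h1 h2
      have h3 : relZ T x ξ ≤ LinearMap.ker (p.flip η) := by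
        refine Submodule.span_le.2 ?_
        rintro z (rfl | hz)
        · exact h2 _ (Submodule.mem_span_singleton_self _)
        · exact h1 _ hz
      exact h3 hy
  · rintro (rfl | rfl | h)
    · exact zero_mem _
    · exact Submodule.subset_span (by simp)
    · exact Submodule.subset_span (Or.inr h)

theorem left_mem_relY (s : SylowRel Γ p T) (x y : V) : x ∈ relY p T x y :=
  fun _ hξ => (s.ne _ _ _ hξ).2.2.2.2.1

theorem right_mem_relY (s : SylowRel Γ p T) (x y : V) : y ∈ relY p T x y :=
  fun _ hξ => (s.ne _ _ _ hξ).2.2.2.2.2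

theorem smul_mem_relY (s : SylowRel Γ p T) (t : TwoTrans Γ p N) (g : Γ) {x y w : V} :
    g • w ∈ relY p T (g • x) (g • y) ↔ w ∈ relY p T x y := by
  rw [mem_relY, mem_relY]
  constructor
  · intro h ξ hξ
    rw [← t.inv g]
    exact h _ (s.smul g _ _ _ hξ)
  · intro h ξ hξ
    rw [← t.inv g⁻¹, inv_smul_smul]
    refine h _ ?_
    rw [← s.smul_iff g]
    simpa using hξ

theorem ne_of_notMem_relY (s : SylowRel Γ p T) {x y w : V} (h : w ∉ relY p T x y) :
    x ≠ 0 ∧ y ≠ 0 ∧ x ≠ y := by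
  obtain ⟨ξ, h1, -⟩ := notMem_relY.1 h
  have := s.ne _ _ _ h1
  exact ⟨this.1, this.2.1, this.2.2.1⟩

theorem notMem_span_of_notMem_relY (s : SylowRel Γ p T) {x y w : V} (h : w ∉ relY p T x y) :
    w ∉ Submodule.span (ZMod 2) {x, y} := by
  intro hw
  refine h (Submodule.span_le.2 ?_ hw)
  rintro z (rfl | rfl)
  · exact left_mem_relY s _ _
  · exact right_mem_relY s _ _

theorem indep_rotate {x y w : V} (hx : x ≠ 0) (hxy : x ≠ y)
    (hw : w ∉ Submodule.span (ZMod 2) {x, y}) :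
    w ≠ 0 ∧ y ≠ w ∧ x ∉ Submodule.span (ZMod 2) {y, w} := by
  rw [mem_span_two] at hw ⊢
  push Not at hw ⊢
  refine ⟨hw.1, hw.2.2.1.symm, hx, hxy, hw.2.1.symm, ?_⟩
  rintro rfl
  exact hw.2.2.2 (by rw [add_assoc, add_comm, add_assoc, add_self_two, add_zero])

theorem indep_swap {x y w : V} (hw : w ∉ Submodule.span (ZMod 2) {x, y}) :
    w ∉ Submodule.span (ZMod 2) {y, x} := by rwa [Set.pair_comm]

/-- Transvections preserve the complement of `relY`. -/
theorem relY_add_left (t : TwoTrans Γ p N) (s : SylowRel Γ p T) {x y w : V}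
    (h : w ∉ relY p T x y) : w ∉ relY p T (x + y) y := by
  obtain ⟨h1, h2, h3⟩ := ne_of_notMem_relY s h
  obtain ⟨h4, h5, h6⟩ := indep_rotate h1 h3 (notMem_span_of_notMem_relY s h)
  obtain ⟨g, a, b, c⟩ := t.translation h2 h4 h5 h6 (e := y) (mem_span_two.2 (by simp))
  rwa [← smul_mem_relY s t g, a, b, c] at h

theorem relY_add_right (t : TwoTrans Γ p N) (s : SylowRel Γ p T) {x y w : V} {e : V}
    (he : e ∈ Submodule.span (ZMod 2) {x, w})
    (h : w ∉ relY p T x y) : w ∉ relY p T x (y + e) := by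
  obtain ⟨h1, h2, h3⟩ := ne_of_notMem_relY s h
  obtain ⟨h4, h5, h6⟩ := indep_rotate h2 h3.symm (indep_swap (notMem_span_of_notMem_relY s h))
  obtain ⟨g, a, b, c⟩ := t.translation h1 h4 h5 h6 (e := e) he
  rwa [← smul_mem_relY s t g, a, b, c] at h

theorem relY_add_third {x y w : V} {e : V}
    (he : e ∈ relY p T x y)
    (h : w ∉ relY p T x y) : w + e ∉ relY p T x y := by
  intro hc
  exact h (by simpa [add_add_cancel_two] using add_mem hc he)

theorem mem_relY_swap (t : TwoTrans Γ p N) (s : SylowRel Γ p T) {x y w : V} :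
    w ∈ relY p T x y ↔ w ∈ relY p T y x := by
  have key : ∀ {x y : V}, w ∉ relY p T x y → w ∉ relY p T y x := by
    intro x y h
    have h1 := relY_add_left t s h
    have h2 := relY_add_right t s (e := x + y) (mem_span_two.2 (by simp)) h1
    have h3 := relY_add_left t s h2
    rwa [add_comm y (x + y), add_add_cancel_two, add_comm x y, add_add_cancel_two] at h3
  exact ⟨fun h => by_contra fun hc => key hc h, fun h => by_contra fun hc => key hc h⟩

theorem mem_relY_rotate (t : TwoTrans Γ p N) (s : SylowRel Γ p T) {x y w : V} :
    w ∈ relY p T x y ↔ y ∈ relY p T x w := by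
  have key : ∀ {y w : V}, w ∉ relY p T x y → y ∉ relY p T x w := by
    intro y w h
    have h1 := relY_add_right t s (e := w) (mem_span_two.2 (by simp)) h
    have h2 := relY_add_third (right_mem_relY s _ _) h1
    rw [add_comm y w, add_add_cancel_left_two] at h2
    have h3 := relY_add_right t s (mem_span_two.2 (by simp)) h2 (e := y)
    rwa [add_add_cancel_two] at h3
  exact ⟨fun h => by_contra fun hc => key hc h, fun h => by_contra fun hc => key hc h⟩

end SylowRel

theorem ncard_mul_eq_of_rel {α β : Type*} [Finite α] [Finite β] (r : α → β → Prop) (A : Set α)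
    (B : Set β) {a b : ℕ} (hA : ∀ x ∈ A, {y | r x y}.ncard = a) (hB : ∀ y ∈ B, {x | r x y}.ncard = b)
    (hr : ∀ x y, r x y → x ∈ A ∧ y ∈ B) : A.ncard * a = B.ncard * b := by
  classical
  have := Fintype.ofFinite α
  have := Fintype.ofFinite β
  rw [Set.ncard_eq_toFinset_card', Set.ncard_eq_toFinset_card']
  refine Finset.card_mul_eq_card_mul r ?_ ?_
  · intro x hx
    rw [← hA x (by simpa using hx), Set.ncard_eq_toFinset_card']
    congr 1
    ext y
    simp only [Finset.mem_bipartiteAbove, Set.mem_toFinset, Set.mem_ofPred_eq]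
    exact ⟨fun h => h.2, fun h => ⟨(hr _ _ h).2, h⟩⟩
  · intro y hy
    rw [← hB y (by simpa using hy), Set.ncard_eq_toFinset_card']
    congr 1
    ext x
    simp only [Finset.mem_bipartiteBelow, Set.mem_toFinset, Set.mem_ofPred_eq]
    exact ⟨fun h => h.2, fun h => ⟨(hr _ _ h).1, h⟩⟩

section RelData

variable {Γ V V' : Type*} [Group Γ] [AddCommGroup V] [Module (ZMod 2) V]
    [AddCommGroup V'] [Module (ZMod 2) V'] [DistribMulAction Γ V] [DistribMulAction Γ V']
    {p : V →ₗ[ZMod 2] V' →ₗ[ZMod 2] ZMod 2} {N : ℕ} {T : V → V → V' → Prop}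

/-- A relation as in `SylowRel` for a two-transitive group, together with the dimension of the
spaces `relN`. -/
structure RelData (Γ : Type*) {V V' : Type*} [Group Γ] [AddCommGroup V] [Module (ZMod 2) V]
    [AddCommGroup V'] [Module (ZMod 2) V'] [DistribMulAction Γ V] [DistribMulAction Γ V']
    (p : V →ₗ[ZMod 2] V' →ₗ[ZMod 2] ZMod 2) (N : ℕ) (T : V → V → V' → Prop) (h : ℕ) : Prop where
  two : TwoTrans Γ p N
  rel : SylowRel Γ p T
  pos : 1 ≤ h
  cardN : ∀ x y : V, x ≠ 0 → y ≠ 0 → x ≠ y → Nat.card (relN T x y) = 2 ^ h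

variable [Finite Γ] [Finite V] [Finite V']

theorem TwoTrans.exists_relData (t : TwoTrans Γ p N) : ∃ T h, RelData Γ p N T h := by
  obtain ⟨T, s⟩ := t.exists_sylowRel
  obtain ⟨x, y, ξ, hT⟩ := s.exists_rel
  obtain ⟨h, hh⟩ := card_submodule_two_pow (relN T x y)
  obtain ⟨h1, h2, h3, h4, -⟩ := s.ne _ _ _ hT
  refine ⟨T, h, t, s, ?_, ?_⟩
  · by_contra hc
    obtain rfl : h = 0 := by omega
    rw [pow_zero, Nat.card_eq_one_iff_unique] at hh
    have := hh.1
    have h5 : (⟨ξ, Submodule.subset_span hT⟩ : relN T x y) = 0 := Subsingleton.elim _ _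
    exact h4 (congrArg Subtype.val h5)
  · intro x' y' h1' h2' h3'
    obtain ⟨g, rfl, rfl⟩ := t.pair x y x' y' h1 h2 h3 h1' h2' h3'
    rw [← hh, ← ncard_submodule, ← ncard_submodule]
    refine (ncard_smul_setOf g fun ξ => ?_).symm
    change ξ ∈ relN T x y ↔ g • ξ ∈ relN T (g • x) (g • y)
    rw [mem_relN t s, mem_relN t s, s.smul_iff,
      smul_eq_zero_iff_eq]

namespace RelData

variable {h : ℕ}

theorem cardY (d : RelData Γ p N T h) {x y : V} (hx : x ≠ 0) (hy : y ≠ 0) (hxy : x ≠ y) :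
    2 ^ h * Nat.card (relY p T x y) = 2 ^ N := by
  have h1 := d.two.nondeg.flip.card_mul (relN T x y)
  rwa [d.cardN x y hx hy hxy, relN, perpS_span, d.two.card] at h1

theorem perp_relY (d : RelData Γ p N T h) (x y : V) : perpS p (relY p T x y : Set V) = relN T x y :=
  d.two.nondeg.flip.perp_perp_set _

theorem swap (d : RelData Γ p N T h) {x y : V} {ξ : V'} (hT : T x y ξ) : T y x ξ := by
  have h0 := (d.rel.ne _ _ _ hT).2.2.2.1
  have h1 : relY p T x y = relY p T y x := by
    ext w
    exact mem_relY_swap d.two d.rel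
  have h2 : relN T x y = relN T y x := by rw [← d.perp_relY, h1, d.perp_relY]
  have h3 : ξ ∈ relN T y x := h2 ▸ Submodule.subset_span hT
  exact ((mem_relN d.two d.rel).1 h3).resolve_left h0

theorem trans (d : RelData Γ p N T h) {x y w x' y' w' : V} (hw : w ∉ relY p T x y)
    (hw' : w' ∉ relY p T x' y') : ∃ g : Γ, g • x = x' ∧ g • y = y' ∧ g • w = w' := by
  obtain ⟨h1, h2, h3⟩ := ne_of_notMem_relY d.rel hw
  obtain ⟨h1', h2', h3'⟩ := ne_of_notMem_relY d.rel hw'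
  obtain ⟨k, rfl, rfl⟩ := d.two.pair x y x' y' h1 h2 h3 h1' h2' h3'
  rw [← smul_mem_relY d.rel d.two k] at hw
  obtain ⟨g, ⟨ha, hb⟩, hc⟩ := d.rel.flagStab_trans hw hw'
  rcases hb with hb | hb
  · exact ⟨g * k, by rw [mul_smul, ha], by rw [mul_smul, hb], by rw [mul_smul, hc]⟩
  · obtain ⟨h4, h5, h6⟩ := indep_rotate h2' h3'.symm
      (indep_swap (notMem_span_of_notMem_relY d.rel hw'))
    obtain ⟨q, a, b, c⟩ := d.two.translation h1' h4 h5 h6 (e := k • x) (mem_span_two.2 (by simp))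
    refine ⟨q * g * k, by rw [mul_smul, mul_smul, ha, a], ?_, by rw [mul_smul, mul_smul, hc, b]⟩
    rw [mul_smul, mul_smul, hb, smul_add, a, c, add_add_cancel_two]

theorem rel_iff_mem (d : RelData Γ p N T h) {x y : V} {ξ : V'} (hξ : ξ ≠ 0) :
    T x y ξ ↔ ξ ∈ relN T x y := by
  rw [mem_relN d.two d.rel]
  simp [hξ]

theorem ncard_T_right (d : RelData Γ p N T h) {x y : V} (hx : x ≠ 0) (hy : y ≠ 0) (hxy : x ≠ y) :
    {ξ | T x y ξ}.ncard = 2 ^ h - 1 := by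
  have h1 : {ξ | T x y ξ} = (relN T x y : Set V') \ {0} := by
    ext ξ
    simp only [Set.mem_sdiff, SetLike.mem_coe, Set.mem_singleton_iff, mem_relN d.two d.rel]
    constructor
    · exact fun hT => ⟨Or.inr hT, (d.rel.ne _ _ _ hT).2.2.2.1⟩
    · exact fun ⟨ha, hb⟩ => ha.resolve_left hb
  rw [h1, Set.ncard_sdiff_singleton_of_mem (zero_mem _), ncard_submodule, d.cardN x y hx hy hxy]

theorem ncard_T_left (d : RelData Γ p N T h) {x : V} {ξ : V'} (hx : x ≠ 0) (hξ : ξ ≠ 0)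
    (hxξ : p x ξ = 0) : {y | T x y ξ}.ncard = 2 ^ (h + 1) - 2 := by
  have h1 := ncard_mul_eq_of_rel (T x) {y | y ≠ 0 ∧ y ≠ x} {ξ | ξ ≠ 0 ∧ p x ξ = 0}
    (a := 2 ^ h - 1) (b := {y | T x y ξ}.ncard)
    (fun y hy => d.ncard_T_right hx hy.1 hy.2.symm) (fun η hη => by
      obtain ⟨g, h1, h2⟩ := d.two.flag x x η ξ hx hx hη.1 hξ (by rw [hη.2, hxξ])
      refine ncard_smul_setOf g fun y => ?_
      rw [← d.rel.smul_iff g, h1, h2]) (fun y η hT => by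
      obtain ⟨-, h2, h3, h4, h5, -⟩ := d.rel.ne _ _ _ hT
      exact ⟨⟨h2, h3.symm⟩, h4, h5⟩)
  have h2 : {y | y ≠ 0 ∧ y ≠ x}.ncard = 2 ^ N - 2 := by
    have h3 : {y | y ≠ 0 ∧ y ≠ x} = ({0, x} : Set V)ᶜ := by
      ext y; simp
    rw [h3, Set.ncard_compl, Set.ncard_pair hx.symm, d.two.card]
  have h3 : {ξ | ξ ≠ 0 ∧ p x ξ = 0}.ncard = 2 ^ (N - 1) - 1 := by
    have h4 : {ξ | ξ ≠ 0 ∧ p x ξ = 0} = {ξ | p x ξ = 0} \ {0} := by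
      ext y; simp [and_comm]
    rw [h4, Set.ncard_sdiff_singleton_of_mem (by simp)]
    exact congrArg (· - 1) (ncard_ker_of_ne d.two.flip hx)
  rw [h2, h3] at h1
  obtain ⟨M, rfl⟩ : ∃ M, N = M + 3 := ⟨N - 3, by have := d.two.le; omega⟩
  have h4 := Nat.one_le_two_pow (n := M)
  have h5 : 2 ^ (M + 3) - 2 = 2 * (2 ^ (M + 3 - 1) - 1) := by
    rw [show M + 3 - 1 = M + 2 by omega, pow_succ 2 (M + 2)]; omega
  rw [h5, mul_assoc, mul_left_comm] at h1
  have h6 : 0 < 2 ^ (M + 3 - 1) - 1 := by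
    rw [show M + 3 - 1 = M + 2 by omega, pow_add]; omega
  have h7 := Nat.eq_of_mul_eq_mul_left h6 h1
  rw [← h7, pow_succ]
  omega

theorem cardZ (d : RelData Γ p N T h) {x : V} {ξ : V'} (hx : x ≠ 0) (hξ : ξ ≠ 0)
    (hxξ : p x ξ = 0) : Nat.card (relZ T x ξ) = 2 ^ (h + 1) := by
  have h1 : (relZ T x ξ : Set V) = {y | T x y ξ} ∪ Submodule.span (ZMod 2) {x} := by
    ext y
    simp only [SetLike.mem_coe, Set.mem_union, mem_relZ d.two d.rel, mem_span_one,
      Set.mem_ofPred_eq]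
    tauto
  have h2 : Disjoint {y | T x y ξ} (Submodule.span (ZMod 2) {x} : Set V) := by
    rw [Set.disjoint_left]
    intro y hy hs
    have h1 := d.rel.ne _ _ _ hy
    rcases mem_span_one.1 hs with rfl | rfl
    · exact h1.2.1 rfl
    · exact h1.2.2.1 rfl
  rw [← ncard_submodule, h1, Set.ncard_union_eq h2 (Set.toFinite _) (Set.toFinite _),
    d.ncard_T_left hx hξ hxξ, ncard_submodule, card_span_one hx, pow_succ]
  have := Nat.one_le_two_pow (n := h)
  omega

theorem relZ_le (d : RelData Γ p N T h) {x : V} {ξ : V'} (hxξ : p x ξ = 0) {y : V}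
    (hy : y ∈ relZ T x ξ) : p y ξ = 0 := by
  rcases (mem_relZ d.two d.rel).1 hy with rfl | rfl | hy
  · simp
  · exact hxξ
  · exact (d.rel.ne _ _ _ hy).2.2.2.2.2

end RelData

end RelData

/-- Transitivity on linearly independent triples. -/
def TripleTrans (Γ V : Type*) [Group Γ] [AddCommGroup V] [Module (ZMod 2) V]
    [DistribMulAction Γ V] : Prop :=
  ∀ x y w x' y' w' : V, x ≠ 0 → y ≠ 0 → x ≠ y → w ∉ Submodule.span (ZMod 2) {x, y} →
    x' ≠ 0 → y' ≠ 0 → x' ≠ y' → w' ∉ Submodule.span (ZMod 2) {x', y'} →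
    ∃ g : Γ, g • x = x' ∧ g • y = y' ∧ g • w = w'

namespace RelData

variable {Γ V V' : Type*} [Group Γ] [AddCommGroup V] [Module (ZMod 2) V]
    [AddCommGroup V'] [Module (ZMod 2) V'] [DistribMulAction Γ V] [DistribMulAction Γ V']
    {p : V →ₗ[ZMod 2] V' →ₗ[ZMod 2] ZMod 2} {N : ℕ} {T : V → V → V' → Prop}
    [Finite Γ] [Finite V] [Finite V'] {h h' : ℕ} {T' : V' → V' → V → Prop}

theorem span_le_relY (d : RelData Γ p N T h) (x y : V) :
    Submodule.span (ZMod 2) {x, y} ≤ relY p T x y := by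
  refine Submodule.span_le.2 ?_
  rintro z (rfl | rfl)
  · exact left_mem_relY d.rel _ _
  · exact right_mem_relY d.rel _ _

theorem cardY_sub (d : RelData Γ p N T h) {x y : V} (hx : x ≠ 0) (hy : y ≠ 0) (hxy : x ≠ y) :
    h + 2 ≤ N ∧ Nat.card (relY p T x y) = 2 ^ (N - h) := by
  have h1 := d.cardY hx hy hxy
  have h2 := card_submodule_mono (d.span_le_relY x y)
  rw [card_span_two hx hy hxy] at h2
  have h3 : 2 ^ (h + 2) ≤ 2 ^ N := by rw [← h1, pow_add]; exact Nat.mul_le_mul_left _ h2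
  have h4 := (Nat.pow_le_pow_iff_right (by norm_num)).1 h3
  refine ⟨h4, ?_⟩
  have h5 : 2 ^ N = 2 ^ h * 2 ^ (N - h) := by rw [← pow_add]; congr 1; omega
  rw [h5] at h1
  exact Nat.eq_of_mul_eq_mul_left (by positivity) h1

theorem exists_pair (d : RelData Γ p N T h) : ∃ x y : V, x ≠ 0 ∧ y ≠ 0 ∧ x ≠ y := by
  obtain ⟨x, y, ξ, hT⟩ := d.rel.exists_rel
  have := d.rel.ne _ _ _ hT
  exact ⟨x, y, this.1, this.2.1, this.2.2.1⟩

theorem le (d : RelData Γ p N T h) : h + 2 ≤ N := by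
  obtain ⟨x, y, h1, h2, h3⟩ := d.exists_pair
  exact (d.cardY_sub h1 h2 h3).1

theorem tripleTrans (d : RelData Γ p N T h) (hN : h + 2 = N) : TripleTrans Γ V := by
  have key : ∀ x y : V, x ≠ 0 → y ≠ 0 → x ≠ y →
      Submodule.span (ZMod 2) {x, y} = relY p T x y := by
    intro x y hx hy hxy
    refine submodule_eq_of_card (d.span_le_relY x y) ?_
    rw [(d.cardY_sub hx hy hxy).2, card_span_two hx hy hxy, show N - h = 2 by omega]
    norm_num
  intro x y w x' y' w' hx hy hxy hw hx' hy' hxy' hw'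
  rw [key x y hx hy hxy] at hw
  rw [key x' y' hx' hy' hxy'] at hw'
  exact d.trans hw hw'

theorem smul_mem_relZ (d : RelData Γ p N T h) (g : Γ) {x y : V} {ξ : V'} :
    g • y ∈ relZ T (g • x) (g • ξ) ↔ y ∈ relZ T x ξ := by
  rw [mem_relZ d.two d.rel, mem_relZ d.two d.rel, d.rel.smul_iff, smul_eq_zero_iff_eq,
    (MulAction.injective g).eq_iff]

theorem orthogonal_Z (d : RelData Γ p N T h) (d' : RelData Γ p.flip N T' h') (hN : h + 2 < N)
    {x y : V} {ξ η : V'} (hx : x ≠ 0) (hξ : ξ ≠ 0) (hxξ : p x ξ = 0) (hy : y ∈ relZ T x ξ)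
    (hη : η ∈ relZ T' ξ x) : p y η = 0 := by
  by_contra hc
  rw [← ne_eq, zmod_two_ne_zero] at hc
  have hyξ := d.relZ_le hxξ hy
  have hT : T' ξ η x := by
    rcases (mem_relZ d'.two d'.rel).1 hη with rfl | rfl | hT
    · simp at hc
    · rw [hyξ] at hc; simp at hc
    · exact hT
  have h1 : ∀ w, p w ξ = 0 → p w η = 1 → w ∈ relZ T x ξ := by
    intro w h1 h2
    obtain ⟨g, a, b, c⟩ := d'.rel.flag_trans_right hT hT hyξ hc h1 h2
    have := (d.smul_mem_relZ g).2 hy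
    rwa [a, b, c] at this
  have h2 : perpS p.flip {ξ} ≤ relZ T x ξ := by
    intro w hw
    have hw : p w ξ = 0 := (mem_perpS_one (p := p.flip)).1 hw
    rcases zmod_two_cases (p w η) with h3 | h3
    · have h4 := h1 (w + y) (by simp [hw, hyξ]) (by simp [h3, hc])
      simpa [add_add_cancel_two] using add_mem h4 hy
    · exact h1 w hw h3
  have h3 := card_submodule_mono h2
  have h4 := d.two.nondeg.flip.two_mul_card_perp_one hξ
  rw [d'.two.card] at h4
  rw [d.cardZ hx hξ hxξ] at h3
  have h5 : 2 ^ N ≤ 2 ^ (h + 2) := by rw [← h4, pow_succ 2 (h + 1)]; omega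
  have := (Nat.pow_le_pow_iff_right (by norm_num)).1 h5
  omega

/-- The kernel in `V` of the dual space attached to a flag. -/
theorem card_perpZ (d' : RelData Γ p.flip N T' h') {x : V} {ξ : V'} (hx : x ≠ 0) (hξ : ξ ≠ 0)
    (hxξ : p x ξ = 0) :
    2 ^ (h' + 1) * Nat.card (perpS p.flip (relZ T' ξ x : Set V')) = 2 ^ N := by
  rw [← d'.cardZ hξ hx hxξ, ← d'.two.card, d'.two.nondeg.card_eq]
  exact d'.two.nondeg.card_mul _

theorem add_le (d : RelData Γ p N T h) (d' : RelData Γ p.flip N T' h') (hN : h + 2 < N) :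
    h + h' + 2 ≤ N := by
  obtain ⟨x, y, ξ, hT⟩ := d.rel.exists_rel
  obtain ⟨hx, hy, hxy, hξ, hxξ, -⟩ := d.rel.ne _ _ _ hT
  have h1 := d'.card_perpZ hx hξ hxξ
  have h2 : relZ T x ξ ≤ perpS p.flip (relZ T' ξ x : Set V') :=
    fun y hy η hη => d.orthogonal_Z d' hN hx hξ hxξ hy hη
  have h3 := card_submodule_mono h2
  rw [d.cardZ hx hξ hxξ] at h3
  have h5 : 2 ^ (h' + 1 + (h + 1)) ≤ 2 ^ N := by
    rw [← h1, pow_add]; exact Nat.mul_le_mul_left _ h3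
  have := (Nat.pow_le_pow_iff_right (by norm_num)).1 h5
  omega

end RelData

/-- A family of pairs of subspaces, indexed by the vectors outside `X`, compatible with a symmetric
relation given by the spaces `Y`. -/
structure SpreadData {V : Type*} [AddCommGroup V] [Module (ZMod 2) V] (X : Submodule (ZMod 2) V)
    (Y C E : V → Submodule (ZMod 2) V) : Prop where
  symm : ∀ y w, w ∈ Y y → y ∈ Y w
  le_C : ∀ z, z ∉ X → X ≤ C z
  mem_C : ∀ z, z ∉ X → z ∈ C z
  C_le : ∀ z, z ∉ X → C z ≤ E z
  rel : ∀ z y w, z ∉ X → y ∈ C z → w ∈ E z → w ∈ Y y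
  exists_partner : ∀ z w, z ∉ X → w ∉ E z → ∃ y ∈ C z, y ∉ X ∧ w ∈ Y y
  partner_unique : ∀ z w y y', z ∉ X → w ∉ E z → y ∈ C z → y' ∈ C z → y ∉ X → y' ∉ X →
    w ∈ Y y → w ∈ Y y' → y + y' ∈ X
  eq_of_mem : ∀ z y, z ∉ X → y ∈ C z → y ∉ X → C y = C z ∧ E y = E z
  add_mem_E : ∀ z y w w', z ∉ X → y ∈ C z → y ∉ X → w ∈ Y y → w' ∈ Y y → w ∉ E z → w' ∉ E z →
    w + w' ∈ E z
  add_partner : ∀ z y y' w w', z ∉ X → y ∈ C z → y' ∈ C z → y ∉ X → y' ∉ X → y + y' ∉ X →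
    w ∈ Y y → w' ∈ Y y' → w ∉ E z → w' ∉ E z → w + w' ∈ Y (y + y')
  exists_notMem : ∀ z, z ∉ X → ∃ w, w ∉ Y z
  large : ∀ z c, z ∉ X → c ∈ C z → ∃ a ∈ C z, ∃ b ∈ C z, a ∉ X ∧ b ∉ X ∧ a + b ∉ X ∧
    a + c ∉ X ∧ b + c ∉ X ∧ a + b + c ∉ X

namespace SpreadData

variable {V : Type*} [AddCommGroup V] [Module (ZMod 2) V] {X : Submodule (ZMod 2) V}
    {Y C E : V → Submodule (ZMod 2) V}

theorem mem_trans {A : Submodule (ZMod 2) V} {a b : V} (h : a + b ∈ A) : a ∈ A ↔ b ∈ A := by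
  constructor
  · intro ha
    simpa [add_add_cancel_left_two] using add_mem ha h
  · intro hb
    simpa [add_add_cancel_two] using add_mem h hb

theorem C_le_of_mem (s : SpreadData X Y C E) {z c : V} (hz : z ∉ X) (hc : c ∉ X) (h : c ∈ E z) :
    C z ≤ E c := by
  intro a ha
  by_contra hac
  have haX : a ∉ X := fun h => hac (s.C_le c hc (s.le_C c hc h))
  have hRac : a ∈ Y c := s.symm _ _ (s.rel z a c hz ha h)
  have hcc := s.mem_C c hc
  have h1 : ∀ c' ∈ C c, c' ∉ X → c + c' ∉ X → a ∉ Y c' := fun c' h1 h2 h3 h4 =>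
    h3 (s.partner_unique c a c c' hc hac hcc h1 hc h2 hRac h4)
  have h2 : ∀ c' ∈ C c, c' ∉ X → c + c' ∉ X → c' ∉ E z := fun c' h1' h2 h3 h4 =>
    h1 c' h1' h2 h3 (s.symm _ _ (s.rel z a c' hz ha h4))
  obtain ⟨c1, hc1, c2, hc2, hX1, hX2, hX12, hX1c, hX2c, hX12c⟩ := s.large c c hc hcc
  rw [add_comm] at hX1c hX2c hX12c
  have n1 := h2 c1 hc1 hX1 hX1c
  have n2 := h2 c2 hc2 hX2 hX2c
  have n12 := h2 (c1 + c2) (add_mem hc1 hc2) hX12 hX12c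
  obtain ⟨a', ha', haX', hR'⟩ := s.exists_partner z c1 hz n1
  have ha'E : a' ∈ E c := by
    by_contra hcon
    exact hX1c (s.partner_unique c a' c c1 hc hcon hcc hc1 hc hX1
      (s.symm _ _ (s.rel z a' c hz ha' h)) (s.symm _ _ hR'))
  have hR2 : c2 ∈ Y a' := s.symm _ _ (s.rel c c2 a' hc hc2 ha'E)
  exact n12 (s.add_mem_E z a' c1 c2 hz ha' haX' hR' hR2 n1 n2)

theorem E_eq (s : SpreadData X Y C E) {z y : V} (hz : z ∉ X) (hy : y ∉ X) (h : y ∈ C z) :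
    E y = E z := (s.eq_of_mem z y hz h hy).2

theorem notMem_E (s : SpreadData X Y C E) {z w y : V} (hz : z ∉ X) (hw : w ∉ X) (hwz : w ∉ E z)
    (hy : y ∈ C z) (hyX : y ∉ X) : y ∉ E w := by
  intro h
  have h1 := s.C_le_of_mem hw hyX h
  rw [s.E_eq hz hyX hy] at h1
  exact hwz (h1 (s.mem_C w hw))

theorem notMem_E' (s : SpreadData X Y C E) {z w y : V} (hz : z ∉ X) (hw : w ∉ X) (hwz : w ∉ E z)
    (hy : y ∈ C w) (hyX : y ∉ X) : y ∉ E z := by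
  intro h
  have h1 := s.C_le_of_mem hz hyX h
  rw [s.E_eq hw hyX hy] at h1
  exact s.notMem_E hz hw hwz (s.mem_C z hz) hz (h1 (s.mem_C z hz))

theorem add_mem_C (s : SpreadData X Y C E) {z w a b v b' : V} (hz : z ∉ X) (hw : w ∉ X)
    (hwz : w ∉ E z) (ha : a ∈ C z) (haX : a ∉ X) (hb : b ∈ C w) (hbX : b ∉ X)
    (hv : v ∈ C z) (hvX : v ∉ X) (hvb : b ∈ Y v) (hb' : b' ∈ C w) (hbX' : b' ∉ X) (hab : b' ∈ Y a)
    : a + b ∉ X ∧ v + b' ∈ C (a + b) := by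
  have haE : a ∉ E w := s.notMem_E hz hw hwz ha haX
  have hbE : b ∉ E z := s.notMem_E' hz hw hwz hb hbX
  have hvE : v ∉ E w := s.notMem_E hz hw hwz hv hvX
  have hbE' : b' ∉ E z := s.notMem_E' hz hw hwz hb' hbX'
  have hq : a + b ∉ X := fun h => haE (s.C_le w hw
    ((mem_trans (s.le_C w hw h)).2 hb))
  refine ⟨hq, ?_⟩
  have hqq := s.mem_C _ hq
  have haq : a ∉ E (a + b) := by
    intro h
    have h1 := s.C_le_of_mem hq haX h hqq
    rw [s.E_eq hz haX ha] at h1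
    exact hbE ((mem_trans h1).1 (s.C_le z hz ha))
  have hbq : b ∉ E (a + b) := by
    intro h
    have h1 := s.C_le_of_mem hq hbX h hqq
    rw [s.E_eq hw hbX hb] at h1
    exact haE ((mem_trans h1).2 (s.C_le w hw hb))
  obtain ⟨t, ht, htX, hta⟩ := s.exists_partner _ a hq haq
  have htq : a + b ∈ Y t := s.rel _ t _ hq ht (s.C_le _ hq hqq)
  have htb : b ∈ Y t := (mem_trans htq).1 hta
  have htz : t ∉ E z := by
    intro h
    have h1 := s.C_le_of_mem hz htX h ha
    rw [s.E_eq hq htX ht] at h1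
    exact haq h1
  have htw : t ∉ E w := by
    intro h
    have h1 := s.C_le_of_mem hw htX h hb
    rw [s.E_eq hq htX ht] at h1
    exact hbq h1
  have h1 : t + b' ∈ E z := s.add_mem_E z a t b' hz ha haX (s.symm _ _ hta) hab htz hbE'
  have h2 : t + v ∈ E w := s.add_mem_E w b t v hw hb hbX (s.symm _ _ htb) (s.symm _ _ hvb) htw hvE
  have hr1 : t + (v + b') ∈ E z := by
    rw [add_left_comm]
    exact add_mem (s.C_le z hz hv) h1
  have hr2 : t + (v + b') ∈ E w := by
    rw [← add_assoc]
    exact add_mem h2 (s.C_le w hw hb')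
  have hC1 : ∀ c ∈ C z, c ∈ Y (t + (v + b')) := fun c hc => s.symm _ _ (s.rel z c _ hz hc hr1)
  have hC2 : ∀ c ∈ C w, c ∈ Y (t + (v + b')) := fun c hc => s.symm _ _ (s.rel w c _ hw hc hr2)
  have hEE : ∀ c ∈ E z, c ∈ E w → c ∈ Y (t + (v + b')) := by
    intro c h3 h4
    refine s.symm _ _ ?_
    by_cases hcX : c ∈ X
    · exact s.symm _ _ (hC1 c (s.le_C z hz hcX))
    have h5 : a + b ∈ E c := add_mem (s.C_le_of_mem hz hcX h3 ha) (s.C_le_of_mem hw hcX h4 hb)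
    have h6 := s.C_le_of_mem hcX hq h5 (s.mem_C c hcX)
    exact add_mem (s.symm _ _ (s.rel _ t c hq ht h6)) (add_mem (s.symm _ _ (s.rel z v c hz hv h3))
      (s.symm _ _ (s.rel w b' c hw hb' h4)))
  have hEz : ∀ c ∈ E z, c ∈ Y (t + (v + b')) := by
    intro c hc
    by_cases hcw : c ∈ E w
    · exact hEE c hc hcw
    obtain ⟨y, hy, hyX, hcy⟩ := s.exists_partner w c hw hcw
    obtain ⟨u, hu, huX, hyu⟩ := s.exists_partner z y hz (s.notMem_E' hz hw hwz hy hyX)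
    have h3 := s.add_mem_E w y c u hw hy hyX hcy (s.symm _ _ hyu) hcw
      (s.notMem_E hz hw hwz hu huX)
    have h4 := hEE _ (add_mem hc (s.C_le z hz hu)) h3
    exact (mem_trans h4).2 (hC1 u hu)
  have hall : ∀ c, c ∈ Y (t + (v + b')) := by
    intro c
    by_cases hcz : c ∈ E z
    · exact hEz c hcz
    obtain ⟨y, hy, hyX, hcy⟩ := s.exists_partner z c hz hcz
    obtain ⟨u, hu, huX, hyu⟩ := s.exists_partner w y hw (s.notMem_E hz hw hwz hy hyX)
    have h3 := s.add_mem_E z y c u hz hy hyX hcy (s.symm _ _ hyu) hcz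
      (s.notMem_E' hz hw hwz hu huX)
    exact (mem_trans (hEz _ h3)).2 (hC2 u hu)
  have hrX : t + (v + b') ∈ X := by
    by_contra hcon
    obtain ⟨c, hc⟩ := s.exists_notMem _ hcon
    exact hc (hall c)
  exact (mem_trans (s.le_C _ hq hrX)).1 ht

theorem false (s : SpreadData X Y C E) {c : V} (hc : c ∉ X) : False := by
  obtain ⟨w, hw⟩ := s.exists_notMem c hc
  have hcc := s.mem_C c hc
  have hwz : w ∉ E c := fun h => hw (s.rel c c w hc hcc h)
  have hwX : w ∉ X := fun h => hwz (s.C_le c hc (s.le_C c hc h))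
  have nE : ∀ y ∈ C c, y ∉ X → y ∉ E w := fun y hy hyX => s.notMem_E hc hwX hwz hy hyX
  have nE' : ∀ y ∈ C w, y ∉ X → y ∉ E c := fun y hy hyX => s.notMem_E' hc hwX hwz hy hyX
  obtain ⟨a, ha, a', ha', h1, h2, h3, h4, h5, h6⟩ := s.large c c hc hcc
  have part : ∀ y ∈ C c, y ∉ X → ∃ b ∈ C w, b ∉ X ∧ b ∈ Y y := fun y hy hyX => by
    obtain ⟨b, hb, hbX, hby⟩ := s.exists_partner w y hwX (nE y hy hyX)
    exact ⟨b, hb, hbX, s.symm _ _ hby⟩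
  obtain ⟨γ, hγ, hγX, hcγ⟩ := part c hcc hc
  obtain ⟨β, hβ, hβX, haβ⟩ := part a ha h1
  obtain ⟨β', hβ', hβX', haβ'⟩ := part a' ha' h2
  have key : ∀ a β, a ∈ C c → a ∉ X → a + c ∉ X → β ∈ C w → β ∉ X → β ∈ Y a →
      a + (β + γ) ∈ C (c + γ) := by
    intro a β ha haX hac hβ hβX haβ
    have hbX : β + γ ∉ X := by
      intro h
      have : γ ∈ Y a := by
        have h7 : β + γ ∈ Y a := s.rel c a _ hc ha (s.C_le c hc (s.le_C c hc h))
        exact (mem_trans h7).1 haβ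
      exact hac (s.partner_unique c γ a c hc (nE' γ hγ hγX) ha hcc haX hc this hcγ)
    have hv : β + γ ∈ Y (a + c) := s.add_partner c a c β γ hc ha hcc haX hc hac haβ hcγ
      (nE' β hβ hβX) (nE' γ hγ hγX)
    obtain ⟨hq, h7⟩ := s.add_mem_C hc hwX hwz ha haX (add_mem hβ hγ) hbX (add_mem ha hcc) hac hv
      hβ hβX haβ
    have h8 : c + γ ∈ C (a + (β + γ)) := by
      have := add_mem h7 (s.mem_C _ hq)
      have e : a + c + β + (a + (β + γ)) = c + γ + (a + a) + (β + β) := by abel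
      rwa [e, add_self_two, add_self_two, add_zero, add_zero] at this
    have h9 : c + γ ∉ X := fun h =>
      nE c hcc hc (s.C_le w hwX ((mem_trans (s.le_C w hwX h)).2 hγ))
    rw [(s.eq_of_mem _ _ hq h8 h9).1]
    exact s.mem_C _ hq
  have k1 := key a β ha h1 h4 hβ hβX haβ
  have k2 := key a' β' ha' h2 h5 hβ' hβX' haβ'
  have hββ : β + β' ∉ X := by
    intro h
    have : β ∈ Y a' := by
      have h7 : β + β' ∈ Y a' := s.rel c a' _ hc ha' (s.C_le c hc (s.le_C c hc h))
      exact (mem_trans h7).2 haβ'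
    exact h3 (s.partner_unique c β a a' hc (nE' β hβ hβX) ha ha' h1 h2 haβ this)
  have k3 := key (a + a') (β + β') (add_mem ha ha') h3 h6 (add_mem hβ hβ') hββ
    (s.add_partner c a a' β β' hc ha ha' h1 h2 h3 haβ haβ' (nE' β hβ hβX) (nE' β' hβ' hβX'))
  have k4 : γ ∈ C (c + γ) := by
    have := add_mem (add_mem k1 k2) k3
    have e : a + (β + γ) + (a' + (β' + γ)) + (a + a' + (β + β' + γ)) =
      γ + (a + a) + (β + β) + (a' + a') + (β' + β') + (γ + γ) := by abel
    rwa [e, add_self_two, add_self_two, add_self_two, add_self_two, add_self_two, add_zero,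
      add_zero, add_zero, add_zero, add_zero] at this
  have h9 : c + γ ∉ X := fun h =>
    nE c hcc hc (s.C_le w hwX ((mem_trans (s.le_C w hwX h)).2 hγ))
  have k5 := (s.eq_of_mem _ _ h9 k4 hγX).1
  rw [(s.eq_of_mem _ _ hwX hγ hγX).1] at k5
  have k6 := s.mem_C _ h9
  rw [← k5] at k6
  exact nE c hcc hc (s.C_le w hwX ((mem_trans k6).2 hγ))

end SpreadData

namespace RelData

variable {Γ V V' : Type*} [Group Γ] [AddCommGroup V] [Module (ZMod 2) V]
    [AddCommGroup V'] [Module (ZMod 2) V'] [DistribMulAction Γ V] [DistribMulAction Γ V']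
    {p : V →ₗ[ZMod 2] V' →ₗ[ZMod 2] ZMod 2} {N : ℕ} {T : V → V → V' → Prop}
    [Finite Γ] [Finite V] [Finite V'] {h h' : ℕ} {T' : V' → V' → V → Prop}

/-- The common kernel of the covectors attached to a flag by the dual relation. -/
def _root_.relE (p : V →ₗ[ZMod 2] V' →ₗ[ZMod 2] ZMod 2) (T' : V' → V' → V → Prop) (x : V)
    (ξ : V') : Submodule (ZMod 2) V := perpS p.flip (relZ T' ξ x : Set V')

theorem exists_of_notMem_relE (d' : RelData Γ p.flip N T' h') {x w : V} {ξ : V'} (hw : p w ξ = 0)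
    (hwE : w ∉ relE p T' x ξ) : ∃ η, T' ξ η x ∧ p w η = 1 := by
  rw [relE, mem_perpS] at hwE
  push Not at hwE
  obtain ⟨η, hη, h1⟩ := hwE
  rw [zmod_two_ne_zero] at h1
  have h1 : p w η = 1 := h1
  rcases (mem_relZ d'.two d'.rel).1 hη with rfl | rfl | hT
  · simp at h1
  · rw [hw] at h1; simp at h1
  · exact ⟨η, hT, h1⟩

theorem relE_le {x w : V} {ξ : V'} (hw : w ∈ relE p T' x ξ) :
    p w ξ = 0 := hw ξ (Submodule.subset_span (by simp))

theorem relE_trans (d' : RelData Γ p.flip N T' h') {x w w' : V} {ξ : V'} (hw : p w ξ = 0)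
    (hwE : w ∉ relE p T' x ξ) (hw' : p w' ξ = 0) (hwE' : w' ∉ relE p T' x ξ) :
    ∃ g : Γ, g • x = x ∧ g • ξ = ξ ∧ g • w = w' := by
  obtain ⟨η, h1, h2⟩ := d'.exists_of_notMem_relE hw hwE
  obtain ⟨η', h1', h2'⟩ := d'.exists_of_notMem_relE hw' hwE'
  obtain ⟨g, a, b, c⟩ := d'.rel.flag_trans_right h1 h1' hw h2 hw' h2'
  exact ⟨g, b, a, c⟩

theorem relZ_inf_relY_const (d : RelData Γ p N T h) (d' : RelData Γ p.flip N T' h') {x w w' : V}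
    {ξ : V'} (hw : p w ξ = 0) (hwE : w ∉ relE p T' x ξ) (hw' : p w' ξ = 0)
    (hwE' : w' ∉ relE p T' x ξ) :
    Nat.card (relZ T x ξ ⊓ relY p T x w : Submodule (ZMod 2) V) =
      Nat.card (relZ T x ξ ⊓ relY p T x w' : Submodule (ZMod 2) V) := by
  obtain ⟨g, a, b, c⟩ := d'.relE_trans hw hwE hw' hwE'
  rw [← ncard_submodule, ← ncard_submodule]
  refine ncard_smul_setOf g fun z => ?_
  change z ∈ relZ T x ξ ⊓ relY p T x w ↔ g • z ∈ relZ T x ξ ⊓ relY p T x w'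
  rw [Submodule.mem_inf, Submodule.mem_inf, ← d.smul_mem_relZ g, ← smul_mem_relY d.rel d.two g,
    a, b, c]

theorem two_le_card_inf (d : RelData Γ p N T h) {x w : V} {ξ : V'} (hx : x ≠ 0) :
    ∃ k, Nat.card (relZ T x ξ ⊓ relY p T x w : Submodule (ZMod 2) V) = 2 ^ (k + 1) := by
  obtain ⟨k, hk⟩ := card_submodule_two_pow (relZ T x ξ ⊓ relY p T x w)
  have h1 : Submodule.span (ZMod 2) {x} ≤ relZ T x ξ ⊓ relY p T x w := by
    rw [Submodule.span_singleton_le_iff_mem]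
    exact ⟨Submodule.subset_span (by simp), left_mem_relY d.rel x w⟩
  have h2 := card_submodule_mono h1
  rw [card_span_one hx, hk] at h2
  refine ⟨k - 1, ?_⟩
  rw [hk]
  congr 1
  have : k ≠ 0 := by rintro rfl; norm_num at h2
  omega

theorem ncard_eq_card_filter {α : Type*} [Fintype α] (P : α → Prop) [DecidablePred P] :
    {a | P a}.ncard = (Finset.univ.filter P).card := by
  rw [Set.ncard_eq_toFinset_card']
  congr 1
  ext
  simp

theorem relY_le_ker {x z w : V} {ξ : V'} (hT : T x z ξ)
    (hw : w ∈ relY p T x z) : p w ξ = 0 := hw ξ hT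

theorem relY_of_mem_span (d : RelData Γ p N T h) {x z : V} (hz : z ∈ Submodule.span (ZMod 2) {x}) :
    relY p T x z = ⊤ := by
  rw [eq_top_iff]
  intro w _ ξ hT
  exfalso
  have := d.rel.ne _ _ _ hT
  rcases mem_span_one.1 hz with rfl | rfl
  · exact this.2.1 rfl
  · exact this.2.2.1 rfl

theorem sum_card_inf (d : RelData Γ p N T h) [Fintype V] {x : V} {ξ : V'} (hx : x ≠ 0) (hξ : ξ ≠ 0)
    (hxξ : p x ξ = 0) [DecidablePred fun w => p w ξ = 0] :
    ∑ w ∈ Finset.univ.filter (fun w => p w ξ = 0),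
      Nat.card (relZ T x ξ ⊓ relY p T x w : Submodule (ZMod 2) V) =
      2 * 2 ^ (N - 1) + (2 ^ (h + 1) - 2) * 2 ^ (N - h) := by
  classical
  set FW := Finset.univ.filter (fun w => p w ξ = 0)
  set FZ := Finset.univ.filter (fun z => z ∈ relZ T x ξ)
  set FX := Finset.univ.filter (fun z => z ∈ Submodule.span (ZMod 2) {x})
  have hXZ : Submodule.span (ZMod 2) {x} ≤ relZ T x ξ := by
    rw [Submodule.span_singleton_le_iff_mem]
    exact Submodule.subset_span (by simp)
  have hFXZ : FX ⊆ FZ := by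
    intro z hz
    simp only [FX, FZ, Finset.mem_filter, Finset.mem_univ, true_and] at hz ⊢
    exact hXZ hz
  have cX : FX.card = 2 := by rw [← card_span_one hx, ← ncard_submodule, ← ncard_eq_card_filter]; rfl
  have cZ : FZ.card = 2 ^ (h + 1) := by
    rw [← d.cardZ hx hξ hxξ, ← ncard_submodule, ← ncard_eq_card_filter]; rfl
  have h1 := Finset.sum_card_bipartiteAbove_eq_sum_card_bipartiteBelow
    (fun w z => w ∈ relY p T x z) (s := FW) (t := FZ)
  have h2 : ∑ w ∈ FW, (Finset.bipartiteAbove (fun w z => w ∈ relY p T x z) FZ w).card =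
      ∑ w ∈ FW, Nat.card (relZ T x ξ ⊓ relY p T x w : Submodule (ZMod 2) V) := by
    refine Finset.sum_congr rfl fun w _ => ?_
    rw [Finset.bipartiteAbove, Finset.filter_filter, ← ncard_eq_card_filter, ← ncard_submodule]
    congr 1
    ext z
    change _ ↔ z ∈ relZ T x ξ ⊓ relY p T x w
    rw [Submodule.mem_inf, mem_relY_rotate d.two d.rel (w := z)]
    rfl
  rw [← h2, h1, ← Finset.sum_sdiff hFXZ, add_comm]
  congr 1
  · have h0 : 2 * 2 ^ (N - 1) = ∑ z ∈ FX, 2 ^ (N - 1) := by rw [Finset.sum_const, smul_eq_mul, cX]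
    rw [h0]
    refine Finset.sum_congr rfl fun z hz => ?_
    rw [← ncard_ker_of_ne d.two hξ, ncard_eq_card_filter]
    congr 1
    ext w
    rw [Finset.mem_bipartiteBelow, d.relY_of_mem_span (by simpa [FX] using hz)]
    simp [FW]
  · have h0 : (2 ^ (h + 1) - 2) * 2 ^ (N - h) = ∑ z ∈ FZ \ FX, 2 ^ (N - h) := by
      rw [Finset.sum_const, smul_eq_mul, Finset.card_sdiff_of_subset hFXZ, cX, cZ]
    rw [h0]
    refine Finset.sum_congr rfl fun z hz => ?_
    simp only [FX, FZ, Finset.mem_sdiff, Finset.mem_filter, Finset.mem_univ, true_and,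
      mem_span_one] at hz
    have hT : T x z ξ := by
      rcases (mem_relZ d.two d.rel).1 hz.1 with h | h | h
      · exact absurd (Or.inl h) hz.2
      · exact absurd (Or.inr h) hz.2
      · exact h
    have h3 := d.rel.ne _ _ _ hT
    rw [← (d.cardY_sub h3.1 h3.2.1 h3.2.2.1).2, ← ncard_submodule]
    rw [Finset.bipartiteBelow, Finset.filter_filter, ← ncard_eq_card_filter]
    congr 1
    ext w
    change _ ∧ _ ↔ w ∈ relY p T x z
    exact ⟨fun h => h.2, fun h => ⟨relY_le_ker hT h, h⟩⟩

end RelData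

namespace RelData

variable {Γ V V' : Type*} [Group Γ] [AddCommGroup V] [Module (ZMod 2) V]
    [AddCommGroup V'] [Module (ZMod 2) V'] [DistribMulAction Γ V] [DistribMulAction Γ V']
    {p : V →ₗ[ZMod 2] V' →ₗ[ZMod 2] ZMod 2} {N : ℕ} {T : V → V → V' → Prop}
    [Finite Γ] [Finite V] [Finite V'] {h h' : ℕ} {T' : V' → V' → V → Prop}

theorem _root_.counting_dichotomy {a u t k S : ℤ} (ha : 1 ≤ a) (hu : 4 ≤ u) (ht : 1 ≤ t)
    (h2 : 2 * a ≤ S) (hS : S ≤ 2 * u * a) (hk : k = 2 ∨ k = 4 ∨ 8 ≤ k)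
    (h : S + (a * u * t - a) * k = 2 * (a * u * t) + (2 * u - 2) * (2 * a * t)) :
    k = 4 ∧ t = 1 ∧ S = 2 * u * a := by
  have h4 : 0 ≤ a * (u * (t - 1)) :=
    mul_nonneg (by linarith) (mul_nonneg (by linarith) (by linarith))
  have h5 : 0 ≤ a * (t - 1) := mul_nonneg (by linarith) (by linarith)
  have h6 : 0 ≤ (a * (t - 1)) * (u - 4) := mul_nonneg h5 (by linarith)
  have h7 : 0 ≤ a * (u - 4) := mul_nonneg (by linarith) (by linarith)
  rcases hk with rfl | rfl | hk
  · exfalso; nlinarith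
  · have : a * (t - 1) = 0 := by nlinarith
    have ht : t = 1 := by
      rcases mul_eq_zero.1 this with h | h <;> linarith
    subst ht
    exact ⟨rfl, rfl, by linarith⟩
  · exfalso
    have : 0 ≤ (a * u * t - a) * (k - 8) := mul_nonneg (by nlinarith) (by linarith)
    nlinarith

theorem eq_and_inf (d : RelData Γ p N T h) (d' : RelData Γ p.flip N T' h') (hN : h + 2 < N)
    (h2 : 2 ≤ h) (hle : h ≤ h') {x : V} {ξ : V'} (hx : x ≠ 0) (hξ : ξ ≠ 0) (hxξ : p x ξ = 0) :
    h = h' ∧ (∀ w ∈ relE p T' x ξ, relZ T x ξ ≤ relY p T x w) ∧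
      ∀ w, p w ξ = 0 → w ∉ relE p T' x ξ →
        Nat.card (relZ T x ξ ⊓ relY p T x w : Submodule (ZMod 2) V) = 4 := by
  classical
  have := Fintype.ofFinite V
  have hadd := d.add_le d' hN
  set FW := Finset.univ.filter (fun w => p w ξ = 0) with hFW
  set FE := Finset.univ.filter (fun w => w ∈ relE p T' x ξ) with hFE
  set m : V → ℕ := fun w => Nat.card (relZ T x ξ ⊓ relY p T x w : Submodule (ZMod 2) V) with hm
  have hEW : FE ⊆ FW := by
    intro w hw
    simp only [FE, FW, Finset.mem_filter, Finset.mem_univ, true_and] at hw ⊢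
    exact relE_le hw
  have cW : FW.card = 2 ^ (N - 1) := by
    rw [← ncard_ker_of_ne d.two hξ, ncard_eq_card_filter]
  have cE : FE.card = 2 ^ (N - 1 - h') := by
    have h1 := d'.card_perpZ hx hξ hxξ
    have h3 : 2 ^ N = 2 ^ (h' + 1) * 2 ^ (N - 1 - h') := by rw [← pow_add]; congr 1; omega
    rw [← Nat.eq_of_mul_eq_mul_left (Nat.two_pow_pos _) (h1.trans h3), ← ncard_submodule, ← ncard_eq_card_filter]
    rfl
  have hsum := d.sum_card_inf hx hξ hxξ
  rw [← hFW, ← Finset.sum_sdiff hEW] at hsum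
  have hZ := d.cardZ hx hξ hxξ
  have hub : ∀ w, m w ≤ 2 ^ (h + 1) := fun w => hZ ▸ card_submodule_mono inf_le_left
  have hlb : ∀ w, 2 ≤ m w := by
    intro w
    obtain ⟨k, hk⟩ := d.two_le_card_inf (w := w) (ξ := ξ) hx
    simp only [hm]
    rw [hk, pow_succ]
    have := Nat.one_le_two_pow (n := k)
    omega
  have hne : ∃ w0, p w0 ξ = 0 ∧ w0 ∉ relE p T' x ξ := by
    by_contra hc
    push Not at hc
    have : FW ⊆ FE := by
      intro w hw
      simp only [FE, FW, Finset.mem_filter, Finset.mem_univ, true_and] at hw ⊢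
      exact hc w hw
    have := Finset.card_le_card this
    rw [cW, cE, Nat.pow_le_pow_iff_right (by norm_num)] at this
    omega
  obtain ⟨w0, hw0, hwE0⟩ := hne
  have hconst : ∀ w ∈ FW \ FE, m w = m w0 := by
    intro w hw
    simp only [FE, FW, Finset.mem_sdiff, Finset.mem_filter, Finset.mem_univ, true_and] at hw
    exact d.relZ_inf_relY_const d' hw.1 hw.2 hw0 hwE0
  rw [Finset.sum_congr rfl hconst, Finset.sum_const, smul_eq_mul,
    Finset.card_sdiff_of_subset hEW, cW, cE] at hsum
  set S := ∑ w ∈ FE, m w with hSdef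
  have hS2 : 2 ^ (N - 1 - h') * 2 ≤ S := by
    rw [← cE]
    exact Finset.card_nsmul_le_sum _ _ _ fun w _ => hlb w
  have hS3 : S ≤ 2 ^ (N - 1 - h') * 2 ^ (h + 1) := by
    rw [← cE]
    exact Finset.sum_le_card_nsmul _ _ _ fun w _ => hub w
  have e1 : 2 ^ (N - 1) = 2 ^ (N - 1 - h') * 2 ^ h * 2 ^ (h' - h) := by
    rw [← pow_add, ← pow_add]; congr 1; omega
  have e2 : 2 ^ (N - h) = 2 * 2 ^ (N - 1 - h') * 2 ^ (h' - h) := by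
    rw [← pow_succ', ← pow_add]; congr 1; omega
  have hk : m w0 = 2 ∨ m w0 = 4 ∨ 8 ≤ m w0 := by
    obtain ⟨k, hk⟩ := d.two_le_card_inf (w := w0) (ξ := ξ) hx
    simp only [hm]
    rw [hk]
    rcases k with _ | _ | k
    · simp
    · simp
    · right; right
      have := Nat.one_le_two_pow (n := k)
      rw [show k + 1 + 1 + 1 = k + 3 by omega, pow_add]
      omega
  rw [e2] at hsum
  rw [e1] at hsum
  rw [pow_succ] at hS3 hsum hZ
  simp only [pow_succ 2 h] at hub
  have a1 : 1 ≤ 2 ^ (N - 1 - h') := Nat.one_le_two_pow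
  have a2 : 2 ^ 2 ≤ 2 ^ h := Nat.pow_le_pow_right (by norm_num) h2
  have a3 : 1 ≤ 2 ^ (h' - h) := Nat.one_le_two_pow
  have a4 : h' - h = 0 ∨ 2 ≤ 2 ^ (h' - h) := by
    rcases Nat.eq_zero_or_pos (h' - h) with h | h
    · exact Or.inl h
    · exact Or.inr (Nat.pow_le_pow_right (n := 2) (by norm_num) h)
  generalize 2 ^ (N - 1 - h') = a at *
  generalize 2 ^ h = u at *
  generalize 2 ^ (h' - h) = t at *
  have a5 : a ≤ a * u * t := by
    rw [mul_assoc]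
    exact Nat.le_mul_of_pos_right a (Nat.mul_pos (by omega) (by omega))
  have hz : (S : ℤ) + ((a : ℤ) * u * t - a) * (m w0 : ℤ) =
      2 * ((a : ℤ) * u * t) + (2 * u - 2) * (2 * a * t) := by
    have h3 : ((a * u * t - a : ℕ) : ℤ) = (a : ℤ) * u * t - a := by
      rw [Nat.cast_sub a5]; push_cast; ring
    have h4 : ((u * 2 - 2 : ℕ) : ℤ) = 2 * u - 2 := by
      rw [Nat.cast_sub (by omega)]; push_cast; ring
    rw [← h3, ← h4]
    have := congrArg (Nat.cast : ℕ → ℤ) hsum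
    push_cast at this ⊢
    linarith
  obtain ⟨b1, b2, b3⟩ := counting_dichotomy (a := a) (u := u) (t := t) (k := m w0) (S := S)
    (by exact_mod_cast a1) (by norm_num at a2; exact_mod_cast a2) (by exact_mod_cast a3)
    (by rw [mul_comm]; exact_mod_cast hS2)
    (by rw [mul_comm, mul_comm (2 : ℤ)]; exact_mod_cast hS3) (by exact_mod_cast hk) hz
  norm_cast at b1 b2 b3
  refine ⟨by omega, fun w hw => ?_, fun w hw hwE => ?_⟩
  · have h5 : ∀ w ∈ FE, m w = u * 2 := by
      refine (Finset.sum_eq_sum_iff_of_le fun w _ => hub w).1 ?_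
      rw [Finset.sum_const, cE, smul_eq_mul, ← hSdef, b3]
      ring
    have h6 := h5 w (by simpa [FE] using hw)
    have h7 := submodule_eq_of_card (inf_le_left : relZ T x ξ ⊓ relY p T x w ≤ relZ T x ξ)
      (hZ.trans h6.symm).le
    exact inf_eq_left.1 h7
  · rw [← b1]
    exact d.relZ_inf_relY_const d' hw hwE hw0 hwE0

end RelData

theorem add_mem_of_card_le_two_mul {V : Type*} [AddCommGroup V] [Module (ZMod 2) V] [Finite V]
    {A B : Submodule (ZMod 2) V} (hAB : A ≤ B) (hc : Nat.card B ≤ 2 * Nat.card A) {a b : V}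
    (ha : a ∈ B) (hb : b ∈ B) (haA : a ∉ A) (hbA : b ∉ A) : a + b ∈ A := by
  have h1 : A ⊔ Submodule.span (ZMod 2) {a} ≤ B :=
    sup_le hAB ((Submodule.span_singleton_le_iff_mem _ _).2 ha)
  have ha' : a ∈ A ⊔ Submodule.span (ZMod 2) {a} :=
    Submodule.mem_sup_right (Submodule.mem_span_singleton_self a)
  have h2 : Nat.card A < Nat.card (A ⊔ Submodule.span (ZMod 2) {a} : Submodule (ZMod 2) V) := by
    by_contra hcon
    push Not at hcon
    exact haA ((submodule_eq_of_card le_sup_left hcon) ▸ ha')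
  obtain ⟨k, hk⟩ := card_submodule_two_pow A
  obtain ⟨l, hl⟩ := card_submodule_two_pow (A ⊔ Submodule.span (ZMod 2) {a})
  rw [hk, hl, Nat.pow_lt_pow_iff_right (by norm_num)] at h2
  have h3 := submodule_eq_of_card h1 (by
    rw [hl]
    refine hc.trans ?_
    rw [hk, ← pow_succ']
    exact Nat.pow_le_pow_right (by norm_num) h2)
  rw [← h3] at hb
  obtain ⟨u, hu, v, hv, rfl⟩ := Submodule.mem_sup.1 hb
  rcases mem_span_one.1 hv with rfl | rfl
  · simp only [add_zero] at hbA
    exact absurd hu hbA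
  · rw [add_comm, add_add_cancel_two]
    exact hu

/-- The situation in which a relation and its dual have equal dimension parameters. -/
structure BalancedData (Γ : Type*) {V V' : Type*} [Group Γ] [AddCommGroup V] [Module (ZMod 2) V]
    [AddCommGroup V'] [Module (ZMod 2) V'] [DistribMulAction Γ V] [DistribMulAction Γ V']
    (p : V →ₗ[ZMod 2] V' →ₗ[ZMod 2] ZMod 2) (N : ℕ) (T : V → V → V' → Prop)
    (T' : V' → V' → V → Prop) (h : ℕ) : Prop where
  left : RelData Γ p N T h
  right : RelData Γ p.flip N T' h
  lt : h + 2 < N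
  two_le : 2 ≤ h

namespace BalancedData

variable {Γ V V' : Type*} [Group Γ] [AddCommGroup V] [Module (ZMod 2) V]
    [AddCommGroup V'] [Module (ZMod 2) V'] [DistribMulAction Γ V] [DistribMulAction Γ V']
    {p : V →ₗ[ZMod 2] V' →ₗ[ZMod 2] ZMod 2} {N : ℕ} {T : V → V → V' → Prop}
    [Finite Γ] [Finite V] [Finite V'] {h : ℕ} {T' : V' → V' → V → Prop}

theorem flip (b : BalancedData Γ p N T T' h) : BalancedData Γ p.flip N T' T h :=
  ⟨b.right, b.left, b.lt, b.two_le⟩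

theorem relE_le_relY (b : BalancedData Γ p N T T' h) {x z : V} {ξ : V'} (hT : T x z ξ) :
    relE p T' x ξ ≤ relY p T x z := by
  intro w hw
  obtain ⟨h1, h2, h3, h4, h5, h6⟩ := b.left.rel.ne _ _ _ hT
  have h7 := (b.left.eq_and_inf b.right b.lt b.two_le le_rfl h1 h4 h5).2.1 w hw
  exact (mem_relY_rotate b.left.two b.left.rel).1
    (h7 (Submodule.subset_span (Set.mem_insert_of_mem _ hT)))

theorem card_relE (b : BalancedData Γ p N T T' h) {x : V} {ξ : V'} (hx : x ≠ 0) (hξ : ξ ≠ 0)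
    (hxξ : p x ξ = 0) : Nat.card (relE p T' x ξ) = 2 ^ (N - 1 - h) := by
  have h1 := b.right.card_perpZ hx hξ hxξ
  have h3 : 2 ^ N = 2 ^ (h + 1) * 2 ^ (N - 1 - h) := by
    rw [← pow_add]; congr 1; have := b.lt; omega
  exact Nat.eq_of_mul_eq_mul_left (Nat.two_pow_pos _) (h1.trans h3)

theorem relZ_le_relE (b : BalancedData Γ p N T T' h) {x : V} {ξ : V'} (hx : x ≠ 0) (hξ : ξ ≠ 0)
    (hxξ : p x ξ = 0) : relZ T x ξ ≤ relE p T' x ξ := fun _ hy _ hη =>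
  b.left.orthogonal_Z b.right b.lt hx hξ hxξ hy hη

theorem perp_relE (b : BalancedData Γ p N T T' h) (x : V) (ξ : V') :
    perpS p (relE p T' x ξ : Set V) = relZ T' ξ x := by
  rw [relE, relZ, perpS_span]
  exact b.left.two.nondeg.flip.perp_perp_set _

theorem relN_le_relZ (b : BalancedData Γ p N T T' h) {x z : V} {ξ : V'} (hT : T x z ξ) :
    relN T x z ≤ relZ T' ξ x := by
  rw [← b.left.perp_relY, ← b.perp_relE]
  exact perpS_anti (b.relE_le_relY hT)

theorem add_mem_relE (b : BalancedData Γ p N T T' h) {x z w w' : V} {ξ : V'} (hT : T x z ξ)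
    (hw : w ∈ relY p T x z) (hw' : w' ∈ relY p T x z) (hwE : w ∉ relE p T' x ξ)
    (hwE' : w' ∉ relE p T' x ξ) : w + w' ∈ relE p T' x ξ := by
  obtain ⟨h1, h2, h3, h4, h5, h6⟩ := b.left.rel.ne _ _ _ hT
  refine add_mem_of_card_le_two_mul (b.relE_le_relY hT) ?_ hw hw' hwE hwE'
  rw [(b.left.cardY_sub h1 h2 h3).2, b.card_relE h1 h4 h5, ← pow_succ']
  exact Nat.pow_le_pow_right (by norm_num) (by have := b.lt; omega)

theorem card_inf (b : BalancedData Γ p N T T' h) {x w : V} {ξ : V'} (hx : x ≠ 0) (hξ : ξ ≠ 0)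
    (hxξ : p x ξ = 0) (hw : p w ξ = 0) (hwE : w ∉ relE p T' x ξ) :
    Nat.card (relZ T x ξ ⊓ relY p T x w : Submodule (ZMod 2) V) = 4 :=
  (b.left.eq_and_inf b.right b.lt b.two_le le_rfl hx hξ hxξ).2.2 w hw hwE

theorem exists_partner (b : BalancedData Γ p N T T' h) {x w : V} {ξ : V'} (hx : x ≠ 0) (hξ : ξ ≠ 0)
    (hxξ : p x ξ = 0) (hw : p w ξ = 0) (hwE : w ∉ relE p T' x ξ) :
    ∃ z, T x z ξ ∧ w ∈ relY p T x z := by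
  have h1 := b.card_inf hx hξ hxξ hw hwE
  obtain ⟨z, hz, hzx⟩ := exists_mem_notMem (A := Submodule.span (ZMod 2) {x})
    (B := relZ T x ξ ⊓ relY p T x w) (by rw [card_span_one hx, h1]; norm_num)
  rw [mem_span_one] at hzx
  refine ⟨z, ?_, (mem_relY_rotate b.left.two b.left.rel).1 hz.2⟩
  rcases (mem_relZ b.left.two b.left.rel).1 hz.1 with h | h | h
  · exact absurd (Or.inl h) hzx
  · exact absurd (Or.inr h) hzx
  · exact h

theorem partner_unique (b : BalancedData Γ p N T T' h) {x w z z' : V} {ξ : V'} (hw : p w ξ = 0)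
    (hwE : w ∉ relE p T' x ξ) (hT : T x z ξ) (hT' : T x z' ξ) (hz : w ∈ relY p T x z)
    (hz' : w ∈ relY p T x z') : z' ∈ Submodule.span (ZMod 2) {x, z} := by
  obtain ⟨h1, h2, h3, h4, h5, h6⟩ := b.left.rel.ne _ _ _ hT
  have hle : Submodule.span (ZMod 2) {x, z} ≤ relZ T x ξ ⊓ relY p T x w := by
    refine le_inf (Submodule.span_le.2 ?_) (Submodule.span_le.2 ?_)
    · rintro a (rfl | rfl)
      · exact Submodule.subset_span (by simp)
      · exact Submodule.subset_span (Set.mem_insert_of_mem _ hT)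
    · rintro a (rfl | rfl)
      · exact left_mem_relY b.left.rel _ _
      · exact (mem_relY_rotate b.left.two b.left.rel).1 hz
  rw [submodule_eq_of_card hle (by rw [b.card_inf h1 h4 h5 hw hwE, card_span_two h1 h2 h3])]
  exact ⟨Submodule.subset_span (Set.mem_insert_of_mem _ hT'),
    (mem_relY_rotate b.left.two b.left.rel).1 hz'⟩

theorem relY_inf_relY (b : BalancedData Γ p N T T' h) {x z z' : V} {ξ : V'} (hT : T x z ξ)
    (hT' : T x z' ξ) (hzz' : z' ∉ Submodule.span (ZMod 2) {x, z}) :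
    relY p T x z ⊓ relY p T x z' = relE p T' x ξ := by
  refine le_antisymm (fun w hw => ?_) (le_inf (b.relE_le_relY hT) (b.relE_le_relY hT'))
  by_contra hwE
  exact hzz' (b.partner_unique (RelData.relY_le_ker hT hw.1) hwE hT hT' hw.1 hw.2)

theorem relY_add_self (b : BalancedData Γ p N T T' h) {x z w : V} (hw : w ∈ relY p T x z) :
    w ∈ relY p T x (z + x) := by
  have h1 := (mem_relY_rotate b.left.two b.left.rel).1 hw
  exact (mem_relY_rotate b.left.two b.left.rel).1 (add_mem h1 (left_mem_relY b.left.rel _ _))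

theorem relE_eq_of_three_le (b : BalancedData Γ p N T T' h) (h3 : 3 ≤ h) {x z : V} {ξ ξ' : V'}
    (hT : T x z ξ) (hT' : T x z ξ') : relE p T' x ξ = relE p T' x ξ' := by
  by_cases heq : ξ = ξ'
  · rw [heq]
  obtain ⟨hx, hz, hxz, hξ, hxξ, hzξ⟩ := b.left.rel.ne _ _ _ hT
  obtain ⟨-, -, -, hξ', hxξ', -⟩ := b.left.rel.ne _ _ _ hT'
  have c1 := b.left.two.nondeg.flip.four_mul_card_perp_two hξ hξ' heq
  have c2 := (b.left.cardY_sub hx hz hxz).2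
  obtain ⟨w, hw, hwY⟩ := exists_mem_notMem (A := relY p T x z) (B := perpS p.flip {ξ, ξ'}) (by
    rw [← b.left.two.nondeg.card_eq, b.left.two.card] at c1
    have h5 : 2 ^ N = 4 * 2 ^ (N - 2) := by
      rw [show (4 : ℕ) = 2 ^ 2 by norm_num, ← pow_add]; congr 1; have := b.lt; omega
    have h6 : Nat.card (perpS p.flip ({ξ, ξ'} : Set V')) = 2 ^ (N - 2) := by omega
    rw [h6, c2]
    exact Nat.pow_lt_pow_right (by norm_num) (by have := b.lt; omega))
  obtain ⟨hw1, hw2⟩ := (mem_perpS_two (p := p.flip)).1 hw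
  have hw1 : p w ξ = 0 := hw1
  have hw2 : p w ξ' = 0 := hw2
  have hwE : w ∉ relE p T' x ξ := fun h => hwY (b.relE_le_relY hT h)
  obtain ⟨z', hz', hwz'⟩ := b.exists_partner hx hξ hxξ hw1 hwE
  have hzz' : z' ∉ Submodule.span (ZMod 2) {x, z} := by
    have h7 := (b.left.rel.ne _ _ _ hz')
    intro hcon
    rcases mem_span_two.1 hcon with rfl | rfl | rfl | rfl
    · exact h7.2.1 rfl
    · exact h7.2.2.1 rfl
    · exact hwY hwz'
    · have := b.relY_add_self hwz'
      rw [add_comm x, add_add_cancel_two] at this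
      exact hwY this
  have hT2 : T x z' ξ' := by
    rw [b.left.rel_iff_mem hξ', ← b.left.perp_relY]
    intro v hv
    by_cases hvE : v ∈ relE p T' x ξ
    · exact RelData.relY_le_ker hT' (b.relE_le_relY hT hvE)
    · have h8 := b.add_mem_relE hz' hv hwz' hvE hwE
      have h9 := RelData.relY_le_ker hT' (b.relE_le_relY hT h8)
      rwa [map_add, LinearMap.add_apply, hw2, add_zero] at h9
  rw [← b.relY_inf_relY hT hz' hzz', ← b.relY_inf_relY hT' hT2 hzz']

end BalancedData

theorem exists_ne_zero_inf {V : Type*} [AddCommGroup V] [Module (ZMod 2) V] [Finite V]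
    {A B D : Submodule (ZMod 2) V} (hA : A ≤ D) (hB : B ≤ D)
    (hc : Nat.card D < Nat.card A * Nat.card B) : ∃ v, v ≠ 0 ∧ v ∈ A ∧ v ∈ B := by
  by_contra hcon
  push Not at hcon
  have : Function.Injective fun q : A × B => (⟨q.1 + q.2, add_mem (hA q.1.2) (hB q.2.2)⟩ : D) := by
    rintro ⟨a, b⟩ ⟨a', b'⟩ hab
    have h1 : (a : V) + b = a' + b' := congrArg Subtype.val hab
    have h2 : (a : V) + a' = b + b' := by
      have h5 : (a : V) = a' + b' + b := eq_add_two.2 h1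
      have h6 : (a' : V) + b' + b + a' = b + b' + (a' + a') := by abel
      rw [h5, h6, add_self_two, add_zero]
    have h3 : (a : V) + a' = 0 := by
      by_contra h0
      exact hcon _ h0 (add_mem a.2 a'.2) (h2 ▸ add_mem b.2 b'.2)
    rw [h3] at h2
    ext
    · exact add_eq_zero_two.1 h3
    · exact add_eq_zero_two.1 h2.symm
  have := Nat.card_le_card_of_injective _ this
  rw [Nat.card_prod] at this
  omega

theorem exists_ne_zero_mem_ker {V : Type*} [AddCommGroup V] [Module (ZMod 2) V] [Finite V]
    {D : Submodule (ZMod 2) V} (hc : 2 < Nat.card D) (f : V →ₗ[ZMod 2] ZMod 2) :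
    ∃ v ∈ D, v ≠ 0 ∧ f v = 0 := by
  obtain ⟨a, ha, ha0⟩ := exists_mem_notMem (A := ⊥) (B := D) (by
    rw [Nat.card_unique]; omega)
  have ha0 : a ≠ 0 := by simpa using ha0
  obtain ⟨b, hb, hba⟩ := exists_mem_notMem (A := Submodule.span (ZMod 2) {a}) (B := D) (by
    rw [card_span_one ha0]; exact hc)
  rw [mem_span_one] at hba
  push Not at hba
  rcases zmod_two_cases (f a) with h1 | h1
  · exact ⟨a, ha, ha0, h1⟩
  rcases zmod_two_cases (f b) with h2 | h2
  · exact ⟨b, hb, hba.1, h2⟩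
  refine ⟨a + b, add_mem ha hb, fun h => hba.2 (add_eq_zero_two.1 h).symm, ?_⟩
  rw [map_add, h1, h2]
  rfl

namespace BalancedData

variable {Γ V V' : Type*} [Group Γ] [AddCommGroup V] [Module (ZMod 2) V]
    [AddCommGroup V'] [Module (ZMod 2) V'] [DistribMulAction Γ V] [DistribMulAction Γ V']
    {p : V →ₗ[ZMod 2] V' →ₗ[ZMod 2] ZMod 2} {N : ℕ} {T : V → V → V' → Prop}
    [Finite Γ] [Finite V] [Finite V'] {h : ℕ} {T' : V' → V' → V → Prop}

theorem rel_add (b : BalancedData Γ p N T T' h) {x z z' : V} {ξ : V'} (hT : T x z ξ)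
    (hT' : T x z' ξ) (hzz' : z' ∉ Submodule.span (ZMod 2) {x, z}) : T x (z + z') ξ := by
  have h1 : z + z' ∈ relZ T x ξ := add_mem
    (Submodule.subset_span (Set.mem_insert_of_mem _ hT))
    (Submodule.subset_span (Set.mem_insert_of_mem _ hT'))
  rw [mem_span_two] at hzz'
  push Not at hzz'
  rcases (mem_relZ b.left.two b.left.rel).1 h1 with h | h | h
  · exact absurd (add_eq_zero_two.1 h).symm hzz'.2.2.1
  · refine absurd ?_ hzz'.2.2.2
    rw [← h, add_comm z, add_add_cancel_two]
  · exact h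

theorem notMem_span_add {x z z' : V} (hzz' : z' ∉ Submodule.span (ZMod 2) {x, z}) :
    z + z' ∉ Submodule.span (ZMod 2) {x, z} := fun hc => hzz' (by
  have := add_mem (Submodule.subset_span (by simp) : z ∈ Submodule.span (ZMod 2) {x, z}) hc
  rwa [add_add_cancel_left_two] at this)

theorem notMem_span_add' {x z z' : V} (hxz : z ∉ Submodule.span (ZMod 2) {x, z'}) :
    z + z' ∉ Submodule.span (ZMod 2) {x, z'} := by
  rw [add_comm]; exact notMem_span_add hxz

theorem notMem_span_exchange {x z z' : V} (hz : z ≠ 0) (hxz : x ≠ z)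
    (h : z' ∉ Submodule.span (ZMod 2) {x, z}) : z ∉ Submodule.span (ZMod 2) {x, z'} := by
  rw [mem_span_two] at h ⊢
  push Not at h ⊢
  refine ⟨hz, hxz.symm, h.2.2.1.symm, fun hc => h.2.2.2 ?_⟩
  rw [hc, add_add_cancel_left_two]

theorem add_mem_relY_add (b : BalancedData Γ p N T T' h) {x z z' a c : V} {ξ : V'}
    (hT : T x z ξ) (hT' : T x z' ξ) (hzz' : z' ∉ Submodule.span (ZMod 2) {x, z})
    (ha : a ∈ relY p T x z) (hc : c ∈ relY p T x z') (haE : a ∉ relE p T' x ξ)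
    (hcE : c ∉ relE p T' x ξ) : a + c ∈ relY p T x (z + z') := by
  have hT3 := b.rel_add hT hT' hzz'
  obtain ⟨hx, hz, hxz, hξ, hxξ, hzξ⟩ := b.left.rel.ne _ _ _ hT3
  have hle : relY p T x (z + z') ≤ relY p T x z ⊔ relY p T x z' := by
    rw [← b.left.two.nondeg.perp_perp (relY p T x z ⊔ relY p T x z')]
    intro w hw η hη
    have h1 : η ∈ relN T x z := by
      rw [← b.left.perp_relY]
      exact perpS_anti (SetLike.coe_subset_coe.2 le_sup_left) hη
    have h2 : η ∈ relN T x z' := by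
      rw [← b.left.perp_relY]
      exact perpS_anti (SetLike.coe_subset_coe.2 le_sup_right) hη
    by_cases h0 : η = 0
    · simp [h0]
    rw [← b.left.rel_iff_mem h0] at h1 h2
    change p w η = 0
    exact RelData.relY_le_ker (b.rel_add h1 h2 hzz') hw
  obtain ⟨v, hv, hvE⟩ := exists_mem_notMem (A := relE p T' x ξ) (B := relY p T x (z + z')) (by
    rw [b.card_relE hx hξ hxξ, (b.left.cardY_sub hx hz hxz).2]
    exact Nat.pow_lt_pow_right (by norm_num) (by have := b.lt; omega))
  obtain ⟨a', ha', c', hc', rfl⟩ := Submodule.mem_sup.1 (hle hv)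
  have ha'E : a' ∉ relE p T' x ξ := fun hcon => hvE (by
    have hne := b.left.rel.ne _ _ _ hT
    rw [← b.relY_inf_relY hT' hT3 (notMem_span_add' (notMem_span_exchange hne.2.1 hne.2.2.1 hzz'))]
    exact ⟨add_mem (b.relE_le_relY hT' hcon) hc', hv⟩)
  have hc'E : c' ∉ relE p T' x ξ := fun hcon => hvE (by
    rw [← b.relY_inf_relY hT hT3 (notMem_span_add hzz')]
    exact ⟨add_mem ha' (b.relE_le_relY hT hcon), hv⟩)
  have h1 := b.relE_le_relY hT3 (b.add_mem_relE hT ha ha' haE ha'E)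
  have h2 := b.relE_le_relY hT3 (b.add_mem_relE hT' hc hc' hcE hc'E)
  have h3 := add_mem (add_mem h1 h2) hv
  have h4 : a + a' + (c + c') + (a' + c') = a + c + (a' + a') + (c' + c') := by abel
  rwa [h4, add_self_two, add_self_two, add_zero, add_zero] at h3

end BalancedData

theorem lt_two_pow_dvd {a k l : ℕ} (h : 2 ^ k < 2 ^ l) (ha : 2 ^ a ≤ 2 ^ k) :
    2 ^ (a + 1) ≤ 2 ^ l := by
  rw [Nat.pow_lt_pow_iff_right (by norm_num)] at h
  rw [Nat.pow_le_pow_iff_right (by norm_num)] at ha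
  exact Nat.pow_le_pow_right (by norm_num) (by omega)

theorem card_span_insert_le {V : Type*} [AddCommGroup V] [Module (ZMod 2) V] [Finite V] (a : V)
    (s : Set V) : Nat.card (Submodule.span (ZMod 2) (insert a s)) ≤
      2 * Nat.card (Submodule.span (ZMod 2) s) := by
  have : Function.Surjective fun q : ({0, a} : Set V) × Submodule.span (ZMod 2) s =>
      (⟨q.1 + q.2, by
        obtain ⟨⟨q, hq⟩, r, hr⟩ := q
        refine add_mem ?_ (Submodule.span_mono (Set.subset_insert _ _) hr)
        rcases hq with rfl | rfl
        · exact zero_mem _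
        · exact Submodule.subset_span (by simp)⟩ : Submodule.span (ZMod 2) (insert a s)) := by
    rintro ⟨v, hv⟩
    obtain ⟨c, z, hz, rfl⟩ := Submodule.mem_span_insert.1 hv
    rcases zmod_two_cases c with rfl | rfl
    · exact ⟨⟨⟨0, by simp⟩, ⟨z, hz⟩⟩, by simp⟩
    · exact ⟨⟨⟨a, by simp⟩, ⟨z, hz⟩⟩, by simp⟩
  have h1 := Nat.card_le_card_of_surjective _ this
  rw [Nat.card_prod] at h1
  refine h1.trans (Nat.mul_le_mul_right _ ?_)
  rw [Nat.card_coe_set_eq]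
  exact (Set.ncard_insert_le _ _).trans (by simp)

namespace BalancedData

variable {Γ V V' : Type*} [Group Γ] [AddCommGroup V] [Module (ZMod 2) V]
    [AddCommGroup V'] [Module (ZMod 2) V'] [DistribMulAction Γ V] [DistribMulAction Γ V']
    {p : V →ₗ[ZMod 2] V' →ₗ[ZMod 2] ZMod 2} {N : ℕ} {T : V → V → V' → Prop}
    [Finite Γ] [Finite V] [Finite V'] {h : ℕ} {T' : V' → V' → V → Prop}

theorem exists_rel (b : BalancedData Γ p N T T' h) {x y : V} (hx : x ≠ 0) (hy : y ≠ 0)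
    (hxy : x ≠ y) : ∃ ξ, T x y ξ := by
  have h1 := b.left.cardN x y hx hy hxy
  obtain ⟨ξ, hξ, h0⟩ := exists_mem_notMem (A := ⊥) (B := relN T x y) (by
    rw [h1, Nat.card_unique]; exact Nat.one_lt_two_pow (by have := b.two_le; omega))
  exact ⟨ξ, (b.left.rel_iff_mem (by simpa using h0)).2 hξ⟩

theorem exists_rel_both (b : BalancedData Γ p N T T' h) {x z : V} {ξ η : V'} (hT : T x z ξ)
    (hη : η ∈ relZ T' ξ x) (hη0 : η ≠ 0) : ∃ y, T x y ξ ∧ T x y η := by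
  obtain ⟨hx, hz, hxz, hξ, hxξ, hzξ⟩ := b.left.rel.ne _ _ _ hT
  have hE : ∀ w ∈ relE p T' x ξ, p w η = 0 := fun w hw => hw η hη
  by_cases h1 : T x z η
  · exact ⟨z, hT, h1⟩
  obtain ⟨z', hz', hzz'⟩ := exists_mem_notMem (A := Submodule.span (ZMod 2) {x, z})
    (B := relZ T x ξ) (by
      rw [card_span_two hx hz hxz, b.left.cardZ hx hξ hxξ]
      exact Nat.pow_lt_pow_right (a := 2) (m := 2) (by norm_num) (by have := b.two_le; omega))
  have hT' : T x z' ξ := by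
    have h2 := hzz'
    rw [mem_span_two] at h2
    push Not at h2
    rcases (mem_relZ b.left.two b.left.rel).1 hz' with h | h | h
    · exact absurd h h2.1
    · exact absurd h h2.2.1
    · exact h
  by_cases h2 : T x z' η
  · exact ⟨z', hT', h2⟩
  have hT3 := b.rel_add hT hT' hzz'
  refine ⟨z + z', hT3, ?_⟩
  rw [b.left.rel_iff_mem hη0, ← b.left.perp_relY] at h1 h2 ⊢
  rw [mem_perpS] at h1 h2
  push Not at h1 h2
  obtain ⟨w, hw, hwη⟩ := h1
  obtain ⟨w', hw', hwη'⟩ := h2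
  rw [zmod_two_ne_zero] at hwη hwη'
  have hwE : w ∉ relE p T' x ξ := fun hc => by simp [hE w hc] at hwη
  have hwE' : w' ∉ relE p T' x ξ := fun hc => by simp [hE w' hc] at hwη'
  have hadd := b.add_mem_relY_add hT hT' hzz' hw hw' hwE hwE'
  have haddE : w + w' ∉ relE p T' x ξ := fun hc => hwE (by
    rw [← b.relY_inf_relY hT hT' hzz']
    refine ⟨hw, ?_⟩
    have := add_mem (b.relE_le_relY hT' hc) hw'
    rwa [add_add_cancel_two] at this)
  intro v hv
  by_cases hvE : v ∈ relE p T' x ξ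
  · exact hE v hvE
  have h3 := hE _ (b.add_mem_relE hT3 hv hadd hvE haddE)
  rw [map_add, map_add, LinearMap.add_apply, LinearMap.add_apply, hwη, hwη', CharTwo.add_self_eq_zero, add_zero] at h3
  exact h3

/-- The common kernel attached to a flag depends only on the plane containing it. -/
def _root_.SpreadProp (p : V →ₗ[ZMod 2] V' →ₗ[ZMod 2] ZMod 2) (T : V → V → V' → Prop)
    (T' : V' → V' → V → Prop) : Prop :=
  ∀ x z ξ ξ', T x z ξ → T x z ξ' → relE p T' x ξ = relE p T' x ξ'

theorem spreadData (b : BalancedData Γ p N T T' h) (sp : SpreadProp p T T') {x : V} (hx : x ≠ 0) :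
    ∃ C E, SpreadData (Submodule.span (ZMod 2) {x}) (relY p T x) C E := by
  classical
  have hX : ∀ {z}, z ∉ Submodule.span (ZMod 2) {x} ↔ z ≠ 0 ∧ x ≠ z := fun {z} => by
    rw [mem_span_one, not_or, eq_comm (a := z) (b := x)]
  have hT : ∀ z, ∃ ξ, z ∉ Submodule.span (ZMod 2) {x} → T x z ξ := by
    intro z
    by_cases hz : z ∈ Submodule.span (ZMod 2) {x}
    · exact ⟨0, fun h => absurd hz h⟩
    · obtain ⟨ξ, hξ⟩ := b.exists_rel hx (hX.1 hz).1 (hX.1 hz).2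
      exact ⟨ξ, fun _ => hξ⟩
  choose ξ hξ using hT
  have rot : ∀ {y w}, w ∈ relY p T x y ↔ y ∈ relY p T x w :=
    mem_relY_rotate b.left.two b.left.rel
  set E : V → Submodule (ZMod 2) V := fun z => relE p T' x (ξ z) with hEdef
  have hE : ∀ {z η}, T x z η → relE p T' x η = E z := fun {z η} hη =>
    sp x z η (ξ z) hη (hξ z (by
      have := b.left.rel.ne _ _ _ hη
      exact hX.2 ⟨this.2.1, this.2.2.1⟩))
  set C : V → Submodule (ZMod 2) V := fun z => ⨅ w ∈ E z, relY p T x w with hCdef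
  have hC : ∀ {z y}, y ∈ C z ↔ ∀ w ∈ E z, w ∈ relY p T x y := fun {z y} => by
    simp only [hCdef, Submodule.mem_iInf]
    exact forall₂_congr fun w _ => rot
  -- the set `D z`
  have hD : ∀ {z η}, z ∉ Submodule.span (ZMod 2) {x} → η ∈ relZ T' (ξ z) x → η ≠ 0 →
      p x η = 0 ∧ relE p T' x η = E z := by
    intro z η hz hη h0
    obtain ⟨y, h1, h2⟩ := b.exists_rel_both (hξ z hz) hη h0
    exact ⟨(b.left.rel.ne _ _ _ h2).2.2.2.2.1, by rw [hE h2, ← hE h1]⟩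
  have hCD : ∀ {z y η}, y ∈ C z → T x y η → η ∈ relZ T' (ξ z) x := by
    intro z y η hy hη
    rw [← b.perp_relE]
    exact fun w hw => RelData.relY_le_ker hη (hC.1 hy w hw)
  have hCE : ∀ {z y η}, z ∉ Submodule.span (ZMod 2) {x} → y ∈ C z → T x y η →
      relE p T' x η = E z := fun {z y η} hz hy hη =>
    (hD hz (hCD hy hη) (b.left.rel.ne _ _ _ hη).2.2.2.1).2
  have hDC : ∀ {z y η}, z ∉ Submodule.span (ZMod 2) {x} → η ∈ relZ T' (ξ z) x → T x y η →
      y ∈ C z := by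
    intro z y η hz hη hy
    rw [hC]
    rw [← (hD hz hη (b.left.rel.ne _ _ _ hy).2.2.2.1).2]
    exact b.relE_le_relY hy
  have hEq : ∀ {z y}, z ∉ Submodule.span (ZMod 2) {x} → y ∈ C z →
      y ∉ Submodule.span (ZMod 2) {x} → E y = E z := fun {z y} hz hy hyX =>
    (hE (hξ y hyX)).symm.trans (hCE hz hy (hξ y hyX))
  have hN : ∀ {z y}, z ∉ Submodule.span (ZMod 2) {x} → y ∈ C z → relN T x y ≤ relZ T' (ξ z) x :=
    fun {z y} hz hy => Submodule.span_le.2 fun η hη => hCD hy hη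
  have cardD : ∀ {z}, z ∉ Submodule.span (ZMod 2) {x} →
      Nat.card (relZ T' (ξ z) x) = 2 ^ (h + 1) := fun {z} hz => by
    have := b.left.rel.ne _ _ _ (hξ z hz)
    exact b.right.cardZ this.2.2.2.1 hx this.2.2.2.2.1
  have hinter : ∀ {z y y'}, z ∉ Submodule.span (ZMod 2) {x} → y ∈ C z → y' ∈ C z →
      y ∉ Submodule.span (ZMod 2) {x} → y' ∉ Submodule.span (ZMod 2) {x} →
      ∃ η ∈ relZ T' (ξ z) x, T x y η ∧ T x y' η := by
    intro z y y' hz hy hy' hyX hyX'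
    obtain ⟨η, h0, h1, h2⟩ := exists_ne_zero_inf (hN hz hy) (hN hz hy') (by
      rw [cardD hz, b.left.cardN x y hx (hX.1 hyX).1 (hX.1 hyX).2,
        b.left.cardN x y' hx (hX.1 hyX').1 (hX.1 hyX').2, ← pow_add]
      exact Nat.pow_lt_pow_right (by norm_num) (by have := b.two_le; omega))
    exact ⟨η, hN hz hy h1, (b.left.rel_iff_mem h0).2 h1, (b.left.rel_iff_mem h0).2 h2⟩
  have hindep : ∀ {y y'}, y + y' ∉ Submodule.span (ZMod 2) {x} →
      y' ∉ Submodule.span (ZMod 2) {x} → y' ∉ Submodule.span (ZMod 2) {x, y} := by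
    intro y y' h1 h2 h3
    rw [mem_span_one] at h1 h2
    push Not at h1 h2
    rcases mem_span_two.1 h3 with h | h | h | h
    · exact h2.1 h
    · exact h2.2 h
    · exact h1.1 (by rw [h, add_self_two])
    · exact h1.2 (by rw [h, add_comm, add_add_cancel_two])
  have hindep' : ∀ {y y'}, y' ∈ Submodule.span (ZMod 2) {x, y} →
      y' ∉ Submodule.span (ZMod 2) {x} → y + y' ∈ Submodule.span (ZMod 2) {x} :=
    fun {y y'} h1 h2 => by_contra fun h3 => hindep h3 h2 h1
  have ker : ∀ {y w η}, T x y η → w ∈ relY p T x y → p w η = 0 := RelData.relY_le_ker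
  refine ⟨C, E, ⟨fun y w => rot.1, ?_, ?_, ?_, fun z y w _ h1 h2 => hC.1 h1 w h2, ?_, ?_, ?_, ?_, ?_,
    ?_, ?_⟩⟩
  · intro z hz
    rw [Submodule.span_singleton_le_iff_mem, hC]
    exact fun w _ => rot.2 (left_mem_relY b.left.rel _ _)
  · intro z hz
    rw [hC]
    exact b.relE_le_relY (hξ z hz)
  · intro z hz y hy
    by_cases hyX : y ∈ Submodule.span (ZMod 2) {x}
    · obtain ⟨h1, h2, h3, h4, h5, h6⟩ := b.left.rel.ne _ _ _ (hξ z hz)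
      refine b.relZ_le_relE h1 h4 h5 ?_
      exact Submodule.span_mono (by simp) hyX
    · obtain ⟨h1, h2, h3, h4, h5, h6⟩ := b.left.rel.ne _ _ _ (hξ y hyX)
      rw [← hEq hz hy hyX]
      exact b.relZ_le_relE h1 h4 h5 (Submodule.subset_span (Set.mem_insert_of_mem _ (hξ y hyX)))
  · intro z w hz hw
    obtain ⟨η, hη, h0, h1⟩ := exists_ne_zero_mem_ker (D := relZ T' (ξ z) x) (by
      rw [cardD hz]
      exact Nat.pow_lt_pow_right (a := 2) (m := 1) (by norm_num) (by have := b.two_le; omega)) (p w)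
    obtain ⟨h2, h3⟩ := hD hz hη h0
    obtain ⟨y, hy, hwy⟩ := b.exists_partner hx h0 h2 h1 (by rwa [h3])
    have h4 := b.left.rel.ne _ _ _ hy
    exact ⟨y, hDC hz hη hy, hX.2 ⟨h4.2.1, h4.2.2.1⟩, hwy⟩
  · intro z w y y' hz hw hy hy' hyX hyX' hwy hwy'
    obtain ⟨η, hη, h1, h2⟩ := hinter hz hy hy' hyX hyX'
    exact hindep' (b.partner_unique (ker h1 hwy) (by rwa [hCE hz hy h1]) h1 h2 hwy hwy') hyX'
  · intro z y hz hy hyX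
    have h1 := hEq hz hy hyX
    refine ⟨?_, h1⟩
    simp only [hCdef, h1]
  · intro z y w w' hz hy hyX hw hw' hwE hwE'
    rw [← hEq hz hy hyX] at hwE hwE' ⊢
    exact b.add_mem_relE (hξ y hyX) hw hw' hwE hwE'
  · intro z y y' w w' hz hy hy' hyX hyX' hyy hw hw' hwE hwE'
    obtain ⟨η, hη, h1, h2⟩ := hinter hz hy hy' hyX hyX'
    rw [← hCE hz hy h1] at hwE hwE'
    exact b.add_mem_relY_add h1 h2 (hindep hyy hyX') hw hw' hwE hwE'
  · intro z hz
    have h1 := hξ z hz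
    obtain ⟨w, hw⟩ := b.left.two.nondeg.flip.exists_one (b.left.rel.ne _ _ _ h1).2.2.2.1
    exact ⟨w, notMem_relY.2 ⟨_, h1, hw⟩⟩
  · intro z c hz hc
    obtain ⟨h1, h2, h3, h4, h5, h6⟩ := b.left.rel.ne _ _ _ (hξ z hz)
    have hZC : ∀ η ∈ relZ T' (ξ z) x, η ≠ 0 → relZ T x η ≤ C z := by
      intro η hη h0 y hy
      rcases (mem_relZ b.left.two b.left.rel).1 hy with rfl | rfl | hy
      · exact zero_mem _
      · rw [hC]
        exact fun w _ => rot.2 (left_mem_relY b.left.rel _ _)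
      · exact hDC hz hη hy
    have hlt : 2 ^ (h + 1) < Nat.card (C z) := by
      by_contra hcon
      push Not at hcon
      have : relZ T' (ξ z) x ≤ relN T x z := by
        intro η hη
        by_cases h0 : η = 0
        · rw [h0]; exact zero_mem _
        have h7 := submodule_eq_of_card (hZC η hη h0) (by
          rwa [b.left.cardZ h1 h0 (hD hz hη h0).1])
        have h8 : z ∈ relZ T x η := by
          rw [h7, hC]
          exact b.relE_le_relY (hξ z hz)
        rw [← b.left.rel_iff_mem h0]
        rcases (mem_relZ b.left.two b.left.rel).1 h8 with h | h | h
        · exact absurd h h2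
        · exact absurd h.symm h3
        · exact h
      have := card_submodule_mono this
      rw [cardD hz, b.left.cardN x z h1 h2 h3, Nat.pow_le_pow_iff_right (by norm_num)] at this
      omega
    have hge : 16 ≤ Nat.card (C z) := by
      obtain ⟨k, hk⟩ := card_submodule_two_pow (C z)
      rw [hk] at hlt ⊢
      exact lt_two_pow_dvd (a := 3) hlt (Nat.pow_le_pow_right (by norm_num)
        (by have := b.two_le; omega))
    have s1 := card_span_insert_le x {c}
    have s0 := card_span_insert_le c ∅
    obtain ⟨a, ha, ha'⟩ := exists_mem_notMem (A := Submodule.span (ZMod 2) {x, c}) (B := C z) (by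
      simp only [insert_empty_eq, Submodule.span_empty, Nat.card_unique] at s0
      omega)
    have s2 := card_span_insert_le a {x, c}
    obtain ⟨e, he, he'⟩ := exists_mem_notMem (A := Submodule.span (ZMod 2) {a, x, c}) (B := C z) (by
      simp only [insert_empty_eq, Submodule.span_empty, Nat.card_unique] at s0
      omega)
    have m1 : Submodule.span (ZMod 2) {x} ≤ Submodule.span (ZMod 2) {x, c} :=
      Submodule.span_mono (by simp)
    have m2 : Submodule.span (ZMod 2) {x} ≤ Submodule.span (ZMod 2) {a, x, c} :=
      Submodule.span_mono (by simp)
    have mc : c ∈ Submodule.span (ZMod 2) {x, c} := Submodule.subset_span (by simp)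
    have mc' : c ∈ Submodule.span (ZMod 2) {a, x, c} := Submodule.subset_span (by simp)
    have ma : a ∈ Submodule.span (ZMod 2) {a, x, c} := Submodule.subset_span (by simp)
    refine ⟨a, ha, e, he, fun h => ha' (m1 h), fun h => he' (m2 h),
      fun h => he' ((SpreadData.mem_trans (m2 h)).1 ma),
      fun h => ha' ((SpreadData.mem_trans (m1 h)).2 mc),
      fun h => he' ((SpreadData.mem_trans (m2 h)).2 mc'), fun h => he' ?_⟩
    have h7 := (SpreadData.mem_trans (m2 h)).2 mc'
    exact (SpreadData.mem_trans h7).1 ma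

theorem not_spreadProp (b : BalancedData Γ p N T T' h) : ¬ SpreadProp p T T' := by
  intro sp
  obtain ⟨x, y, hx, hy, hxy⟩ := b.left.exists_pair
  obtain ⟨C, E, s⟩ := b.spreadData sp hx
  exact s.false (c := y) (by rw [mem_span_one, not_or]; exact ⟨hy, hxy.symm⟩)

theorem eq_two (b : BalancedData Γ p N T T' h) : h = 2 := by
  by_contra hne
  exact b.not_spreadProp fun x z ξ ξ' => b.relE_eq_of_three_le (by have := b.two_le; omega)

end BalancedData

section Quadratic

variable {V : Type*} [AddCommGroup V] [Module (ZMod 2) V]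

theorem sum_mul_linear_eq_zero [Fintype V] (K : Submodule (ZMod 2) V) [DecidablePred (· ∈ K)]
    (hK : 4 < Nat.card K) (f g : V →ₗ[ZMod 2] ZMod 2) :
    ∑ u ∈ Finset.univ.filter (· ∈ K), f u * g u = 0 := by
  obtain ⟨c, hc, hc0, hfc, hgc⟩ : ∃ c ∈ K, c ≠ 0 ∧ f c = 0 ∧ g c = 0 := by
    by_contra! hcon
    have hinj : Function.Injective fun c : K => (f c, g c) := by
      intro a b hab
      simp only [Prod.mk.injEq] at hab
      by_contra hne
      refine hcon (a - b) (sub_mem a.2 b.2) ?_ ?_ ?_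
      · rw [sub_ne_zero]; exact fun h => hne (Subtype.ext h)
      · rw [map_sub, hab.1, sub_self]
      · rw [map_sub, hab.2, sub_self]
    have := Nat.card_le_card_of_injective _ hinj
    rw [Nat.card_prod, Nat.card_zmod] at this
    omega
  refine Finset.sum_involution (fun u _ => u + c) ?_ ?_ ?_ ?_
  · intro u _
    rw [map_add, map_add, hfc, hgc, add_zero, add_zero]
    exact add_self_two _
  · intro u _ _ h
    exact hc0 (by simpa using h)
  · intro u hu
    simp only [Finset.mem_filter, Finset.mem_univ, true_and] at hu ⊢
    exact add_mem hu hc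
  · intro u _
    exact add_add_cancel_two _ _

theorem exists_quadratic [Fintype V] (B : V →ₗ[ZMod 2] V →ₗ[ZMod 2] ZMod 2)
    (hB : ∀ x, B x x = 0) :
    ∃ Q : V → ZMod 2, (∀ x y, Q (x + y) = Q x + Q y + B x y) ∧
      ∀ (K : Submodule (ZMod 2) V) [DecidablePred (· ∈ K)], 4 < Nat.card K →
        ∑ u ∈ Finset.univ.filter (· ∈ K), Q u = 0 := by
  have hsymm : ∀ x y, B x y = B y x := by
    intro x y
    have := hB (x + y)
    simp only [map_add, LinearMap.add_apply, hB, zero_add, add_zero] at this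
    rw [add_comm] at this
    exact (add_eq_zero_two).1 this
  let b := Module.finBasis (ZMod 2) V
  refine ⟨fun u => ∑ i, ∑ j, if i < j then B (b i) (b j) * (b.coord i u * b.coord j u) else 0,
    ?_, ?_⟩
  · intro x y
    have hxy : B x y = ∑ i, ∑ j, b.coord i x * b.coord j y * B (b i) (b j) := by
      conv_lhs => rw [← b.sum_repr x, ← b.sum_repr y]
      simp only [map_sum, LinearMap.sum_apply, map_smul, LinearMap.smul_apply, smul_eq_mul,
        Module.Basis.coord_apply]
      rw [Finset.sum_comm]
      refine Finset.sum_congr rfl fun i _ => ?_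
      rw [Finset.mul_sum]
      exact Finset.sum_congr rfl fun j _ => by ring
    have hsplit : B x y = (∑ i, ∑ j, if i < j then
        b.coord i x * b.coord j y * B (b i) (b j) else 0) + ∑ i, ∑ j, if i < j then
        b.coord j x * b.coord i y * B (b i) (b j) else 0 := by
      rw [Finset.sum_comm (f := fun i j => if i < j then
        b.coord j x * b.coord i y * B (b i) (b j) else 0), hxy, ← Finset.sum_add_distrib]
      refine Finset.sum_congr rfl fun i _ => ?_
      rw [← Finset.sum_add_distrib]
      refine Finset.sum_congr rfl fun j _ => ?_
      rcases lt_trichotomy i j with h | h | h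
      · simp [h, h.not_gt]
      · subst h; simp [hB]
      · simp [h, h.not_gt, hsymm (b j) (b i)]
    rw [hsplit]
    simp only [← Finset.sum_add_distrib]
    refine Finset.sum_congr rfl fun i _ => Finset.sum_congr rfl fun j _ => ?_
    split_ifs
    · rw [map_add, map_add]; ring
    · simp
  · intro K _ hK
    rw [Finset.sum_comm]
    refine Finset.sum_eq_zero fun i _ => ?_
    rw [Finset.sum_comm]
    refine Finset.sum_eq_zero fun j _ => ?_
    split_ifs
    · rw [← Finset.mul_sum, sum_mul_linear_eq_zero K hK, mul_zero]
    · simp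

end Quadratic

namespace RelData

variable {Γ V V' : Type*} [Group Γ] [AddCommGroup V] [Module (ZMod 2) V]
    [AddCommGroup V'] [Module (ZMod 2) V'] [DistribMulAction Γ V] [DistribMulAction Γ V']
    {p : V →ₗ[ZMod 2] V' →ₗ[ZMod 2] ZMod 2} {N : ℕ} {T : V → V → V' → Prop}
    [Finite Γ] [Finite V] [Finite V']

theorem exists_form (d : RelData Γ p N T 1) (e : V) :
    ∃ B : V →ₗ[ZMod 2] V →ₗ[ZMod 2] ZMod 2, (∀ u z, B u z = 0 ↔ z ∈ relY p T e u) ∧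
      ∀ x, B x x = 0 := by
  classical
  have hadd : ∀ x y a b : V, a ∉ relY p T x y → b ∉ relY p T x y → a + b ∈ relY p T x y := by
    intro x y a b ha hb
    obtain ⟨hx, hy, hxy⟩ := ne_of_notMem_relY d.rel ha
    refine add_mem_of_card_le_two_mul le_top ?_ Submodule.mem_top Submodule.mem_top ha hb
    have := d.cardY hx hy hxy
    rw [pow_one] at this
    rw [this, ← d.two.card, Nat.card_congr Submodule.topEquiv.toEquiv]
  have hsymm : ∀ u z, z ∈ relY p T e u ↔ u ∈ relY p T e z :=
    fun u z => mem_relY_rotate d.two d.rel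
  let φ : V → V → ZMod 2 := fun u z => if z ∈ relY p T e u then 0 else 1
  have hφ : ∀ u z z', φ u (z + z') = φ u z + φ u z' := by
    intro u z z'
    by_cases h1 : z ∈ relY p T e u
    · have : z + z' ∈ relY p T e u ↔ z' ∈ relY p T e u := Submodule.add_mem_iff_right _ h1
      simp [φ, h1, this]
    · by_cases h2 : z' ∈ relY p T e u
      · have : z + z' ∈ relY p T e u ↔ z ∈ relY p T e u := Submodule.add_mem_iff_left _ h2
        simp [φ, h1, h2, this]
      · simp only [φ, h1, h2, hadd _ _ _ _ h1 h2, if_true, if_false]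
        decide
  have hφs : ∀ u z, φ u z = φ z u := fun u z => by simp only [φ, hsymm u z]
  have hsm : ∀ (c : ZMod 2) u z, φ u (c • z) = c • φ u z := by
    intro c u z
    rcases zmod_two_cases c with rfl | rfl
    · simp [φ]
    · simp
  refine ⟨LinearMap.mk₂ (ZMod 2) φ (fun u v z => ?_) (fun c u z => ?_) hφ hsm, ?_, ?_⟩
  · rw [hφs, hφ, hφs z, hφs z]
  · rw [hφs, hsm, hφs z]
  · intro u z
    simp [φ]
  · intro x
    simp [φ, right_mem_relY d.rel]

theorem one_not_lt (d : RelData Γ p N T 1) : N ≤ 3 := by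
  classical
  have := Fintype.ofFinite V
  by_contra! hN
  obtain ⟨x₀, y₀, ξ, hT₀⟩ := d.rel.exists_rel
  have hξ := (d.rel.ne _ _ _ hT₀).2.2.2.1
  obtain ⟨e, he⟩ := d.two.nondeg.flip.exists_one hξ
  change p e ξ = 1 at he
  obtain ⟨B, hB, hB0⟩ := d.exists_form e
  obtain ⟨Q, hQ, hK⟩ := exists_quadratic B hB0
  have hQ0 : Q 0 = 0 := by
    have := hQ 0 0
    simpa using this
  let K : Submodule (ZMod 2) V := perpS p.flip {ξ}
  have mK : ∀ u, u ∈ K ↔ p u ξ = 0 := fun u => mem_perpS_one (p := p.flip)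
  have cK : Nat.card K = 2 ^ (N - 1) := by
    have h1 := d.two.nondeg.flip.two_mul_card_perp_one hξ
    rw [← d.two.nondeg.card_eq, d.two.card] at h1
    have : 2 ^ N = 2 * 2 ^ (N - 1) := by rw [← pow_succ']; congr 1; omega
    change 2 * Nat.card K = _ at h1
    omega
  have hK' := hK K (by
    rw [cK]
    exact Nat.pow_lt_pow_right (a := 2) (m := 2) (by norm_num) (by omega))
  have cL : ∀ (A : Submodule (ZMod 2) V),
      ((Finset.univ.filter (· ∈ A)).erase 0).card + 1 = Nat.card A := by
    intro A
    rw [Finset.card_erase_add_one (by simp), ← ncard_eq_card_filter]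
    rfl
  let K₀ : Finset V := (Finset.univ.filter (· ∈ K)).erase 0
  have mK₀ : ∀ u, u ∈ K₀ ↔ u ≠ 0 ∧ p u ξ = 0 := fun u => by simp [K₀, mK]
  have hline : ∀ u ∈ K₀, ∑ v ∈ K₀, (if v ∈ relZ T u ξ then Q v else 0) = 1 := by
    intro u hu
    rw [mK₀] at hu
    have hc := d.cardZ hu.1 hξ hu.2
    obtain ⟨z, hz, hzu⟩ := exists_mem_notMem (A := Submodule.span (ZMod 2) {u})
      (B := relZ T u ξ) (by rw [hc, card_span_one hu.1]; norm_num)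
    have hzu' := hzu
    rw [mem_span_one] at hzu'
    push Not at hzu'
    have hT : T u z ξ := by
      rcases (mem_relZ d.two d.rel).1 hz with h | h | h
      · exact absurd h hzu'.1
      · exact absurd h hzu'.2
      · exact h
    have hB1 : B u z = 1 := by
      rw [← zmod_two_ne_zero, Ne, hB, mem_relY_swap d.two d.rel, mem_relY_rotate d.two d.rel]
      exact notMem_relY.2 ⟨ξ, hT, he⟩
    have hZ : relZ T u ξ = Submodule.span (ZMod 2) {u, z} := by
      refine (submodule_eq_of_card (Submodule.span_le.2 ?_) ?_).symm
      · rintro v (rfl | rfl)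
        · exact (mem_relZ d.two d.rel).2 (Or.inr (Or.inl rfl))
        · exact hz
      · rw [hc, card_span_two hu.1 hzu'.1 (Ne.symm hzu'.2)]
        norm_num
    have hfil : K₀.filter (· ∈ relZ T u ξ) = {u, z, u + z} := by
      ext v
      simp only [Finset.mem_filter, mK₀, hZ, mem_span_two, Finset.mem_insert,
        Finset.mem_singleton]
      have hz0 := d.relZ_le hu.2 hz
      constructor
      · rintro ⟨h1, h2⟩
        tauto
      · rintro (rfl | rfl | rfl)
        · exact ⟨hu, by simp⟩
        · exact ⟨⟨hzu'.1, hz0⟩, by simp⟩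
        · refine ⟨⟨?_, by simp [hu.2, hz0]⟩, by simp⟩
          rw [Ne, add_eq_zero_two]
          exact Ne.symm hzu'.2
    rw [← Finset.sum_filter, hfil, Finset.sum_insert, Finset.sum_pair, hQ, hB1]
    · have h1 := add_self_two (Q u)
      have h2 := add_self_two (Q z)
      linear_combination h1 + h2
    · intro h
      exact hu.1 (by simpa using h.symm)
    · simp only [Finset.mem_insert, Finset.mem_singleton, not_or]
      exact ⟨Ne.symm hzu'.2, fun h => hzu'.1 (by simpa using h.symm)⟩
  have hsum : ∑ u ∈ K₀, ∑ v ∈ K₀, (if v ∈ relZ T u ξ then Q v else 0) = ∑ v ∈ K₀, Q v := by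
    rw [Finset.sum_comm]
    refine Finset.sum_congr rfl fun v hv => ?_
    rw [mK₀] at hv
    have hsw : ∀ a b : V, a ≠ 0 → a ∈ relZ T b ξ → b ∈ relZ T a ξ := by
      intro a b ha h
      rw [mem_relZ d.two d.rel] at h ⊢
      rcases h with h | h | h
      · exact absurd h ha
      · exact Or.inr (Or.inl h.symm)
      · exact Or.inr (Or.inr (d.swap h))
    have hfil : K₀.filter (fun u => v ∈ relZ T u ξ) =
        (Finset.univ.filter (· ∈ relZ T v ξ)).erase 0 := by
      ext u
      simp only [Finset.mem_filter, mK₀, Finset.mem_erase, Finset.mem_univ, true_and]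
      constructor
      · rintro ⟨h1, h2⟩
        exact ⟨h1.1, hsw _ _ hv.1 h2⟩
      · rintro ⟨h1, h2⟩
        exact ⟨⟨h1, d.relZ_le hv.2 h2⟩, hsw _ _ h1 h2⟩
    have h3 := cL (relZ T v ξ)
    rw [d.cardZ hv.1 hξ hv.2, ← hfil] at h3
    rw [← Finset.sum_filter, Finset.sum_const, show Finset.card _ = 3 by omega]
    have h1 := add_self_two (Q v)
    rw [succ_nsmul, two_nsmul, h1, zero_add]
  have hcard : ((K₀.card : ℕ) : ZMod 2) = 1 := by
    have h1 := cL K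
    change K₀.card + 1 = _ at h1
    rw [cK] at h1
    have h2 : 2 ^ (N - 1) = 2 * 2 ^ (N - 2) := by rw [← pow_succ']; congr 1; omega
    rw [h2] at h1
    have h3 := congrArg (Nat.cast : ℕ → ZMod 2) h1
    push_cast at h3
    rw [show (2 : ZMod 2) = 0 from rfl, zero_mul] at h3
    exact (add_eq_zero_two).1 h3
  rw [Finset.sum_congr rfl hline, Finset.sum_const, nsmul_one, hcard] at hsum
  rw [← Finset.add_sum_erase _ _ (show (0 : V) ∈ Finset.univ.filter (· ∈ K) by simp), hQ0,
    zero_add] at hK'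
  rw [hK'] at hsum
  exact one_ne_zero hsum

end RelData

theorem le_of_indep_mem {V : Type*} [AddCommGroup V] [Module (ZMod 2) V] [Finite V]
    {A P : Submodule (ZMod 2) V} (hP : Nat.card P ≤ 8) {x y z : V} (hx : x ≠ 0) (hy : y ≠ 0)
    (hxy : x ≠ y) (hz : z ∉ Submodule.span (ZMod 2) {x, y}) (hxP : x ∈ P) (hyP : y ∈ P)
    (hzP : z ∈ P) (hxA : x ∈ A) (hyA : y ∈ A) (hzA : z ∈ A) : P ≤ A := by
  have h1 : Submodule.span (ZMod 2) {x, y} ≤ P ⊓ A := by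
    refine Submodule.span_le.2 ?_
    rintro v (rfl | rfl)
    · exact ⟨hxP, hxA⟩
    · exact ⟨hyP, hyA⟩
  have h2 : Nat.card (Submodule.span (ZMod 2) {x, y}) <
      Nat.card (P ⊓ A : Submodule (ZMod 2) V) := by
    by_contra! hcon
    exact hz ((submodule_eq_of_card h1 hcon) ▸ ⟨hzP, hzA⟩)
  rw [card_span_two hx hy hxy] at h2
  obtain ⟨k, hk⟩ := card_submodule_two_pow (P ⊓ A)
  have h3 : 2 < k := by
    rw [hk, show 4 = 2 ^ 2 by rfl] at h2
    exact (Nat.pow_lt_pow_iff_right (by norm_num)).1 h2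
  have h4 : 2 ^ 3 ≤ 2 ^ k := Nat.pow_le_pow_right (by norm_num) h3
  have h5 := submodule_eq_of_card (inf_le_left : P ⊓ A ≤ P) (by rw [hk]; omega)
  exact h5 ▸ inf_le_right

namespace BalancedData

variable {Γ V V' : Type*} [Group Γ] [AddCommGroup V] [Module (ZMod 2) V]
    [AddCommGroup V'] [Module (ZMod 2) V'] [DistribMulAction Γ V] [DistribMulAction Γ V']
    {p : V →ₗ[ZMod 2] V' →ₗ[ZMod 2] ZMod 2} {N : ℕ} {T : V → V → V' → Prop}
    [Finite Γ] [Finite V] [Finite V'] {T' : V' → V' → V → Prop}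

theorem exists_third (b : BalancedData Γ p N T T' 2) {x z : V} {ξ : V'} (hT : T x z ξ) :
    ∃ y, T x y ξ ∧ y ∉ Submodule.span (ZMod 2) {x, z} := by
  obtain ⟨hx, hz, hxz, hξ, hxξ, hzξ⟩ := b.left.rel.ne _ _ _ hT
  obtain ⟨y, hy, hyz⟩ := exists_mem_notMem (A := Submodule.span (ZMod 2) {x, z})
    (B := relZ T x ξ) (by
      rw [card_span_two hx hz hxz, b.left.cardZ hx hξ hxξ]
      norm_num)
  have h2 := hyz
  rw [mem_span_two] at h2
  push Not at h2
  rcases (mem_relZ b.left.two b.left.rel).1 hy with h | h | h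
  · exact absurd h h2.1
  · exact absurd h h2.2.1
  · exact ⟨y, h, hyz⟩

theorem mem_relZ_comm (b : BalancedData Γ p N T T' 2) {x y : V} {ξ : V'} (hy : y ≠ 0)
    (h : y ∈ relZ T x ξ) : x ∈ relZ T y ξ := by
  rw [mem_relZ b.left.two b.left.rel] at h ⊢
  rcases h with h | h | h
  · exact absurd h hy
  · exact Or.inr (Or.inl h.symm)
  · exact Or.inr (Or.inr (b.left.swap h))

theorem rel_of_mem_relZ (b : BalancedData Γ p N T T' 2) {x y : V} {ξ : V'} (hy : y ≠ 0)
    (hxy : x ≠ y) (h : y ∈ relZ T x ξ) : T x y ξ := by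
  rcases (mem_relZ b.left.two b.left.rel).1 h with h | h | h
  · exact absurd h hy
  · exact absurd h.symm hxy
  · exact h

/-- The planes through a pair attached to its first vector are those attached to the second. -/
theorem exists_relZ_eq (b : BalancedData Γ p N T T' 2) {x z : V} {ξ : V'} (hT : T x z ξ) :
    ∃ ξ', T x z ξ' ∧ relZ T z ξ' = relZ T x ξ := by
  obtain ⟨hx, hz, hxz, hξ, hxξ, hzξ⟩ := b.left.rel.ne _ _ _ hT
  obtain ⟨y, hTy, hy⟩ := b.exists_third hT
  obtain ⟨-, hy0, hxy, -, -, hyξ⟩ := b.left.rel.ne _ _ _ hTy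
  have h1 : z ∉ Submodule.span (ZMod 2) {x, y} := notMem_span_exchange hz hxz hy
  obtain ⟨g, hg1, hg2, hg3⟩ := b.left.two.translation hx hy0 hxy h1
    (Submodule.subset_span (by simp) : x ∈ _)
  have h2 : x ∉ Submodule.span (ZMod 2) {z + x, y} := by
    rw [mem_span_two] at h1 ⊢
    push Not at h1 ⊢
    obtain ⟨h11, h12, h13, h14⟩ := h1
    refine ⟨hx, fun h => h11 (by simpa using h.symm), hxy, fun h => ?_⟩
    have h5 : z = y := by
      rw [← add_eq_zero_two]
      have : x + (z + x + y) = 0 := (add_eq_zero_two).2 h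
      rw [show x + (z + x + y) = (x + x) + (z + y) by abel, add_self_two, zero_add] at this
      exact this
    exact h13 h5
  have h3 : z + x ≠ 0 := by rw [Ne, add_eq_zero_two]; exact Ne.symm hxz
  have h4 : z + x ≠ y := by
    rintro h
    rw [mem_span_two] at hy
    push Not at hy
    exact hy.2.2.2 (by rw [← h, add_comm])
  obtain ⟨k, hk1, hk2, hk3⟩ := b.left.two.translation h3 hy0 h4 h2
    (Submodule.subset_span (by simp) : z + x ∈ _)
  have hx' : (k * g) • x = z := by
    rw [mul_smul, hg1, hk3, add_comm z x, add_add_cancel_left_two]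
  have hz' : (k * g) • z = z + x := by rw [mul_smul, hg3, hk1]
  have hy' : (k * g) • y = y := by rw [mul_smul, hg2, hk2]
  have m1 := b.left.rel.smul (k * g) _ _ _ hT
  have m2 := b.left.rel.smul (k * g) _ _ _ hTy
  rw [hx', hz'] at m1
  rw [hx', hy'] at m2
  have m3 : z ∈ relZ T z ((k * g) • ξ) :=
    (mem_relZ b.left.two b.left.rel).2 (Or.inr (Or.inl rfl))
  have m4 : x ∈ relZ T z ((k * g) • ξ) := by
    have := add_mem m3 ((mem_relZ b.left.two b.left.rel).2 (Or.inr (Or.inr m1)))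
    rwa [add_add_cancel_left_two] at this
  have hzξ' : p z ((k * g) • ξ) = 0 := by
    rw [← hx', b.left.two.inv]; exact hxξ
  refine ⟨(k * g) • ξ, b.left.swap (b.rel_of_mem_relZ hx (Ne.symm hxz) m4), ?_⟩
  have hξ' : (k * g) • ξ ≠ 0 := (smul_ne_zero_iff_ne _).2 hξ
  refine (submodule_eq_of_card (le_of_indep_mem ?_ hx hz hxz hy
    ((mem_relZ b.left.two b.left.rel).2 (Or.inr (Or.inl rfl)))
    ((mem_relZ b.left.two b.left.rel).2 (Or.inr (Or.inr hT)))
    ((mem_relZ b.left.two b.left.rel).2 (Or.inr (Or.inr hTy))) m4 m3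
    ((mem_relZ b.left.two b.left.rel).2 (Or.inr (Or.inr m2)))) ?_).symm
  · rw [b.left.cardZ hx hξ hxξ]
    norm_num
  · rw [b.left.cardZ hx hξ hxξ, b.left.cardZ hz hξ' hzξ']

theorem eq_of_relZ_eq (b : BalancedData Γ p N T T' 2) {x z : V} {ξ ξ' : V'} (hT : T x z ξ)
    (hT' : T x z ξ') (h : relZ T x ξ = relZ T x ξ') : ξ = ξ' := by
  by_contra hne
  obtain ⟨hx, hz, hxz, hξ, hxξ, hzξ⟩ := b.left.rel.ne _ _ _ hT
  have hξ' := (b.left.rel.ne _ _ _ hT').2.2.2.1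
  obtain ⟨y, hTy, hy⟩ := b.exists_third hT
  obtain ⟨-, hy0, hxy, -, -, hyξ⟩ := b.left.rel.ne _ _ _ hTy
  have hTy' : T x y ξ' := by
    refine b.rel_of_mem_relZ hy0 hxy (h ▸ ?_)
    exact (mem_relZ b.left.two b.left.rel).2 (Or.inr (Or.inr hTy))
  have key : ∀ u, u ≠ 0 → x ≠ u → T x u ξ → T x u ξ' →
      Submodule.span (ZMod 2) {ξ, ξ'} = relN T x u := by
    intro u hu hxu h1 h2
    refine submodule_eq_of_card (Submodule.span_le.2 ?_) ?_
    · rintro v (rfl | rfl)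
      · exact (mem_relN b.left.two b.left.rel).2 (Or.inr h1)
      · exact (mem_relN b.left.two b.left.rel).2 (Or.inr h2)
    · rw [b.left.cardN x u hx hu hxu, card_span_two hξ hξ' hne]
      norm_num
  have hN := (key z hz hxz hT hT').symm.trans (key y hy0 hxy hTy hTy')
  have h1 := b.relY_inf_relY hT hTy hy
  have h2 : relY p T x z ≤ relY p T x y := by
    intro w hw η hη
    have : η ∈ relN T x z := hN ▸ (mem_relN b.left.two b.left.rel).2 (Or.inr hη)
    rcases (mem_relN b.left.two b.left.rel).1 this with rfl | h
    · simp
    · exact hw η h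
  rw [inf_eq_left.2 h2] at h1
  have h3 := b.card_relE hx hξ hxξ
  rw [← h1, (b.left.cardY_sub hx hz hxz).2] at h3
  have h4 := Nat.pow_right_injective (le_refl 2) h3
  have := b.lt
  omega

theorem relZ_eq_of_fixed (b : BalancedData Γ p N T T' 2) {x z : V} {ξ η : V'} {g : Γ}
    (hT : T x z ξ) (hgx : g • x = x) (hgz : g • z = z) (hgξ : g • ξ = ξ) (hη : η ∈ relN T x z)
    (hgη : g • η ≠ η) : relZ T z ξ = relZ T x ξ := by
  obtain ⟨hx, hz, hxz, hξ, hxξ, hzξ⟩ := b.left.rel.ne _ _ _ hT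
  obtain ⟨ξ', hT', hZ⟩ := b.exists_relZ_eq hT
  have h1 : g • ξ' = ξ' := by
    refine b.eq_of_relZ_eq (x := z) (z := x) ?_ (b.left.swap hT') ?_
    · have := b.left.rel.smul g _ _ _ (b.left.swap hT')
      rwa [hgx, hgz] at this
    · rw [hZ]
      have h2 : ∀ v, v ∈ relZ T z (g • ξ') ↔ g⁻¹ • v ∈ relZ T z ξ' := by
        intro v
        conv_rhs => rw [← b.left.smul_mem_relZ g, smul_inv_smul, hgz]
      have h3 : ∀ v, v ∈ relZ T x ξ ↔ g⁻¹ • v ∈ relZ T x ξ := by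
        intro v
        conv_rhs => rw [← b.left.smul_mem_relZ g, smul_inv_smul, hgx, hgξ]
      ext v
      rw [h2, hZ, ← h3]
  have h2 : ξ' = ξ := by
    by_contra hne
    have hξ' := (b.left.rel.ne _ _ _ hT').2.2.2.1
    have h3 : Submodule.span (ZMod 2) {ξ, ξ'} = relN T x z := by
      refine submodule_eq_of_card (Submodule.span_le.2 ?_) ?_
      · rintro v (rfl | rfl)
        · exact (mem_relN b.left.two b.left.rel).2 (Or.inr hT)
        · exact (mem_relN b.left.two b.left.rel).2 (Or.inr hT')
      · rw [b.left.cardN x z hx hz hxz, card_span_two hξ hξ' (Ne.symm hne)]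
        norm_num
    rw [← h3, mem_span_two] at hη
    rcases hη with rfl | rfl | rfl | rfl
    · exact hgη (smul_zero _)
    · exact hgη hgξ
    · exact hgη h1
    · exact hgη (by rw [smul_add, hgξ, h1])
  rw [← h2, hZ, h2]

theorem relZ_eq_of_relZ_eq (b : BalancedData Γ p N T T' 2) {x₀ z₀ : V} {ξ₀ : V'}
    (hT₀ : T x₀ z₀ ξ₀) (hZ₀ : relZ T z₀ ξ₀ = relZ T x₀ ξ₀) {x c : V} {ξ : V'}
    (hT : T x c ξ) : relZ T c ξ = relZ T x ξ := by
  have key : ∀ z, T x z ξ → relZ T z ξ = relZ T x ξ ∨ relZ T (z + x) ξ = relZ T x ξ := by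
    intro z hz
    obtain ⟨g, hg1, hg2, hg3⟩ := b.left.rel.conj _ _ _ _ _ _ hT₀ hz
    have h1 : relZ T (g • z₀) ξ = relZ T x ξ := by
      ext v
      have h2 := b.left.smul_mem_relZ g (x := z₀) (y := g⁻¹ • v) (ξ := ξ₀)
      have h3 := b.left.smul_mem_relZ g (x := x₀) (y := g⁻¹ • v) (ξ := ξ₀)
      rw [smul_inv_smul, hg3] at h2 h3
      rw [hg1] at h3
      rw [h2, h3, hZ₀]
    rcases hg2 with h | h
    · exact Or.inl (h ▸ h1)
    · exact Or.inr (h ▸ h1)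
  obtain ⟨hx, hc, hxc, hξ, hxξ, hcξ⟩ := b.left.rel.ne _ _ _ hT
  have hcZ : c ∈ relZ T x ξ := (mem_relZ b.left.two b.left.rel).2 (Or.inr (Or.inr hT))
  have hxc' : x ∈ relZ T c ξ := b.mem_relZ_comm hc hcZ
  refine (submodule_eq_of_card ?_ ?_).symm
  · intro z hz
    rcases (mem_relZ b.left.two b.left.rel).1 hz with rfl | rfl | hz
    · exact zero_mem _
    · exact hxc'
    · rcases key z hz with h | h
      · exact b.mem_relZ_comm hc (h ▸ hcZ)
      · have := add_mem (b.mem_relZ_comm hc (h ▸ hcZ)) hxc'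
        rwa [add_add_cancel_two] at this
  · rw [b.left.cardZ hx hξ hxξ, b.left.cardZ hc hξ hcξ]

theorem smul_eq_of_mem_relN (b : BalancedData Γ p N T T' 2) {x z : V} {ξ η : V'} {g : Γ}
    (hT : T x z ξ) (hgx : g • x = x) (hgz : g • z = z) (hgξ : g • ξ = ξ)
    (hη : η ∈ relN T x z) : g • η = η := by
  by_contra hgη
  have h1 := b.relZ_eq_of_fixed hT hgx hgz hgξ hη hgη
  refine b.flip.not_spreadProp ?_
  intro ξ η' x x' hTx hTx'
  have h2 : x' ∈ relZ T x ξ := b.flip.relN_le_relZ hTx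
    ((mem_relN b.right.two b.right.rel).2 (Or.inr hTx'))
  obtain ⟨-, -, -, hx, -, -⟩ := b.right.rel.ne _ _ _ hTx
  obtain ⟨-, -, -, hx', -, -⟩ := b.right.rel.ne _ _ _ hTx'
  by_cases h3 : x = x'
  · rw [h3]
  · rw [relE, relE, b.relZ_eq_of_relZ_eq hT h1 (b.rel_of_mem_relZ hx' h3 h2)]

end BalancedData

section Main

variable {Γ V V' : Type*} [Group Γ] [AddCommGroup V] [Module (ZMod 2) V]
    [AddCommGroup V'] [Module (ZMod 2) V'] [DistribMulAction Γ V] [DistribMulAction Γ V']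
    {p : V →ₗ[ZMod 2] V' →ₗ[ZMod 2] ZMod 2} {N : ℕ}
    [Finite Γ] [Finite V] [Finite V']

theorem TwoTrans.tripleTrans_or_balanced (t : TwoTrans Γ p N) :
    TripleTrans Γ V ∨ ∃ T T', BalancedData Γ p N T T' 2 := by
  obtain ⟨T, h, d⟩ := t.exists_relData
  obtain ⟨T', h', d'⟩ := t.flip.exists_relData
  rcases d.le.eq_or_lt with hN | hN
  · exact Or.inl (d.tripleTrans hN)
  right
  have h1 := d.add_le d' hN
  have hp := d.pos
  have hp' := d'.pos
  have hh : h ≠ 1 := by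
    rintro rfl
    have := d.one_not_lt
    omega
  have hh' : h' ≠ 1 := by
    rintro rfl
    have := d'.one_not_lt
    omega
  have hx : h = h' := by
    obtain ⟨x, y, ξ, hT⟩ := d.rel.exists_rel
    obtain ⟨hx, -, -, hξ, hxξ, -⟩ := d.rel.ne _ _ _ hT
    rcases le_total h h' with hle | hle
    · exact (d.eq_and_inf d' hN (by omega) hle hx hξ hxξ).1
    · exact (d'.eq_and_inf (T' := T) d (by omega) (by omega) hle hξ hx hxξ).1.symm
  subst hx
  have b : BalancedData Γ p N T T' h := ⟨d, d', hN, by omega⟩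
  obtain rfl := b.eq_two
  exact ⟨T, T', b⟩

end Main

section Contragredient

variable (Γ M : Type*) [Group Γ] [AddCommGroup M] [Module (ZMod 2) M] [DistribMulAction Γ M]

/-- The dual module, carrying the contragredient action of `Γ`. -/
def Contragredient (_Γ M : Type*) [AddCommGroup M] [Module (ZMod 2) M] : Type _ :=
  Module.Dual (ZMod 2) M

instance : AddCommGroup (Contragredient Γ M) := inferInstanceAs (AddCommGroup (Module.Dual _ M))

instance : Module (ZMod 2) (Contragredient Γ M) :=
  inferInstanceAs (Module (ZMod 2) (Module.Dual _ M))

instance [Finite M] : Finite (Contragredient Γ M) :=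
  Finite.of_injective (fun (f : Module.Dual (ZMod 2) M) (x : M) => f x)
    fun _ _ h => LinearMap.ext fun x => congrFun h x

/-- The evaluation pairing between a module and its contragredient. -/
def evalPairing : M →ₗ[ZMod 2] Contragredient Γ M →ₗ[ZMod 2] ZMod 2 :=
  Module.Dual.eval (ZMod 2) M

variable {Γ M} in
/-- The linear map given by a group element. -/
def smulLinear (g : Γ) : M →ₗ[ZMod 2] M :=
  (DistribSMul.toAddMonoidHom M g).toZModLinearMap 2

instance : DistribMulAction Γ (Contragredient Γ M) where
  smul g ξ := (ξ : Module.Dual (ZMod 2) M) ∘ₗ smulLinear g⁻¹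
  one_smul ξ := LinearMap.ext fun x => by
    change evalPairing Γ M ((1 : Γ)⁻¹ • x) ξ = evalPairing Γ M x ξ
    rw [inv_one, one_smul]
  mul_smul g h ξ := LinearMap.ext fun x => by
    change evalPairing Γ M ((g * h)⁻¹ • x) ξ =
      evalPairing Γ M (h⁻¹ • g⁻¹ • x) ξ
    rw [mul_inv_rev, mul_smul]
  smul_zero g := LinearMap.ext fun x => rfl
  smul_add g ξ η := LinearMap.ext fun x => rfl

theorem evalPairing_nondeg : Nondeg (evalPairing Γ M) where
  left x hx := (Module.forall_dual_apply_eq_zero_iff (ZMod 2) x).1 hx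
  right _ hξ := LinearMap.ext hξ

theorem evalPairing_smul (g : Γ) (x : M) (ξ : Contragredient Γ M) :
    evalPairing Γ M (g • x) (g • ξ) = evalPairing Γ M x ξ := by
  change evalPairing Γ M (g⁻¹ • g • x) ξ = _
  rw [inv_smul_smul]

theorem evalPairing_smul_eq_iff (g : Γ) (ξ η : Contragredient Γ M) :
    g • ξ = η ↔ ∀ x, evalPairing Γ M (g • x) η = evalPairing Γ M x ξ := by
  constructor
  · rintro rfl x
    exact evalPairing_smul Γ M g x ξ
  · intro h
    refine LinearMap.ext fun x => ?_
    have := h (g⁻¹ • x)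
    rw [smul_inv_smul] at this
    exact this.symm

end Contragredient

section Quotient

variable {G V : Type*} [Group G] [AddCommGroup V] [Module (ZMod 2) V] [DistribMulAction G V]

/-- The action of the pointwise stabilizer of a submodule on the quotient. -/
instance quotientAction (F : Submodule (ZMod 2) V) :
    DistribMulAction (fixingSubgroup G (F : Set V)) (V ⧸ F) where
  smul g := F.mapQ F (smulLinear (g : G)) fun x hx => by
    have h1 : (g : G) • x = x := (mem_fixingSubgroup_iff G).1 g.2 x hx
    change (g : G) • x ∈ F
    rwa [h1]
  one_smul x := by
    induction x using Submodule.Quotient.induction_on with | _ x => ?_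
    exact congrArg (Submodule.Quotient.mk (p := F)) (one_smul G x)
  mul_smul g h x := by
    induction x using Submodule.Quotient.induction_on with | _ x => ?_
    exact congrArg (Submodule.Quotient.mk (p := F)) (mul_smul (g : G) (h : G) x)
  smul_zero g := map_zero _
  smul_add g := map_add _

theorem smul_mk (F : Submodule (ZMod 2) V) (g : fixingSubgroup G (F : Set V)) (x : V) :
    g • (Submodule.Quotient.mk x : V ⧸ F) = Submodule.Quotient.mk ((g : G) • x) := rfl

theorem mk_eq_mk {F : Submodule (ZMod 2) V} {x y : V} :
    (Submodule.Quotient.mk x : V ⧸ F) = Submodule.Quotient.mk y ↔ x + y ∈ F := by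
  rw [Submodule.Quotient.eq, sub_two]

theorem mk_mem_span_two {F : Submodule (ZMod 2) V} {u v w : V} :
    (Submodule.Quotient.mk w : V ⧸ F) ∈ Submodule.span (ZMod 2)
      {Submodule.Quotient.mk u, Submodule.Quotient.mk v} ↔
      w ∈ F ∨ w + u ∈ F ∨ w + v ∈ F ∨ w + (u + v) ∈ F := by
  rw [mem_span_two, ← Submodule.Quotient.mk_add, mk_eq_mk, mk_eq_mk, mk_eq_mk,
    Submodule.Quotient.mk_eq_zero]

instance [Finite V] (F : Submodule (ZMod 2) V) : Finite (V ⧸ F) :=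
  Finite.of_surjective _ F.mkQ_surjective

theorem card_quotient_mul [Finite V] (F : Submodule (ZMod 2) V) :
    Nat.card (V ⧸ F) * Nat.card F = Nat.card V := by
  rw [mul_comm]
  exact (Submodule.card_eq_card_quotient_mul_card F).symm

/-- The pointwise stabilizer of `F` is transitive on independent pairs modulo `F`. -/
def PairTransMod (G : Type*) [Group G] [DistribMulAction G V] (F : Submodule (ZMod 2) V) : Prop :=
  ∀ u v u' v' : V, u ∉ F → v ∉ F → u + v ∉ F → u' ∉ F → v' ∉ F → u' + v' ∉ F →
    ∃ g : G, (∀ x ∈ F, g • x = x) ∧ g • u + u' ∈ F ∧ g • v + v' ∈ F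

/-- The pointwise stabilizer of `F` in the stabilizer of a functional vanishing on `F` is
transitive on the vectors off the kernel of the functional. -/
def AntiflagTransMod (G : Type*) [Group G] [DistribMulAction G V] (F : Submodule (ZMod 2) V) :
    Prop :=
  ∀ ξ : Module.Dual (ZMod 2) V, (∀ x ∈ F, ξ x = 0) → ∀ y y', ξ y = 1 → ξ y' = 1 →
    ∃ g : G, (∀ x ∈ F, g • x = x) ∧ (∀ x, ξ (g • x) = ξ x) ∧ g • y = y'

variable [Finite G] [Finite V]

theorem PairTransMod.twoTrans {F : Submodule (ZMod 2) V} (hF : PairTransMod G F) {N : ℕ}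
    (hN : 3 ≤ N) (hc : Nat.card (V ⧸ F) = 2 ^ N) :
    TwoTrans (fixingSubgroup G (F : Set V)) (evalPairing (fixingSubgroup G (F : Set V)) (V ⧸ F))
      N := by
  refine TwoTrans.of_pair (evalPairing_nondeg _ _) (evalPairing_smul _ _) hc hN ?_
  intro x y x' y'
  induction x using Submodule.Quotient.induction_on with | _ x => ?_
  induction y using Submodule.Quotient.induction_on with | _ y => ?_
  induction x' using Submodule.Quotient.induction_on with | _ x' => ?_
  induction y' using Submodule.Quotient.induction_on with | _ y' => ?_
  simp only [Ne, Submodule.Quotient.mk_eq_zero, mk_eq_mk]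
  intro hx hy hxy hx' hy' hxy'
  obtain ⟨g, h1, h2, h3⟩ := hF x y x' y' hx hy hxy hx' hy' hxy'
  refine ⟨⟨g, (mem_fixingSubgroup_iff G).2 h1⟩, ?_, ?_⟩
  · rw [smul_mk, mk_eq_mk]; exact h2
  · rw [smul_mk, mk_eq_mk]; exact h3

/-- A functional vanishing on `F`, viewed in the contragredient of the quotient. -/
def quotDual (G : Type*) [Group G] [DistribMulAction G V] {F : Submodule (ZMod 2) V}
    {ξ : Module.Dual (ZMod 2) V} (h : ∀ x ∈ F, ξ x = 0) :
    Contragredient (fixingSubgroup G (F : Set V)) (V ⧸ F) :=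
  F.liftQ ξ h

theorem evalPairing_quotDual {F : Submodule (ZMod 2) V} {ξ : Module.Dual (ZMod 2) V}
    (h : ∀ x ∈ F, ξ x = 0) (x : V) :
    evalPairing _ _ (Submodule.Quotient.mk x : V ⧸ F) (quotDual G h) = ξ x := rfl

theorem quotDual_ne_zero {F : Submodule (ZMod 2) V} {ξ : Module.Dual (ZMod 2) V}
    (h : ∀ x ∈ F, ξ x = 0) {y : V} (hy : ξ y = 1) : quotDual G h ≠ 0 := by
  intro hc
  have := evalPairing_quotDual (G := G) h y
  rw [hc, map_zero, hy] at this
  exact zero_ne_one this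

theorem smul_quotDual_iff {F : Submodule (ZMod 2) V} {ξ ξ' : Module.Dual (ZMod 2) V}
    (h : ∀ x ∈ F, ξ x = 0) (h' : ∀ x ∈ F, ξ' x = 0) (g : fixingSubgroup G (F : Set V)) :
    g • quotDual G h = quotDual G h' ↔ ∀ x, ξ' ((g : G) • x) = ξ x := by
  rw [evalPairing_smul_eq_iff]
  constructor
  · intro H x
    exact H (Submodule.Quotient.mk x)
  · intro H x
    induction x using Submodule.Quotient.induction_on with | _ x => ?_
    exact H x

theorem PairTransMod.flag {F : Submodule (ZMod 2) V} (hF : PairTransMod G F) {N : ℕ}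
    (hN : 3 ≤ N) (hc : Nat.card (V ⧸ F) = 2 ^ N) {ξ ξ' : Module.Dual (ZMod 2) V}
    (hξF : ∀ x ∈ F, ξ x = 0) (hξF' : ∀ x ∈ F, ξ' x = 0) {y y' : V} (hy : ξ y = 1) (hy' : ξ' y' = 1)
    {v v' : V} (hv : v ∉ F) (hv' : v' ∉ F) (hvv : ξ v = ξ' v') :
    ∃ g : G, (∀ x ∈ F, g • x = x) ∧ (∀ x, ξ' (g • x) = ξ x) ∧ g • v + v' ∈ F := by
  obtain ⟨g, h1, h2⟩ := (hF.twoTrans hN hc).flag (Submodule.Quotient.mk v)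
    (Submodule.Quotient.mk v') (quotDual G hξF) (quotDual G hξF')
    (by rwa [Ne, Submodule.Quotient.mk_eq_zero]) (by rwa [Ne, Submodule.Quotient.mk_eq_zero])
    (quotDual_ne_zero _ hy) (quotDual_ne_zero _ hy') hvv
  exact ⟨g, (mem_fixingSubgroup_iff G).1 g.2, (smul_quotDual_iff hξF hξF' g).1 h2,
    mk_eq_mk.1 (by rw [← smul_mk, h1])⟩

theorem antiflagTransMod_bot (hF : PairTransMod G (⊥ : Submodule (ZMod 2) V)) {N : ℕ}
    (hN : 3 ≤ N) (hc : Nat.card V = 2 ^ N) : AntiflagTransMod G (⊥ : Submodule (ZMod 2) V) := by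
  intro ξ hξ y y' hy hy'
  have hne : ∀ y, ξ y = 1 → y ∉ (⊥ : Submodule (ZMod 2) V) := by
    rintro y hy h
    rw [(Submodule.mem_bot _).1 h, map_zero] at hy
    exact zero_ne_one hy
  have hcard := card_quotient_mul (⊥ : Submodule (ZMod 2) V)
  rw [Nat.card_unique (α := (⊥ : Submodule (ZMod 2) V)), mul_one, hc] at hcard
  obtain ⟨g, h1, h2, h3⟩ := hF.flag hN hcard hξ hξ hy hy'
    (hne y hy) (hne y' hy') (hy.trans hy'.symm)
  exact ⟨g, h1, h2, (add_eq_zero_two).1 ((Submodule.mem_bot _).1 h3)⟩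

end Quotient

section Subspaces

variable {V : Type*} [AddCommGroup V] [Module (ZMod 2) V]

theorem exists_dual_eq_one {F : Submodule (ZMod 2) V} {v : V} (hv : v ∉ F) :
    ∃ ξ : Module.Dual (ZMod 2) V, (∀ x ∈ F, ξ x = 0) ∧ ξ v = 1 := by
  obtain ⟨ξ, h1, h2⟩ := Submodule.exists_dual_map_eq_bot_of_notMem hv inferInstance
  refine ⟨ξ, fun x hx => ?_, zmod_two_ne_zero.1 h1⟩
  have : ξ x ∈ F.map ξ := Submodule.mem_map_of_mem hx
  rwa [h2, Submodule.mem_bot] at this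

theorem exists_dual_eq_one_two {F : Submodule (ZMod 2) V} {v w : V} (hv : v ∉ F) (hw : w ∉ F) :
    ∃ ξ : Module.Dual (ZMod 2) V, (∀ x ∈ F, ξ x = 0) ∧ ξ v = 1 ∧ ξ w = 1 := by
  obtain ⟨ξ, h1, h2⟩ := exists_dual_eq_one hv
  obtain ⟨η, h3, h4⟩ := exists_dual_eq_one hw
  obtain ⟨ζ, h5, h6, h7⟩ := LinearMap.exists_common_one (f := Module.Dual.eval (ZMod 2) V v)
    (g := Module.Dual.eval (ZMod 2) V w) (a := ξ) (b := η) h2 h4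
  refine ⟨ζ, fun x hx => ?_, h6, h7⟩
  rcases h5 with rfl | rfl | rfl
  · exact h1 x hx
  · exact h3 x hx
  · rw [LinearMap.add_apply, h1 x hx, h3 x hx, add_zero]

theorem mem_sup_span_one {F : Submodule (ZMod 2) V} {v x : V} :
    x ∈ F ⊔ Submodule.span (ZMod 2) {v} ↔ x ∈ F ∨ x + v ∈ F := by
  simp only [Submodule.mem_sup, mem_span_one]
  constructor
  · rintro ⟨y, hy, z, rfl | rfl, rfl⟩
    · left; simpa using hy
    · right; rwa [add_add_cancel_two]
  · rintro (h | h)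
    · exact ⟨x, h, 0, Or.inl rfl, add_zero x⟩
    · exact ⟨_, h, v, Or.inr rfl, add_add_cancel_two _ _⟩

variable [Finite V]

theorem card_sup_span_one {F : Submodule (ZMod 2) V} {v : V} (hv : v ∉ F) :
    Nat.card (F ⊔ Submodule.span (ZMod 2) {v} : Submodule (ZMod 2) V) = 2 * Nat.card F := by
  have h1 : ((F ⊔ Submodule.span (ZMod 2) {v} : Submodule (ZMod 2) V) : Set V) =
      (F : Set V) ∪ (· + v) '' (F : Set V) := by
    ext x
    simp only [SetLike.mem_coe, mem_sup_span_one, Set.mem_union, Set.mem_image]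
    refine or_congr_right ⟨fun h => ⟨_, h, add_add_cancel_two _ _⟩, ?_⟩
    rintro ⟨y, hy, rfl⟩
    rwa [add_add_cancel_two]
  rw [← ncard_submodule, h1, Set.ncard_union_eq _ (Set.toFinite _) (Set.toFinite _),
    Set.ncard_image_of_injective _ (add_left_injective v), ncard_submodule, two_mul]
  rw [Set.disjoint_left]
  rintro _ h ⟨y, hy, rfl⟩
  exact hv (by simpa only [add_add_cancel_left_two] using F.add_mem hy h)

theorem exists_submodule_card {A B : Submodule (ZMod 2) V} (hAB : A ≤ B) {j : ℕ}
    (hA : Nat.card A ≤ 2 ^ j) (hB : 2 ^ j ≤ Nat.card B) :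
    ∃ C, A ≤ C ∧ C ≤ B ∧ Nat.card C = 2 ^ j := by
  obtain ⟨a, ha⟩ := card_submodule_two_pow A
  have haj : a ≤ j := by rw [ha] at hA; exact (Nat.pow_le_pow_iff_right one_lt_two).1 hA
  induction h : j - a generalizing a A with
  | zero => exact ⟨A, le_rfl, hAB, by rw [ha]; congr 1; omega⟩
  | succ k ih =>
    obtain ⟨b, hb, hb'⟩ := exists_mem_notMem (A := A) (B := B)
      (lt_of_lt_of_le (by rw [ha]; exact Nat.pow_lt_pow_right one_lt_two (by omega)) hB)
    have hc : Nat.card (A ⊔ Submodule.span (ZMod 2) {b} : Submodule (ZMod 2) V) = 2 ^ (a + 1) := by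
      rw [card_sup_span_one hb', ha, pow_succ']
    obtain ⟨C, h1, h2, h3⟩ := ih (A := A ⊔ Submodule.span (ZMod 2) {b})
      (sup_le hAB (by simpa using hb))
      (by rw [hc]; exact Nat.pow_le_pow_right two_pos (by omega)) (a + 1) hc (by omega) (by omega)
    exact ⟨C, le_sup_left.trans h1, h2, h3⟩

theorem exists_linearEquiv_map {A B : Submodule (ZMod 2) V} (h : Nat.card A = Nat.card B) {a b : V}
    (ha : a ∈ A) (hb : b ∈ B) (ha0 : a ≠ 0) (hb0 : b ≠ 0) :
    ∃ φ : V ≃ₗ[ZMod 2] V, φ a = b ∧ ∀ x, φ x ∈ B ↔ x ∈ A := by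
  have hr : Module.finrank (ZMod 2) A = Module.finrank (ZMod 2) B := by
    have h1 := Module.natCard_eq_pow_finrank (K := ZMod 2) (V := A)
    have h2 := Module.natCard_eq_pow_finrank (K := ZMod 2) (V := B)
    rw [h1, h2, Nat.card_zmod] at h
    exact Nat.pow_right_injective le_rfl h
  obtain ⟨ψ, hψ⟩ := Submodule.exists_linearEquiv_restrict_eq (LinearEquiv.ofFinrankEq A B hr)
  have hψB : ∀ x, ψ x ∈ B ↔ x ∈ A := by
    intro x
    constructor
    · intro hx
      have h1 := hψ ((LinearEquiv.ofFinrankEq A B hr).symm ⟨ψ x, hx⟩)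
      rw [LinearEquiv.apply_symm_apply] at h1
      rw [ψ.injective h1]
      exact Subtype.prop _
    · intro hx
      rw [← hψ ⟨x, hx⟩]
      exact Subtype.prop _
  have hbot : ∀ x : V, x ≠ 0 → x ∉ (⊥ : Submodule (ZMod 2) V) := fun x hx h => hx h
  obtain ⟨ξ, -, h1, h2⟩ := exists_dual_eq_one_two (hbot (ψ a) (by simpa using ha0)) (hbot b hb0)
  have h3 : ξ (ψ a + b) = 0 := by rw [map_add, h1, h2, add_self_two]
  refine ⟨ψ ≪≫ₗ LinearEquiv.transvection h3, ?_, fun x => ?_⟩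
  · rw [LinearEquiv.trans_apply, LinearEquiv.transvection.apply, h1, one_smul,
      add_add_cancel_left_two]
  · rw [LinearEquiv.trans_apply, LinearEquiv.transvection.apply, ← hψB,
      Submodule.add_mem_iff_left]
    exact B.smul_mem _ (B.add_mem ((hψB a).2 ha) hb)

end Subspaces

section Levels

variable {G V : Type*} [Group G] [AddCommGroup V] [Module (ZMod 2) V] [DistribMulAction G V]
  [Finite G] [Finite V]

/-- The pointwise stabilizer of `F` is transitive on incident pairs of a nonzero vector modulo `F`
and a nonzero functional vanishing on `F`. -/
def FlagTransMod (G : Type*) [Group G] [DistribMulAction G V] (F : Submodule (ZMod 2) V) : Prop :=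
  ∀ ξ ξ' : Module.Dual (ZMod 2) V, (∀ x ∈ F, ξ x = 0) → (∀ x ∈ F, ξ' x = 0) →
    ∀ y y', ξ y = 1 → ξ' y' = 1 → ∀ v v', v ∉ F → v' ∉ F → ξ v = 0 → ξ' v' = 0 →
    ∃ g : G, (∀ x ∈ F, g • x = x) ∧ (∀ x, ξ' (g • x) = ξ x) ∧ g • v + v' ∈ F

/-- Every linear automorphism agrees on `F` with some group element. -/
def LinearTransOn (G : Type*) [Group G] [DistribMulAction G V] (F : Submodule (ZMod 2) V) : Prop :=
  ∀ φ : V ≃ₗ[ZMod 2] V, ∃ g : G, ∀ x ∈ F, g • x = φ x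

theorem PairTransMod.flagTransMod_two {F : Submodule (ZMod 2) V} (hF : PairTransMod G F)
    (hc : Nat.card V = 4 * Nat.card F) : FlagTransMod G F := by
  intro ξ ξ' hξ hξ' y y' hy hy' v v' hv hv' hvξ hvξ'
  have hne : ∀ (ξ : Module.Dual (ZMod 2) V), (∀ x ∈ F, ξ x = 0) → ∀ y, ξ y = 1 → y ∉ F :=
    fun ξ hξ y hy h => zero_ne_one ((hξ y h).symm.trans hy)
  obtain ⟨g, h1, h2, h3⟩ := hF v y v' y' hv (hne ξ hξ y hy)
    (hne ξ hξ _ (by rw [map_add, hvξ, hy, zero_add])) hv' (hne ξ' hξ' y' hy')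
    (hne ξ' hξ' _ (by rw [map_add, hvξ', hy', zero_add]))
  refine ⟨g, h1, ?_, h2⟩
  have hv2 : ξ' (g • v) = 0 := by
    have := hξ' _ h2
    rwa [map_add, hvξ', add_zero] at this
  have hy2 : ξ' (g • y) = 1 := by
    have := hξ' _ h3
    rwa [map_add, add_eq_zero_two, hy'] at this
  have hy3 : y ∉ F ⊔ Submodule.span (ZMod 2) {v} := by
    rw [mem_sup_span_one]
    rintro (h | h)
    · exact hne ξ hξ y hy h
    · exact hne ξ hξ _ (by rw [map_add, hvξ, hy, add_zero]) h
  have htop : F ⊔ Submodule.span (ZMod 2) {v} ⊔ Submodule.span (ZMod 2) {y} = ⊤ := by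
    apply submodule_eq_of_card le_top
    rw [card_sup_span_one hy3, card_sup_span_one hv, Nat.card_congr Submodule.topEquiv.toEquiv, hc]
    omega
  have hFv : ∀ x ∈ F ⊔ Submodule.span (ZMod 2) {v}, ξ' (g • x) = ξ x := by
    intro x hx
    have hF' : ∀ x ∈ F, ξ' (g • x) = ξ x := fun x hx => by rw [h1 x hx, hξ x hx, hξ' x hx]
    rcases mem_sup_span_one.1 hx with h | h
    · exact hF' x h
    · have := hF' _ h
      rwa [smul_add, map_add, map_add, hv2, hvξ, add_zero, add_zero] at this
  intro x
  have hx : x ∈ F ⊔ Submodule.span (ZMod 2) {v} ⊔ Submodule.span (ZMod 2) {y} := by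
    rw [htop]; trivial
  rcases mem_sup_span_one.1 hx with h | h
  · exact hFv x h
  · have := hFv _ h
    rw [smul_add, map_add, map_add, hy2, hy] at this
    exact add_right_cancel this

theorem PairTransMod.flagTransMod {F : Submodule (ZMod 2) V} (hF : PairTransMod G F) {N : ℕ}
    (hN : 2 ≤ N) (hc : Nat.card V = 2 ^ N * Nat.card F) : FlagTransMod G F := by
  rcases hN.eq_or_lt with rfl | hN
  · exact hF.flagTransMod_two hc
  · intro ξ ξ' hξ hξ' y y' hy hy' v v' hv hv' hvξ hvξ'
    refine hF.flag hN ?_ hξ hξ' hy hy' hv hv' (hvξ.trans hvξ'.symm)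
    rw [← card_quotient_mul F] at hc
    exact Nat.eq_of_mul_eq_mul_right Nat.card_pos hc

/-- A flag and an antiflag with the same functional can be moved simultaneously. -/
theorem FlagTransMod.with_antiflag {F : Submodule (ZMod 2) V} (hF : FlagTransMod G F)
    (hA : AntiflagTransMod G F) {n N : ℕ} (hN : 2 ≤ N) (hc : Nat.card V = 2 ^ N * Nat.card F)
    (hn : Nat.card V = 2 ^ n)
    {ξ ξ' : Module.Dual (ZMod 2) V} (hξ : ∀ x ∈ F, ξ x = 0) (hξ' : ∀ x ∈ F, ξ' x = 0) {y y' : V}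
    (hy : ξ y = 1) (hy' : ξ' y' = 1) {v v' : V} (hv : v ∉ F) (hv' : v' ∉ F) (hvξ : ξ v = 0)
    (hvξ' : ξ' v' = 0) :
    ∃ g : G, (∀ x ∈ F, g • x = x) ∧ (∀ x, ξ' (g • x) = ξ x) ∧ g • v + v' ∈ F ∧ g • y = y' := by
  obtain ⟨g, h1, h2, h3⟩ := hF ξ ξ' hξ hξ' y y' hy hy' v v' hv hv' hvξ hvξ'
  let H : Subgroup (fixingSubgroup G (F : Set V)) :=
    { carrier := {h | ∀ x, ξ' ((h : G) • x) = ξ' x}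
      one_mem' := fun x => by rw [Subgroup.coe_one, one_smul]
      mul_mem' := fun {a b} ha hb x => by rw [Subgroup.coe_mul, mul_smul, ha, hb]
      inv_mem' := fun {a} ha x => by rw [← ha, Subgroup.coe_inv, smul_inv_smul] }
  let A : Set V := {y | ξ' y = 1}
  let B : Set (V ⧸ F) := {w | w ≠ 0 ∧ F.liftQ ξ' hξ' w = 0}
  have hp := evalPairing_nondeg (Γ := G) (M := V)
  have hξ0 : (ξ' : Contragredient G V) ≠ 0 := by
    intro h
    have h5 : ξ' y' = (0 : Module.Dual (ZMod 2) V) y' := congrArg (fun z : Module.Dual (ZMod 2) V => z y') h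
    rw [hy', LinearMap.zero_apply] at h5
    exact one_ne_zero h5
  have hQ0 : F.liftQ ξ' hξ' ≠ 0 := by
    intro h
    have h5 : ξ' y' = 0 := congrArg (fun z : Module.Dual (ZMod 2) (V ⧸ F) => z (Submodule.Quotient.mk y')) h
    rw [hy'] at h5
    exact one_ne_zero h5
  have hker : ∀ (M : Type _) [AddCommGroup M] [Module (ZMod 2) M] [Finite M]
      (f : Module.Dual (ZMod 2) M), f ≠ 0 → 2 * Nat.card (LinearMap.ker f) = Nat.card M := by
    intro M _ _ _ f hf
    rw [← card_range_mul_card_ker f, LinearMap.range_eq_top.2 (LinearMap.surjective hf),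
      Nat.card_congr Submodule.topEquiv.toEquiv, Nat.card_zmod]
  have hAc : 2 * A.ncard = 2 ^ n := by
    have h5 := hker V ξ' hξ0
    have h6 := Set.ncard_add_ncard_compl A
    have h7 : Aᶜ = (LinearMap.ker ξ' : Set V) := by
      ext x
      simp [A, zmod_two_ne_one]
    rw [h7, ncard_submodule] at h6
    omega
  have hBc : 2 * (B.ncard + 1) = 2 ^ N := by
    have h5 := hker (V ⧸ F) (F.liftQ ξ' hξ') hQ0
    have h6 : B = (LinearMap.ker (F.liftQ ξ' hξ') : Set (V ⧸ F)) \ {0} := by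
      ext x
      simp [B, and_comm]
    have h7 := Set.ncard_sdiff_singleton_add_one (s := (LinearMap.ker (F.liftQ ξ' hξ') : Set (V ⧸ F)))
      (a := 0) (Submodule.zero_mem _)
    rw [← h6, ncard_submodule] at h7
    rw [h7, h5]
    rw [← card_quotient_mul F] at hc
    exact Nat.eq_of_mul_eq_mul_right Nat.card_pos hc
  have hco : Nat.Coprime A.ncard B.ncard := by
    have h5 : 2 ∣ B.ncard + 1 := by
      obtain ⟨M, rfl⟩ : ∃ M, N = M + 2 := ⟨N - 2, by omega⟩
      exact ⟨2 ^ M, by rw [pow_add] at hBc; omega⟩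
    have h6 : Nat.Coprime 2 B.ncard := by
      rw [Nat.coprime_two_left, Nat.odd_iff]
      omega
    have h7 : Nat.Coprime (2 * A.ncard) B.ncard := by
      rw [hAc]; exact Nat.Coprime.pow_left n h6
    exact Nat.Coprime.coprime_dvd_left (Dvd.intro_left 2 rfl) h7
  obtain ⟨h, hH, h4, h5⟩ := transOn_prod_of_coprime (H := H) (A := A) (B := B)
    (a := g • y) (a' := y') (b := Submodule.Quotient.mk (g • v)) (b' := Submodule.Quotient.mk v')
    (by
      intro a ha b hb
      obtain ⟨k, k1, k2, k3⟩ := hA ξ' hξ' a b ha hb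
      exact ⟨⟨k, (mem_fixingSubgroup_iff G).2 k1⟩, k2, k3⟩)
    (by
      rintro a ⟨ha0, ha⟩ b ⟨hb0, hb⟩
      induction a using Submodule.Quotient.induction_on with | _ a => ?_
      induction b using Submodule.Quotient.induction_on with | _ b => ?_
      rw [Ne, Submodule.Quotient.mk_eq_zero] at ha0 hb0
      obtain ⟨k, k1, k2, k3⟩ := hF ξ' ξ' hξ' hξ' y' y' hy' hy' a b ha0 hb0 ha hb
      refine ⟨⟨k, (mem_fixingSubgroup_iff G).2 k1⟩, k2, ?_⟩
      rw [smul_mk, mk_eq_mk]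
      exact k3)
    (fun k hk a ha => (hk a).trans ha)
    (by
      rintro k hk a ⟨ha0, ha⟩
      refine ⟨smul_ne_zero_iff'.2 ha0, ?_⟩
      induction a using Submodule.Quotient.induction_on with | _ a => ?_
      exact (hk a).trans ha)
    hco ((h2 y).trans hy) hy' 
    ⟨by
      rw [Ne, Submodule.Quotient.mk_eq_zero]
      intro h
      have h6 : g • v + v' + g • v ∈ F := F.add_mem h3 h
      rw [add_comm, add_add_cancel_left_two] at h6
      exact hv' h6, (h2 v).trans hvξ⟩
    ⟨by rwa [Ne, Submodule.Quotient.mk_eq_zero], hvξ'⟩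
  refine ⟨h * g, fun x hx => ?_, fun x => ?_, ?_, ?_⟩
  · rw [mul_smul, h1 x hx]
    exact (mem_fixingSubgroup_iff G).1 h.2 x hx
  · rw [mul_smul, hH, h2]
  · rw [smul_mk, mk_eq_mk] at h5
    rwa [mul_smul]
  · rwa [mul_smul]

end Levels

section Levels

variable {G V : Type*} [Group G] [AddCommGroup V] [Module (ZMod 2) V] [DistribMulAction G V]
  [Finite G] [Finite V]

theorem exists_sup_span_one {D : Submodule (ZMod 2) V} {j : ℕ} (hD : Nat.card D = 2 ^ (j + 1)) :
    ∃ F : Submodule (ZMod 2) V, ∃ v, Nat.card F = 2 ^ j ∧ v ∉ F ∧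
      D = F ⊔ Submodule.span (ZMod 2) {v} := by
  obtain ⟨F, -, h1, h2⟩ := exists_submodule_card (bot_le (a := D)) (j := j)
    (by rw [Nat.card_unique]; exact Nat.one_le_two_pow)
    (by rw [hD]; exact Nat.pow_le_pow_right two_pos j.le_succ)
  obtain ⟨v, h3, h4⟩ := exists_mem_notMem (A := F) (B := D)
    (by rw [hD, h2]; exact Nat.pow_lt_pow_right one_lt_two j.lt_succ_self)
  refine ⟨F, v, h2, h4, (submodule_eq_of_card ?_ ?_).symm⟩
  · exact sup_le h1 (by simpa using h3)
  · rw [card_sup_span_one h4, hD, h2, pow_succ']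

theorem AntiflagTransMod.exists_involution {F : Submodule (ZMod 2) V} (hF : AntiflagTransMod G F)
    {n j : ℕ} (hn : Nat.card V = 2 ^ n) (hj : Nat.card F = 2 ^ j) (hjn : j + 2 ≤ n) :
    ∃ t : G, t ≠ 1 ∧ t * t = 1 ∧ (∀ x ∈ F, t • x = x) ∧ ∃ w, w ∉ F ∧ t • w = w := by
  obtain ⟨y, -, hy⟩ := exists_mem_notMem (A := F) (B := ⊤) (by
    rw [Nat.card_congr Submodule.topEquiv.toEquiv, hn, hj]
    exact Nat.pow_lt_pow_right one_lt_two (by omega))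
  obtain ⟨ξ, h1, h2⟩ := exists_dual_eq_one hy
  let K := fixingSubgroup G (F : Set V)
  have hKF : ∀ (k : K), ∀ x ∈ F, (k : G) • x = x := fun k => (mem_fixingSubgroup_iff G).1 k.2
  let Q : Sylow 2 K := default
  have hQ : IsPGroup 2 (Q : Subgroup K) := Q.isPGroup'
  -- the stabilizer of `ξ` in `K` is transitive on the complement of the kernel of `ξ`
  have hdvd : 2 ^ (n - 1) ∣ Nat.card K := by
    let H : Subgroup K :=
      { carrier := {h | ∀ x, ξ ((h : G) • x) = ξ x}
        one_mem' := fun x => by rw [Subgroup.coe_one, one_smul]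
        mul_mem' := fun {a b} ha hb x => by rw [Subgroup.coe_mul, mul_smul, ha, hb]
        inv_mem' := fun {a} ha x => by rw [← ha, Subgroup.coe_inv, smul_inv_smul] }
    have h3 : MulAction.orbit H y = {x | ξ x = 1} := by
      apply orbit_eq_of_transOn
      · intro a ha b hb
        obtain ⟨k, k1, k2, k3⟩ := hF ξ h1 a b ha hb
        exact ⟨⟨k, (mem_fixingSubgroup_iff G).2 k1⟩, k2, k3⟩
      · intro h hh a ha
        exact (hh a).trans ha
      · exact h2
    have h4 : {x | ξ x = 1}.ncard = 2 ^ (n - 1) := by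
      have h6 := Set.ncard_add_ncard_compl {x | ξ x = 1}
      have h7 : {x | ξ x = 1}ᶜ = (LinearMap.ker ξ : Set V) := by
        ext x
        simp [zmod_two_ne_one]
      have h8 : 2 * Nat.card (LinearMap.ker ξ) = Nat.card V := by
        rw [← card_range_mul_card_ker ξ, LinearMap.range_eq_top.2 (LinearMap.surjective ?_),
          Nat.card_congr Submodule.topEquiv.toEquiv, Nat.card_zmod]
        rintro rfl
        exact zero_ne_one h2
      rw [h7, ncard_submodule] at h6
      obtain ⟨m, rfl⟩ : ∃ m, n = m + 1 := ⟨n - 1, by omega⟩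
      rw [pow_succ] at hn
      rw [Nat.add_sub_cancel]
      omega
    rw [← h4, ← h3, ← MulAction.index_stabilizer]
    exact (Subgroup.index_dvd_card _).trans (Subgroup.card_subgroup_dvd_card H)
  have hQc : 2 ^ (n - 1) ≤ Nat.card Q := Nat.le_of_dvd Nat.card_pos (Q.pow_dvd_card_of_pow_dvd_card hdvd)
  have hVF : ∃ N, 1 ≤ N ∧ Nat.card (V ⧸ F) = 2 ^ N := by
    refine ⟨n - j, by omega, Nat.eq_of_mul_eq_mul_right (Nat.card_pos (α := F)) ?_⟩
    rw [card_quotient_mul, hn, hj, ← pow_add]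
    congr 1
    omega
  obtain ⟨N, hN, hVF⟩ := hVF
  obtain ⟨w, hw, hwo⟩ := exists_small_orbit hQ ({0}ᶜ : Set (V ⧸ F)) (Set.toFinite _)
    (fun s a ha => smul_ne_zero_iff'.2 ha) 0 (by
      intro h
      have h3 := Set.ncard_add_ncard_compl ({0} : Set (V ⧸ F))
      rw [Set.ncard_singleton, hVF] at h3
      obtain ⟨m, rfl⟩ : ∃ m, N = m + 1 := ⟨N - 1, by omega⟩
      rw [pow_succ] at h3
      omega)
  induction w using Submodule.Quotient.induction_on with | _ w => ?_
  have hwF : w ∉ F := by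
    rw [← Submodule.Quotient.mk_eq_zero F]
    exact hw
  have hwq : ∀ q : Q, ((q : K) : G) • w + w ∈ F := by
    intro q
    have h3 := smul_eq_of_ncard_orbit hwo q
    exact mk_eq_mk.1 h3
  have hinj : ¬ Function.Injective (fun q : Q => (⟨((q : K) : G) • w + w, hwq q⟩ : F)) := by
    intro h
    have h3 := Nat.card_le_card_of_injective _ h
    rw [hj] at h3
    exact absurd (hQc.trans h3) (by
      rw [not_le]; exact Nat.pow_lt_pow_right one_lt_two (by omega))
  let R : Subgroup Q := MulAction.stabilizer Q w
  have hR : R ≠ ⊥ := by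
    intro hR
    apply hinj
    intro a b hab
    have h3 : ((a : K) : G) • w = ((b : K) : G) • w := add_right_cancel (congrArg Subtype.val hab)
    have h4 : b⁻¹ * a ∈ R := by
      change (((b : K) : G)⁻¹ * ((a : K) : G)) • w = w
      rw [mul_smul, inv_smul_eq_iff]
      exact h3
    rw [hR, Subgroup.mem_bot, inv_mul_eq_one] at h4
    exact h4.symm
  have hR2 : 2 ∣ Nat.card R := by
    obtain ⟨m, hm⟩ := (IsPGroup.iff_card.1 (hQ.to_subgroup R))
    rw [hm]
    apply dvd_pow_self
    rintro rfl
    rw [pow_zero] at hm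
    exact hR (Subgroup.card_eq_one.1 hm)
  obtain ⟨t, ht⟩ := exists_prime_orderOf_dvd_card' 2 hR2
  have ht1 : t ≠ 1 := by
    rintro rfl
    simp at ht
  have ht2 : t * t = 1 := by
    have h3 := pow_orderOf_eq_one t
    rwa [ht, pow_two] at h3
  refine ⟨(((t : Q) : K) : G), ?_, ?_, hKF _, w, hwF, t.2⟩
  · intro h
    apply ht1
    ext
    exact h
  · exact congrArg (fun r : R => (((r : Q) : K) : G)) ht2

/-- An involution fixing enough vectors moves a vector by a fixed vector in a prescribed kernel. -/
theorem exists_of_involution [FaithfulSMul G V] {n j : ℕ} (hn : Nat.card V = 2 ^ n) (hodd : Odd n)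
    {F : Submodule (ZMod 2) V} (hj : Nat.card F = 2 ^ j) (hj0 : 1 ≤ j) {t : G} (ht1 : t ≠ 1)
    (ht2 : t * t = 1) (htF : ∀ x ∈ F, t • x = x) {w : V} (hwF : w ∉ F) (htw : t • w = w) :
    ∃ (F' : Submodule (ZMod 2) V) (ξ : Module.Dual (ZMod 2) V) (v f y : V), Nat.card F' = 2 ^ j ∧
      (∀ x ∈ F', t • x = x) ∧ (∀ x ∈ F', ξ x = 0) ∧ f ∈ F' ∧ f ≠ 0 ∧ t • v = v + f ∧ v ∉ F' ∧
      ξ v = 0 ∧ ξ y = 1 ∧ t • y = y ∧ ∀ x, ξ (t • x) = ξ x := by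
  set d := displacement V t with hd
  let K := LinearMap.ker d
  let I := LinearMap.range d
  have hK : ∀ {x}, x ∈ K ↔ t • x = x := by
    intro x
    rw [LinearMap.mem_ker, hd, displacement_apply, add_eq_zero_two]
  have hIK : I ≤ K := by
    rintro _ ⟨x, rfl⟩
    rw [hK, hd, displacement_apply, smul_add, ← mul_smul, ht2, one_smul, add_comm]
  have hne : Nat.card I < Nat.card K := by
    refine lt_of_le_of_ne (card_submodule_mono hIK) fun h => ?_
    have h1 := card_range_mul_card_ker d
    obtain ⟨k, hk⟩ := card_submodule_two_pow K
    change Nat.card I * Nat.card K = _ at h1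
    rw [h, hk, hn, ← pow_add] at h1
    have h2 := Nat.pow_right_injective le_rfl h1
    rw [← h2] at hodd
    exact (Nat.not_odd_iff_even.2 ⟨k, rfl⟩) hodd
  obtain ⟨y, hyK, hyI⟩ := exists_mem_notMem hne
  obtain ⟨ξ, hξI, hξy⟩ := exists_dual_eq_one hyI
  have hKt : ∃ x, x ∉ K := by
    by_contra hc
    push Not at hc
    apply ht1
    apply FaithfulSMul.eq_of_smul_eq_smul (α := V)
    intro x
    rw [one_smul]
    exact hK.1 (hc x)
  obtain ⟨v, hvK, hvξ⟩ : ∃ v, v ∉ K ∧ ξ v = 0 := by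
    obtain ⟨x, hx⟩ := hKt
    rcases zmod_two_cases (ξ x) with h | h
    · exact ⟨x, hx, h⟩
    · refine ⟨x + y, fun hc => hx ?_, by rw [map_add, h, hξy, add_self_two]⟩
      exact (Submodule.add_mem_iff_left K hyK).1 hc
  have hdI : ∀ x, d x ∈ I := fun x => ⟨x, rfl⟩
  have hcard : Nat.card (K ⊓ LinearMap.ker ξ : Submodule (ZMod 2) V) * 2 = Nat.card K := by
    have h1 : K = (K ⊓ LinearMap.ker ξ) ⊔ Submodule.span (ZMod 2) {y} := by
      ext x
      rw [mem_sup_span_one]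
      constructor
      · intro hx
        rcases zmod_two_cases (ξ x) with h | h
        · exact Or.inl ⟨hx, h⟩
        · exact Or.inr ⟨K.add_mem hx hyK, by
            change ξ (x + y) = 0
            rw [map_add, h, hξy, add_self_two]⟩
      · rintro (h | h)
        · exact h.1
        · exact (Submodule.add_mem_iff_left K hyK).1 h.1
    nth_rw 2 [h1]
    rw [card_sup_span_one, mul_comm]
    intro h
    exact zero_ne_one (h.2.symm.trans hξy)
  have hcK : 2 ^ j ≤ Nat.card (K ⊓ LinearMap.ker ξ : Submodule (ZMod 2) V) := by
    have h1 : F ⊔ Submodule.span (ZMod 2) {w} ≤ K :=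
      sup_le (fun x hx => hK.2 (htF x hx)) (by simpa using hK.2 htw)
    have h2 := card_submodule_mono h1
    rw [card_sup_span_one hwF, hj] at h2
    omega
  have hf0 : d v ≠ 0 := fun h => hvK h
  have hfm : d v ∈ K ⊓ LinearMap.ker ξ := ⟨hIK (hdI v), hξI _ (hdI v)⟩
  obtain ⟨F', h1, h2, h3⟩ := exists_submodule_card
    (A := Submodule.span (ZMod 2) {d v}) (B := K ⊓ LinearMap.ker ξ) (by simpa using hfm)
    (by rw [card_span_one hf0]; simpa using Nat.pow_le_pow_right two_pos hj0) hcK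
  refine ⟨F', ξ, v, d v, y, h3, fun x hx => hK.1 (h2 hx).1, fun x hx => (h2 hx).2,
    h1 (Submodule.mem_span_singleton_self _), hf0, ?_, fun h => hvK (h2 h).1, hvξ, hξy, hK.1 hyK,
    fun x => ?_⟩
  · rw [hd, displacement_apply, add_comm, add_add_cancel_two]
  · have := hξI _ (hdI x)
    rwa [hd, displacement_apply, map_add, add_eq_zero_two] at this

theorem antiflagTransMod_succ [FaithfulSMul G V] {n j : ℕ} (hn : Nat.card V = 2 ^ n) (hodd : Odd n)
    (hjn : j + 2 ≤ n)
    (hA : ∀ F : Submodule (ZMod 2) V, Nat.card F = 2 ^ j → AntiflagTransMod G F)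
    (hF : ∀ F : Submodule (ZMod 2) V, Nat.card F = 2 ^ j → FlagTransMod G F)
    (hL : ∀ F : Submodule (ZMod 2) V, Nat.card F = 2 ^ j → LinearTransOn G F)
    {D : Submodule (ZMod 2) V} (hD : Nat.card D = 2 ^ (j + 1)) : AntiflagTransMod G D := by
  obtain ⟨F, v, hFj, hvF, rfl⟩ := exists_sup_span_one hD
  intro ξ hξD y y' hy hy'
  have hξF : ∀ x ∈ F, ξ x = 0 := fun x hx => hξD x (le_sup_left (a := F) hx)
  have hξv : ξ v = 0 := hξD v (mem_sup_span_one.2 (Or.inr (by rw [add_self_two]; exact F.zero_mem)))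
  have hc : Nat.card V = 2 ^ (n - j) * Nat.card F := by
    rw [hn, hFj, ← pow_add]; congr 1; omega
  have hwith := fun {ξ' : Module.Dual (ZMod 2) V} hξ' {y y' v v'} hy hy' hv hv' a b =>
    (hF F hFj).with_antiflag (hA F hFj) (show 2 ≤ n - j by omega) hc hn (ξ := ξ') (ξ' := ξ)
    hξ' hξF (y := y) (y' := y') hy hy' (v := v) (v' := v') hv hv' a b
  obtain ⟨g, g1, g2, g3, g4⟩ := hwith hξF hy hy' hvF hvF hξv hξv
  -- it remains to correct the image of `v`
  suffices ∃ h : G, (∀ x ∈ F, h • x = x) ∧ (∀ x, ξ (h • x) = ξ x) ∧ h • (g • v) = v ∧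
      h • y' = y' by
    obtain ⟨h, h1, h2, h3, h4⟩ := this
    refine ⟨h * g, fun x hx => ?_, fun x => ?_, ?_⟩
    · have h5 : (h * g) • v = v := by rw [mul_smul, h3]
      have h6 : ∀ x ∈ F, (h * g) • x = x := fun x hx => by rw [mul_smul, g1 x hx, h1 x hx]
      rcases mem_sup_span_one.1 hx with hx | hx
      · exact h6 x hx
      · have := h6 _ hx
        rw [smul_add, h5] at this
        exact add_right_cancel this
    · rw [mul_smul, h2, g2]
    · rw [mul_smul, g4, h4]
  obtain ⟨f, hf, hgv⟩ : ∃ f ∈ F, g • v = v + f :=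
    ⟨_, g3, by rw [add_comm (g • v), add_add_cancel_left_two]⟩
  rw [hgv]
  rcases eq_or_ne f 0 with rfl | hf0
  · exact ⟨1, fun x _ => one_smul G x, fun x => by rw [one_smul], by rw [one_smul, add_zero],
      one_smul G _⟩
  have hj0 : 1 ≤ j := by
    by_contra hc
    obtain rfl : j = 0 := by omega
    have := submodule_eq_of_card (bot_le (a := F)) (by rw [hFj, Nat.card_unique, pow_zero])
    rw [← this] at hf
    exact hf0 hf
  obtain ⟨t, ht1, ht2, htF, w, hwF, htw⟩ := (hA F hFj).exists_involution hn hFj hjn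
  obtain ⟨F', ζ, v₁, f₁, y₁, hF', htF', hζF', hf₁, hf₁0, htv₁, hv₁, hζv₁, hζy₁, hty₁, hζt⟩ :=
    exists_of_involution hn hodd hFj hj0 ht1 ht2 htF hwF htw
  obtain ⟨φ, hφf, hφ⟩ := exists_linearEquiv_map (hF'.trans hFj.symm) hf₁ hf hf₁0 hf0
  obtain ⟨g₀, hg₀⟩ := hL F' hF' φ
  have hg₀F : ∀ x, g₀ • x ∈ F ↔ x ∈ F' := by
    have h1 : ∀ x ∈ F', g₀ • x ∈ F := fun x hx => by rw [hg₀ x hx]; exact (hφ x).2 hx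
    intro x
    refine ⟨fun hx => ?_, h1 x⟩
    obtain ⟨z, hz⟩ := φ.surjective (g₀ • x)
    have hz' : z ∈ F' := (hφ z).1 (hz ▸ hx)
    rw [← hg₀ z hz'] at hz
    rwa [← smul_left_cancel g₀ hz]
  have hg₀' : ∀ x ∈ F, g₀⁻¹ • x ∈ F' := fun x hx => by rwa [← hg₀F, smul_inv_smul]
  obtain ⟨g₁, k1, k2, k3, k4⟩ := hwith (ξ' := ζ ∘ₗ smulLinear g₀⁻¹)
    (fun x hx => hζF' _ (hg₀' x hx)) (y := g₀ • y₁) (y' := y') (v := g₀ • v₁) (v' := v)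
    (by change ζ (g₀⁻¹ • g₀ • y₁) = 1; rw [inv_smul_smul, hζy₁]) hy'
    (fun h => hv₁ ((hg₀F _).1 h)) hvF
    (by change ζ (g₀⁻¹ • g₀ • v₁) = 0; rw [inv_smul_smul, hζv₁]) hξv
  let γ := g₁ * g₀
  have hγF : ∀ x ∈ F, γ⁻¹ • x ∈ F' := fun x hx => by
    change (g₁ * g₀)⁻¹ • x ∈ F'
    rw [mul_inv_rev, mul_smul, inv_smul_eq_iff.2 (k1 x hx).symm]
    exact hg₀' x hx
  have hγξ : ∀ x, ξ (γ • x) = ζ x := fun x => by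
    change ξ ((g₁ * g₀) • x) = ζ x
    rw [mul_smul, k2]
    change ζ (g₀⁻¹ • g₀ • x) = ζ x
    rw [inv_smul_smul]
  have hconj : ∀ x : V, t • γ⁻¹ • x = γ⁻¹ • x → (γ * t * γ⁻¹) • x = x := fun x hx => by
    rw [mul_smul, mul_smul, hx, smul_inv_smul]
  have hfix : ∀ x ∈ F, (γ * t * γ⁻¹) • x = x := fun x hx => hconj x (htF' _ (hγF x hx))
  refine ⟨γ * t * γ⁻¹, hfix, fun x => ?_, ?_, ?_⟩
  · rw [mul_smul, mul_smul, hγξ, hζt, ← hγξ, smul_inv_smul]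
  · have h1 : γ • v₁ + v ∈ F := by
      change (g₁ * g₀) • v₁ + v ∈ F
      rwa [mul_smul]
    have h2 : γ • f₁ = f := by
      change (g₁ * g₀) • f₁ = f
      rw [mul_smul, hg₀ _ hf₁, hφf, k1 f hf]
    have h3 : (γ * t * γ⁻¹) • γ • v₁ = γ • v₁ + f := by
      rw [mul_smul, mul_smul, inv_smul_smul, htv₁, smul_add, h2]
    have h4 := hfix _ h1
    rw [smul_add, h3] at h4
    rw [smul_add, hfix f hf]
    have h5 : (γ * t * γ⁻¹) • v = v + f := by
      have h6 : γ • v₁ + (f + (γ * t * γ⁻¹) • v) = γ • v₁ + v := by rw [← add_assoc, h4]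
      exact (add_add_cancel_left_two f _).symm.trans (by rw [add_left_cancel h6, add_comm])
    rw [h5, add_add_cancel_two]
  · apply hconj
    have h1 : γ⁻¹ • y' = y₁ := by
      rw [inv_smul_eq_iff]
      change y' = (g₁ * g₀) • y₁
      rw [mul_smul, k4]
    rw [h1, hty₁]

theorem linearTransOn_succ {j : ℕ}
    (hA : ∀ F : Submodule (ZMod 2) V, Nat.card F = 2 ^ j → AntiflagTransMod G F)
    (hL : ∀ F : Submodule (ZMod 2) V, Nat.card F = 2 ^ j → LinearTransOn G F)
    {D : Submodule (ZMod 2) V} (hD : Nat.card D = 2 ^ (j + 1)) : LinearTransOn G D := by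
  obtain ⟨F, v, hFj, hvF, rfl⟩ := exists_sup_span_one hD
  intro φ
  obtain ⟨g, hg⟩ := hL F hFj φ
  let F' := F.map (φ : V →ₗ[ZMod 2] V)
  have hF' : Nat.card F' = 2 ^ j := by
    rw [← hFj]
    exact (Nat.card_congr (φ.submoduleMap F).toEquiv).symm
  have h1 : φ v ∉ F' := by
    rintro ⟨x, hx, h⟩
    rw [← φ.injective h] at hvF
    exact hvF hx
  have h2 : g • v ∉ F' := by
    rintro ⟨x, hx, h⟩
    change φ x = g • v at h
    rw [← hg x hx] at h
    rw [← smul_left_cancel g h] at hvF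
    exact hvF hx
  obtain ⟨ξ, k1, k2, k3⟩ := exists_dual_eq_one_two h2 h1
  obtain ⟨h, h3, -, h5⟩ := hA F' hF' ξ k1 _ _ k2 k3
  have h6 : ∀ x ∈ F, (h * g) • x = φ x := fun x hx => by
    rw [mul_smul, hg x hx]
    exact h3 _ (Submodule.mem_map_of_mem hx)
  refine ⟨h * g, fun x hx => ?_⟩
  rcases mem_sup_span_one.1 hx with hx | hx
  · exact h6 x hx
  · have := h6 _ hx
    rw [smul_add, map_add, mul_smul h g v, h5] at this
    exact add_right_cancel this

end Levels

section Levels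

variable {G V : Type*} [Group G] [AddCommGroup V] [Module (ZMod 2) V] [DistribMulAction G V]
  [Finite G] [Finite V]

theorem AntiflagTransMod.dual_trans {D : Submodule (ZMod 2) V} (hD : AntiflagTransMod G D)
    {ξ ξ' : Module.Dual (ZMod 2) V} (hξ : ∀ x ∈ D, ξ x = 0) (hξ' : ∀ x ∈ D, ξ' x = 0) {u : V}
    (hu : ξ u = 1) (hu' : ξ' u = 1) :
    ∃ g : G, (∀ x ∈ D, g • x = x) ∧ g • u = u ∧ ∀ x, ξ' (g • x) = ξ x := by
  classical
  let Γ := fixingSubgroup G (D : Set V)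
  obtain ⟨g, -, hg⟩ := orbit_transfer (evalPairing_nondeg (Γ := Γ) (M := V ⧸ D))
    (evalPairing_smul _ _) ⊤ (fun a => decide (a = 0)) (by
      intro a b hab
      rcases eq_or_ne a 0 with ha | ha
      · simp only [ha] at hab
        have hb : b = 0 := by simpa using hab.symm
        exact ⟨1, trivial, by rw [one_smul, ha, hb]⟩
      · have hb : b ≠ 0 := by simpa [ha] using hab
        induction a using Submodule.Quotient.induction_on with | _ a => ?_
        induction b using Submodule.Quotient.induction_on with | _ b => ?_
        rw [Ne, Submodule.Quotient.mk_eq_zero] at ha hb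
        obtain ⟨ζ, h1, h2, h3⟩ := exists_dual_eq_one_two ha hb
        obtain ⟨g, g1, -, g3⟩ := hD ζ h1 a b h2 h3
        exact ⟨⟨g, (mem_fixingSubgroup_iff G).2 g1⟩, trivial, by rw [smul_mk, g3]⟩)
    (fun a => decide (a = 0)) (by
      rintro (_ | _)
      · exact ⟨quotDual G hξ, by simpa using quotDual_ne_zero hξ hu⟩
      · exact ⟨0, by simp⟩)
    (fun h _ a => by rw [decide_eq_decide, smul_eq_zero_iff_eq]) (quotDual G hξ) (quotDual G hξ')
    (by
      simp [quotDual_ne_zero hξ hu, quotDual_ne_zero hξ' hu'])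
  rw [smul_quotDual_iff] at hg
  obtain ⟨k, k1, k2, k3⟩ := hD ξ' hξ' ((g : G) • u) u ((hg u).trans hu) hu'
  refine ⟨k * g, fun x hx => ?_, by rw [mul_smul, k3], fun x => by rw [mul_smul, k2, hg]⟩
  have h1 : (g : G) • x = x := (mem_fixingSubgroup_iff G).1 g.2 x hx
  rw [mul_smul, h1, k1 x hx]

/-- Every vector outside `E` can be translated by elements of `E`, fixing `E` pointwise. -/
def TranslationProp (G : Type*) [Group G] [DistribMulAction G V] (E : Submodule (ZMod 2) V) :
    Prop :=
  ∀ w, w ∉ E → ∀ e ∈ E, ∃ g : G, (∀ x ∈ E, g • x = x) ∧ g • w = w + e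

theorem translationProp_of_antiflag {j : ℕ}
    (hA : ∀ D : Submodule (ZMod 2) V, Nat.card D = 2 ^ j → AntiflagTransMod G D)
    {E : Submodule (ZMod 2) V} (hE : Nat.card E = 2 ^ (j + 1)) : TranslationProp G E := by
  have key : ∀ ξ ξ' : Module.Dual (ZMod 2) V, (∀ e ∈ E, ξ e = ξ' e) → ∀ u ∈ E, ξ u = 1 →
      ∃ g : G, (∀ x ∈ E, g • x = x) ∧ ∀ x, ξ' (g • x) = ξ x := by
    intro ξ ξ' hξξ' u huE hu
    let D := E ⊓ LinearMap.ker ξ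
    have huD : u ∉ D := fun h => zero_ne_one (h.2.symm.trans hu)
    have hED : E = D ⊔ Submodule.span (ZMod 2) {u} := by
      ext x
      rw [mem_sup_span_one]
      constructor
      · intro hx
        rcases zmod_two_cases (ξ x) with h | h
        · exact Or.inl ⟨hx, h⟩
        · exact Or.inr ⟨E.add_mem hx huE, by
            change ξ (x + u) = 0
            rw [map_add, h, hu, add_self_two]⟩
      · rintro (h | h)
        · exact h.1
        · exact (Submodule.add_mem_iff_left E huE).1 h.1
    have hDj : Nat.card D = 2 ^ j := by
      have h1 := card_sup_span_one huD
      rw [← hED, hE, pow_succ'] at h1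
      omega
    obtain ⟨g, g1, g2, g3⟩ := (hA D hDj).dual_trans (ξ := ξ) (ξ' := ξ') (fun x hx => hx.2)
      (fun x hx => (hξξ' x hx.1).symm.trans hx.2) hu ((hξξ' u huE).symm.trans hu)
    refine ⟨g, fun x hx => ?_, g3⟩
    rw [hED] at hx
    rcases mem_sup_span_one.1 hx with hx | hx
    · exact g1 x hx
    · have := g1 _ hx
      rw [smul_add, g2] at this
      exact add_right_cancel this
  intro w hw e he
  obtain ⟨g, g1, g2⟩ := exists_translation (evalPairing_nondeg (Γ := G) (M := V))
    (evalPairing_smul _ _) (fixingSubgroup G (E : Set V)) E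
    (fun h hh e he => (mem_fixingSubgroup_iff G).1 hh e he) (by
      intro ξ ξ' hξξ' ⟨u, huE, hu⟩
      obtain ⟨g, g1, g2⟩ := key ξ ξ' hξξ' u huE (zmod_two_ne_zero.1 hu)
      exact ⟨g, (mem_fixingSubgroup_iff G).2 fun x hx => g1 x hx,
        (evalPairing_smul_eq_iff _ _ g ξ ξ').2 g2⟩) hw he
  exact ⟨g, fun x hx => (mem_fixingSubgroup_iff G).1 g1 x hx, g2⟩

/-- The vectors `u, v, w` are independent modulo `F`. -/
def IndepMod (F : Submodule (ZMod 2) V) (u v w : V) : Prop :=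
  u ∉ F ∧ v ∉ F ∧ u + v ∉ F ∧ w ∉ F ∧ w + u ∉ F ∧ w + v ∉ F ∧ w + (u + v) ∉ F

theorem indepMod_iff {F : Submodule (ZMod 2) V} {u v w : V} :
    IndepMod F u v w ↔ w ∉ F ⊔ Submodule.span (ZMod 2) {u} ⊔ Submodule.span (ZMod 2) {v} ∧
      u ∉ F ∧ v ∉ F ∧ u + v ∉ F := by
  simp only [IndepMod, mem_sup_span_one, not_or, add_assoc, add_comm u v]
  tauto

theorem IndepMod.rotate {F : Submodule (ZMod 2) V} {u v w : V} (h : IndepMod F u v w) :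
    IndepMod F v w u := by
  obtain ⟨h1, h2, h3, h4, h5, h6, h7⟩ := h
  refine ⟨h2, h4, by rwa [add_comm], h1, h3, by rwa [add_comm], ?_⟩
  rwa [← add_assoc, add_comm (u + v)]

theorem IndepMod.exists_shift {F : Submodule (ZMod 2) V} {j : ℕ}
    (hT : ∀ E : Submodule (ZMod 2) V, Nat.card E = 2 ^ (j + 2) → TranslationProp G E)
    (hF : Nat.card F = 2 ^ j) {u v w : V} (h : IndepMod F u v w) {a : V} (ha : a ∈ F) :
    ∃ g : G, (∀ x ∈ F, g • x = x) ∧ g • u = u ∧ g • v = v ∧ g • (w + a) = w := by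
  obtain ⟨h1, h2, h3, h4⟩ := indepMod_iff.1 h
  have hle := le_sup_left (a := F) (b := Submodule.span (ZMod 2) {u})
  have hle' := le_sup_left (a := F ⊔ Submodule.span (ZMod 2) {u}) (b := Submodule.span (ZMod 2) {v})
  obtain ⟨g, g1, g2⟩ := hT (F ⊔ Submodule.span (ZMod 2) {u} ⊔ Submodule.span (ZMod 2) {v}) (by
    rw [card_sup_span_one, card_sup_span_one h2, hF]
    · ring
    · rw [mem_sup_span_one, not_or]
      exact ⟨h3, by rwa [add_comm]⟩) w h1 a (hle' (hle ha))
  refine ⟨g, fun x hx => g1 x (hle' (hle hx)), g1 u (hle' ?_), g1 v ?_, ?_⟩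
  · rw [mem_sup_span_one, add_self_two]; exact Or.inr F.zero_mem
  · rw [mem_sup_span_one, add_self_two]; exact Or.inr (Submodule.zero_mem _)
  · rw [smul_add, g2, g1 a (hle' (hle ha)), add_add_cancel_two]

theorem IndepMod.exists_correct {F : Submodule (ZMod 2) V} {j : ℕ}
    (hT : ∀ E : Submodule (ZMod 2) V, Nat.card E = 2 ^ (j + 2) → TranslationProp G E)
    (hF : Nat.card F = 2 ^ j) {u v w : V} (h : IndepMod F u v w) {u' v' w' : V}
    (hu : u' + u ∈ F) (hv : v' + v ∈ F) (hw : w' + w ∈ F) :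
    ∃ g : G, (∀ x ∈ F, g • x = x) ∧ g • u' = u ∧ g • v' = v ∧ g • w' = w := by
  have key : ∀ {x x' : V}, x' = x + (x' + x) := fun {x x'} => by
    rw [add_comm x', add_add_cancel_left_two]
  obtain ⟨g, g1, g2, g3, g4⟩ := h.exists_shift hT hF hw
  obtain ⟨k, k1, k2, k3, k4⟩ := h.rotate.exists_shift hT hF hu
  obtain ⟨l, l1, l2, l3, l4⟩ := h.rotate.rotate.exists_shift hT hF hv
  rw [← key] at g4 k4 l4
  refine ⟨g * k * l, fun x hx => ?_, ?_, ?_, ?_⟩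
  · rw [mul_smul, mul_smul, l1 x hx, k1 x hx, g1 x hx]
  · have h1 : l • u' = u' := by
      rw [key (x := u) (x' := u'), smul_add, l3, l1 _ hu]
    rw [mul_smul, mul_smul, h1, k4, g2]
  · rw [mul_smul, mul_smul, l4, k2, g3]
  · have h1 : l • w' = w' := by
      rw [key (x := w) (x' := w'), smul_add, l2, l1 _ hw]
    have h2 : k • w' = w' := by
      rw [key (x := w) (x' := w'), smul_add, k3, k1 _ hw]
    rw [mul_smul, mul_smul, h1, h2, g4]

/-- The pointwise stabilizer of `F` is transitive on independent triples modulo `F`. -/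
def TripleTransMod (G : Type*) [Group G] [DistribMulAction G V] (F : Submodule (ZMod 2) V) :
    Prop :=
  ∀ u v w u' v' w' : V, IndepMod F u v w → IndepMod F u' v' w' →
    ∃ g : G, (∀ x ∈ F, g • x = x) ∧ g • u + u' ∈ F ∧ g • v + v' ∈ F ∧ g • w + w' ∈ F

theorem TripleTransMod.pairTransMod_succ {F : Submodule (ZMod 2) V} {j : ℕ}
    (h : TripleTransMod G F)
    (hT : ∀ E : Submodule (ZMod 2) V, Nat.card E = 2 ^ (j + 2) → TranslationProp G E)
    (hF : Nat.card F = 2 ^ j) {x : V} (hx : x ∉ F) :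
    PairTransMod G (F ⊔ Submodule.span (ZMod 2) {x}) := by
  have key : ∀ {u v : V}, u ∉ F ⊔ Submodule.span (ZMod 2) {x} →
      v ∉ F ⊔ Submodule.span (ZMod 2) {x} → u + v ∉ F ⊔ Submodule.span (ZMod 2) {x} →
      IndepMod F x u v := by
    intro u v hu hv huv
    simp only [mem_sup_span_one, not_or] at hu hv huv
    refine ⟨hx, hu.1, by rw [add_comm]; exact hu.2, hv.1, hv.2, by rw [add_comm]; exact huv.1, ?_⟩
    have := huv.2
    rwa [add_comm u v, add_assoc, add_comm u x] at this
  intro u v u' v' hu hv huv hu' hv' huv'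
  have hi := key hu' hv' huv'
  obtain ⟨g, g1, g2, g3, g4⟩ := h x u v x u' v' (key hu hv huv) hi
  obtain ⟨k, k1, k2, k3, k4⟩ := hi.exists_correct hT hF g2 g3 g4
  refine ⟨k * g, fun y hy => ?_, ?_, ?_⟩
  · have h1 : ∀ y ∈ F, (k * g) • y = y := fun y hy => by rw [mul_smul, g1 y hy, k1 y hy]
    rcases mem_sup_span_one.1 hy with hy | hy
    · exact h1 y hy
    · have := h1 _ hy
      rw [smul_add, mul_smul k g x, k2] at this
      exact add_right_cancel this
  · rw [mul_smul, k3, add_self_two]; exact Submodule.zero_mem _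
  · rw [mul_smul, k4, add_self_two]; exact Submodule.zero_mem _

end Levels

section ExoticSpace

variable {G V : Type*} [Group G] [AddCommGroup V] [Module (ZMod 2) V] [DistribMulAction G V]

/-- A codimension two subspace attached to the pair `u, v` modulo `F`, as it comes from the
relation on the quotient by `F` when the pointwise stabilizer of `F` is transitive on pairs but not
on triples modulo `F`. -/
structure ExoticSpace (G : Type*) [Group G] [DistribMulAction G V] (F : Submodule (ZMod 2) V)
    (u v : V) (Y : Submodule (ZMod 2) V) : Prop where
  le : F ≤ Y
  left_mem : u ∈ Y
  right_mem : v ∈ Y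
  exists_mem : ∃ y ∈ Y, IndepMod F u v y
  exists_dual : ∀ w, ∃ ξ : Module.Dual (ZMod 2) V, ξ ≠ 0 ∧ (∀ x ∈ Y, ξ x = 0) ∧ ξ w = 0
  dual_unique : ∀ w, w ∉ Y → ∀ ξ η : Module.Dual (ZMod 2) V, ξ ≠ 0 → η ≠ 0 → (∀ x ∈ Y, ξ x = 0) →
    (∀ x ∈ Y, η x = 0) → ξ w = 0 → η w = 0 → ξ = η
  smul_mem : ∀ g : G, (∀ x ∈ F, g • x = x) → g • u + u ∈ F → g • v + v ∈ F → ∀ x ∈ Y, g • x ∈ Y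
  trans : ∀ w w', w ∉ Y → w' ∉ Y →
    ∃ g : G, (∀ x ∈ F, g • x = x) ∧ g • u + u ∈ F ∧ g • v + v ∈ F ∧ g • w + w' ∈ F
  rigid : ∀ g : G, (∀ x ∈ F, g • x = x) → g • u + u ∈ F → g • v + v ∈ F →
    ∀ ξ : Module.Dual (ZMod 2) V, (∀ x ∈ Y, ξ x = 0) → ξ ≠ 0 → (∀ x, ξ (g • x) = ξ x) →
      ∀ η : Module.Dual (ZMod 2) V, (∀ x ∈ Y, η x = 0) → ∀ x, η (g • x) = η x
  trans_left : ∀ ξ : Module.Dual (ZMod 2) V, (∀ x ∈ Y, ξ x = 0) → ∀ w w', ξ w = 1 → ξ w' = 1 →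
    ∃ g : G, (∀ x ∈ F, g • x = x) ∧ g • u + u ∈ F ∧ (g • v + v ∈ F ∨ g • v + (v + u) ∈ F) ∧
      (∀ x, ξ (g • x) = ξ x) ∧ g • w + w' ∈ F

variable [Finite G] [Finite V]

theorem BalancedData.exoticSpace {F : Submodule (ZMod 2) V} {N : ℕ} {T T'}
    (b : BalancedData (fixingSubgroup G (F : Set V))
      (evalPairing (fixingSubgroup G (F : Set V)) (V ⧸ F)) N T T' 2) {u v : V} (hu : u ∉ F)
    (hv : v ∉ F) (huv : u + v ∉ F) : ∃ Y, ExoticSpace G F u v Y := by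
  have hmk : ∀ x : V, x ∉ F → (Submodule.Quotient.mk x : V ⧸ F) ≠ 0 := fun x hx => by
    rwa [Ne, Submodule.Quotient.mk_eq_zero]
  have hu' := hmk u hu
  have hv' := hmk v hv
  have huv' : (Submodule.Quotient.mk u : V ⧸ F) ≠ Submodule.Quotient.mk v := by
    rwa [Ne, mk_eq_mk]
  let x : V ⧸ F := Submodule.Quotient.mk u
  let y : V ⧸ F := Submodule.Quotient.mk v
  let p := evalPairing (fixingSubgroup G (F : Set V)) (V ⧸ F)
  let Y := (relY p T x y).comap F.mkQ
  have hmem : ∀ w : V, w ∈ Y ↔ (Submodule.Quotient.mk w : V ⧸ F) ∈ relY p T x y := fun w => Iff.rfl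
  have hle : F ≤ Y := fun z hz => by
    rw [hmem, (Submodule.Quotient.mk_eq_zero F).2 hz]; exact Submodule.zero_mem _
  have hfix : ∀ g : G, (∀ x ∈ F, g • x = x) → g ∈ fixingSubgroup G (F : Set V) :=
    fun g hg => (mem_fixingSubgroup_iff G).2 hg
  have hfix' : ∀ g : fixingSubgroup G (F : Set V), ∀ x ∈ F, (g : G) • x = x :=
    fun g => (mem_fixingSubgroup_iff G).1 g.2
  have hdual : ∀ ξ : Module.Dual (ZMod 2) V, ∀ h : (∀ x ∈ Y, ξ x = 0),
      quotDual G (fun z hz => h z (hle hz)) ∈ relN T x y := by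
    intro ξ h
    rw [← b.left.perp_relY]
    intro w hw
    induction w using Submodule.Quotient.induction_on with | _ w => ?_
    exact h w hw
  have hne : ∀ ξ : Module.Dual (ZMod 2) V, ξ ≠ 0 → ∃ w, ξ w = 1 := by
    intro ξ hξ
    by_contra hc
    push Not at hc
    exact hξ (LinearMap.ext fun w => zmod_two_ne_one.1 (hc w))
  have hsm : ∀ g : fixingSubgroup G (F : Set V), (g : G) • u + u ∈ F → (g : G) • v + v ∈ F →
      g • x = x ∧ g • y = y := fun g h1 h2 => ⟨mk_eq_mk.2 h1, mk_eq_mk.2 h2⟩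
  refine ⟨Y, hle, left_mem_relY b.left.rel x y, right_mem_relY b.left.rel x y, ?_, ?_, ?_, ?_, ?_,
    ?_, ?_⟩
  · obtain ⟨w, h1, h2⟩ := exists_mem_notMem (A := Submodule.span (ZMod 2) {x, y})
      (B := relY p T x y) (by
        rw [card_span_two hu' hv' huv', (b.left.cardY_sub hu' hv' huv').2]
        have := b.lt
        calc 4 = 2 ^ 2 := rfl
          _ < _ := Nat.pow_lt_pow_right (by norm_num) (by omega))
    induction w using Submodule.Quotient.induction_on with | _ w => ?_
    rw [mk_mem_span_two] at h2
    push Not at h2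
    exact ⟨w, h1, hu, hv, huv, h2⟩
  · intro w
    have h1 := b.left.cardN x y hu' hv' huv'
    let f : relN T x y →ₗ[ZMod 2] ZMod 2 :=
      (p (Submodule.Quotient.mk w)).domRestrict (relN T x y)
    have h2 := card_range_mul_card_ker f
    have h3 : Nat.card (LinearMap.range f) ≤ 2 := by
      have := Nat.card_le_card_of_injective (Subtype.val : LinearMap.range f → ZMod 2)
        Subtype.val_injective
      rwa [Nat.card_zmod] at this
    obtain ⟨ξ, h4, h5⟩ := exists_mem_notMem (A := ⊥) (B := LinearMap.ker f) (by
      rw [Nat.card_unique]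
      rw [h1] at h2
      by_contra hc
      have : Nat.card (LinearMap.ker f) ≤ 1 := by omega
      nlinarith)
    let ξ' : Module.Dual (ZMod 2) (V ⧸ F) := ξ.1
    refine ⟨ξ' ∘ₗ F.mkQ, ?_, ?_, h4⟩
    · intro h0
      refine h5 ((Submodule.mem_bot _).2 (Subtype.ext (LinearMap.ext fun z => ?_)))
      induction z using Submodule.Quotient.induction_on with | _ z => ?_
      exact LinearMap.congr_fun h0 z
    · intro z hz
      have h6 : ξ.1 ∈ perpS p (relY p T x y : Set (V ⧸ F)) := by
        rw [b.left.perp_relY]; exact ξ.2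
      exact h6 _ hz
  · intro w hw ξ η hξ0 hη0 hξ hη hξw hηw
    by_contra hξη
    obtain ⟨a, ha⟩ := hne ξ hξ0
    obtain ⟨c, hc⟩ := hne η hη0
    have h1 : Submodule.span (ZMod 2) {quotDual G (fun z hz => hξ z (hle hz)),
        quotDual G (fun z hz => hη z (hle hz))} = relN T x y := by
      refine submodule_eq_of_card ?_ ?_
      · rw [Submodule.span_le]
        rintro _ (rfl | rfl)
        exacts [hdual ξ hξ, hdual η hη]
      · rw [b.left.cardN x y hu' hv' huv', card_span_two (quotDual_ne_zero _ ha)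
          (quotDual_ne_zero _ hc) fun h => hξη (LinearMap.ext fun z =>
            LinearMap.congr_fun h (Submodule.Quotient.mk z))]
        norm_num
    obtain ⟨ζ, hT, hζ⟩ := notMem_relY.1 hw
    have h2 : ζ ∈ relN T x y := Submodule.subset_span hT
    rw [← h1, mem_span_two] at h2
    rcases h2 with rfl | rfl | rfl | rfl
    · rw [map_zero] at hζ; exact zero_ne_one hζ
    · exact zero_ne_one (hξw.symm.trans hζ)
    · exact zero_ne_one (hηw.symm.trans hζ)
    · rw [map_add] at hζ
      have h3 : ξ w + η w = 1 := hζ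
      rw [hξw, hηw, add_zero] at h3
      exact zero_ne_one h3
  · intro g hg h1 h2 z hz
    obtain ⟨h3, h4⟩ := hsm ⟨g, hfix g hg⟩ h1 h2
    have := (smul_mem_relY b.left.rel b.left.two (⟨g, hfix g hg⟩ : fixingSubgroup G (F : Set V))
      (x := x) (y := y) (w := Submodule.Quotient.mk z)).2 hz
    rwa [h3, h4] at this
  · intro w w' hw hw'
    obtain ⟨g, h1, h2, h3⟩ := b.left.trans (x := x) (y := y) (x' := x) (y' := y) hw hw'
    exact ⟨g, hfix' g, mk_eq_mk.1 h1, mk_eq_mk.1 h2, mk_eq_mk.1 h3⟩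
  · intro g hg h1 h2 ξ hξ hξ0 hgξ η hη
    obtain ⟨h3, h4⟩ := hsm ⟨g, hfix g hg⟩ h1 h2
    obtain ⟨w, hw⟩ := hne ξ hξ0
    have hT := ((mem_relN b.left.two b.left.rel).1 (hdual ξ hξ)).resolve_left
      (quotDual_ne_zero _ hw)
    exact (smul_quotDual_iff _ _ _).1 (b.smul_eq_of_mem_relN hT h3 h4
      ((smul_quotDual_iff _ _ ⟨g, hfix g hg⟩).2 hgξ) (hdual η hη))
  · intro ξ hξ w w' hw hw'
    have hT := ((mem_relN b.left.two b.left.rel).1 (hdual ξ hξ)).resolve_left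
      (quotDual_ne_zero _ hw)
    obtain ⟨g, ⟨h1, h2⟩, h3, h4⟩ := b.left.rel.trans_left x y _ hT (Submodule.Quotient.mk w)
      (Submodule.Quotient.mk w') hw hw'
    exact ⟨g, hfix' g, mk_eq_mk.1 h1, h2.imp (fun h => mk_eq_mk.1 h) (fun h => mk_eq_mk.1 h),
      (smul_quotDual_iff _ _ g).1 h3, mk_eq_mk.1 h4⟩

theorem PairTransMod.tripleTransMod_or_exotic {F : Submodule (ZMod 2) V} (hF : PairTransMod G F)
    {N : ℕ} (hN : 3 ≤ N) (hc : Nat.card V = 2 ^ N * Nat.card F) :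
    TripleTransMod G F ∨ ∀ u v, u ∉ F → v ∉ F → u + v ∉ F → ∃ Y, ExoticSpace G F u v Y := by
  have hcard : Nat.card (V ⧸ F) = 2 ^ N := by
    have h1 := card_quotient_mul F
    rw [hc] at h1
    exact Nat.eq_of_mul_eq_mul_right Nat.card_pos h1
  rcases (hF.twoTrans hN hcard).tripleTrans_or_balanced with h | ⟨T, T', b⟩
  · left
    intro u v w u' v' w' ⟨h1, h2, h3, h4⟩ ⟨h1', h2', h3', h4'⟩
    obtain ⟨g, g1, g2, g3⟩ := h (Submodule.Quotient.mk u) (Submodule.Quotient.mk v)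
      (Submodule.Quotient.mk w) (Submodule.Quotient.mk u') (Submodule.Quotient.mk v')
      (Submodule.Quotient.mk w') (by rwa [Ne, Submodule.Quotient.mk_eq_zero])
      (by rwa [Ne, Submodule.Quotient.mk_eq_zero]) (by rwa [Ne, mk_eq_mk])
      (by rw [mk_mem_span_two]; tauto) (by rwa [Ne, Submodule.Quotient.mk_eq_zero])
      (by rwa [Ne, Submodule.Quotient.mk_eq_zero]) (by rwa [Ne, mk_eq_mk])
      (by rw [mk_mem_span_two]; tauto)
    exact ⟨g, (mem_fixingSubgroup_iff G).1 g.2, mk_eq_mk.1 g1, mk_eq_mk.1 g2, mk_eq_mk.1 g3⟩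
  · exact Or.inr fun u v hu hv huv => b.exoticSpace hu hv huv

end ExoticSpace

namespace ExoticSpace

variable {G V : Type*} [Group G] [AddCommGroup V] [Module (ZMod 2) V] [DistribMulAction G V]
  [Finite G] [Finite V] {F : Submodule (ZMod 2) V} {u v : V} {Y : Submodule (ZMod 2) V} {j : ℕ}

theorem indepMod (e : ExoticSpace G F u v Y) {w : V} (hw : w ∉ Y) : IndepMod F u v w := by
  obtain ⟨y, -, h1, h2, h3, -⟩ := e.exists_mem
  refine ⟨h1, h2, h3, fun h => hw (e.le h), fun h => hw ?_, fun h => hw ?_, fun h => hw ?_⟩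
  · exact (Submodule.add_mem_iff_left Y e.left_mem).1 (e.le h)
  · exact (Submodule.add_mem_iff_left Y e.right_mem).1 (e.le h)
  · exact (Submodule.add_mem_iff_left Y (Y.add_mem e.left_mem e.right_mem)).1 (e.le h)

theorem trans_fix (e : ExoticSpace G F u v Y)
    (hT : ∀ E : Submodule (ZMod 2) V, Nat.card E = 2 ^ (j + 2) → TranslationProp G E)
    (hF : Nat.card F = 2 ^ j) {w w' : V} (hw : w ∉ Y) (hw' : w' ∉ Y) :
    ∃ g : G, (∀ x ∈ F, g • x = x) ∧ g • u = u ∧ g • v = v ∧ g • w = w' := by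
  obtain ⟨g, g1, g2, g3, g4⟩ := e.trans w w' hw hw'
  obtain ⟨k, k1, k2, k3, k4⟩ := (e.indepMod hw').exists_correct hT hF g2 g3 g4
  exact ⟨k * g, fun x hx => by rw [mul_smul, g1 x hx, k1 x hx], by rw [mul_smul, k2],
    by rw [mul_smul, k3], by rw [mul_smul, k4]⟩

theorem exists_notMem (e : ExoticSpace G F u v Y) : ∃ w, w ∉ Y := by
  obtain ⟨ξ, h1, h2, -⟩ := e.exists_dual 0
  by_contra hc
  push Not at hc
  exact h1 (LinearMap.ext fun x => h2 x (hc x))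

theorem le_of_fix (e : ExoticSpace G F u v Y)
    (hT : ∀ E : Submodule (ZMod 2) V, Nat.card E = 2 ^ (j + 2) → TranslationProp G E)
    (hF : Nat.card F = 2 ^ j) {F₁ : Submodule (ZMod 2) V} {u₁ v₁ : V} {Y₁ : Submodule (ZMod 2) V}
    (e₁ : ExoticSpace G F₁ u₁ v₁ Y₁) (hle : F₁ ⊔ Submodule.span (ZMod 2) {u₁} ⊔
      Submodule.span (ZMod 2) {v₁} ≤ F ⊔ Submodule.span (ZMod 2) {u} ⊔
      Submodule.span (ZMod 2) {v}) : Y₁ ≤ Y := by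
  obtain ⟨w, hw, hw₁⟩ : ∃ w, w ∉ Y ∧ w ∉ Y₁ := by
    obtain ⟨a, ha⟩ := e.exists_notMem
    obtain ⟨b, hb⟩ := e₁.exists_notMem
    by_cases h1 : a ∈ Y₁
    · by_cases h2 : b ∈ Y
      · exact ⟨a + b, fun h => ha ((Submodule.add_mem_iff_left Y h2).1 h),
          fun h => hb ((Submodule.add_mem_iff_right Y₁ h1).1 h)⟩
      · exact ⟨b, h2, hb⟩
    · exact ⟨a, ha, h1⟩
  intro z hz
  by_contra hzY
  obtain ⟨g, g1, g2, g3, rfl⟩ := e.trans_fix hT hF hzY hw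
  have hfix : ∀ x ∈ F ⊔ Submodule.span (ZMod 2) {u} ⊔ Submodule.span (ZMod 2) {v}, g • x = x := by
    have h1 : ∀ x ∈ F ⊔ Submodule.span (ZMod 2) {u}, g • x = x := by
      intro x hx
      rcases mem_sup_span_one.1 hx with hx | hx
      · exact g1 x hx
      · have := g1 _ hx
        rw [smul_add, g2] at this
        exact add_right_cancel this
    intro x hx
    rcases mem_sup_span_one.1 hx with hx | hx
    · exact h1 x hx
    · have := h1 _ hx
      rw [smul_add, g3] at this
      exact add_right_cancel this
  have hF₁ := fun x (hx : x ∈ F₁) => hfix x 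
    (hle (Submodule.mem_sup_left (Submodule.mem_sup_left hx)))
  have hu₁ : g • u₁ = u₁ := hfix _ (hle (Submodule.mem_sup_left
    (Submodule.mem_sup_right (Submodule.mem_span_singleton_self u₁))))
  have hv₁ : g • v₁ = v₁ := hfix _ (hle (Submodule.mem_sup_right
    (Submodule.mem_span_singleton_self v₁)))
  exact hw₁ (e₁.smul_mem g hF₁ (by rw [hu₁, add_self_two]; exact F₁.zero_mem)
    (by rw [hv₁, add_self_two]; exact F₁.zero_mem) z hz)

theorem exists_ker_notMem (e : ExoticSpace G F u v Y) {ξ : Module.Dual (ZMod 2) V} {w : V}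
    (hw : ξ w = 1) : ∃ t, ξ t = 0 ∧ t ∉ Y := by
  obtain ⟨η, h1, h2, h3⟩ := e.exists_dual w
  obtain ⟨z, hz⟩ : ∃ z, η z = 1 := by
    by_contra hc
    push Not at hc
    exact h1 (LinearMap.ext fun x => zmod_two_ne_one.1 (hc x))
  rcases zmod_two_cases (ξ z) with h | h
  · exact ⟨z, h, fun hzY => zero_ne_one ((h2 z hzY).symm.trans hz)⟩
  · refine ⟨z + w, by rw [map_add, h, hw, add_self_two], fun hzY => ?_⟩
    have := h2 _ hzY
    rw [map_add, hz, h3, add_zero] at this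
    exact one_ne_zero this

/-- There is an element fixing the span of `F` and `u` pointwise, preserving a nonzero
functional vanishing on `Y` but acting nontrivially on all of these functionals. -/
theorem exists_fix_ne (e : ExoticSpace G F u v Y)
    (hT : ∀ E : Submodule (ZMod 2) V, Nat.card E = 2 ^ (j + 2) → TranslationProp G E)
    (hF : Nat.card F = 2 ^ j) : ∃ g : G, ∃ ξ : Module.Dual (ZMod 2) V, ∃ w,
      (∀ x ∈ F ⊔ Submodule.span (ZMod 2) {u}, g • x = x) ∧
      g • v + v ∈ F ⊔ Submodule.span (ZMod 2) {u} ∧ ξ ≠ 0 ∧ (∀ x ∈ Y, ξ x = 0) ∧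
      (∀ x, ξ (g • x) = ξ x) ∧ g • w + w ∉ Y := by
  obtain ⟨ξ, hξ0, hξ, -⟩ := e.exists_dual 0
  obtain ⟨w, hw⟩ : ∃ w, ξ w = 1 := by
    by_contra hc
    push Not at hc
    exact hξ0 (LinearMap.ext fun x => zmod_two_ne_one.1 (hc x))
  obtain ⟨t, ht, htY⟩ := e.exists_ker_notMem hw
  obtain ⟨g, g1, g2, g3, g4, g5⟩ := e.trans_left ξ hξ w (w + t) hw
    (by rw [map_add, hw, ht, add_zero])
  have hw' : g • w ∉ Y := fun h => by
    have := hξ _ h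
    rw [g4, hw] at this
    exact one_ne_zero this
  obtain ⟨q, q1, q2, q3, q4⟩ := (e.indepMod hw').rotate.exists_shift hT hF g2
  have hgu : u + (g • u + u) = g • u := by rw [add_comm, add_add_cancel_two]
  rw [hgu] at q4
  have hqu : q • u + u ∈ F := by
    have h1 : q • (g • u + u) = g • u + u := q1 _ g2
    rw [smul_add, q4] at h1
    rw [add_comm, h1]
    exact g2
  have hqv : q • v + v ∈ F := by rw [q2, add_self_two]; exact F.zero_mem
  obtain ⟨η, η1, η2, η3⟩ := e.exists_dual (g • w)
  have hη : η ∘ₗ smulLinear q = η := by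
    refine e.dual_unique _ hw' _ _ ?_ η1 (fun x hx => η2 _ (e.smul_mem q q1 hqu hqv x hx)) η2 ?_ η3
    · intro h
      refine η1 (LinearMap.ext fun x => ?_)
      have h1 : η (q • q⁻¹ • x) = 0 := LinearMap.congr_fun h (q⁻¹ • x)
      rwa [smul_inv_smul] at h1
    · change η (q • g • w) = 0
      rw [q3, η3]
  have hqξ := e.rigid q q1 hqu hqv η η2 η1 (fun x => LinearMap.congr_fun hη x) ξ hξ
  have hfix : ∀ x ∈ F, (q * g) • x = x := fun x hx => by rw [mul_smul, g1 x hx, q1 x hx]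
  refine ⟨q * g, ξ, w, fun x hx => ?_, ?_, hξ0, hξ, fun x => by rw [mul_smul, hqξ, g4], fun h => ?_⟩
  · rcases mem_sup_span_one.1 hx with hx | hx
    · exact hfix x hx
    · have := hfix _ hx
      rw [smul_add, mul_smul q g u, q4] at this
      exact add_right_cancel this
  · rw [mem_sup_span_one, mul_smul]
    rcases g3 with h | h
    · left
      have h1 := q1 _ h
      rw [smul_add, q2] at h1
      rwa [h1]
    · right
      have h1 := q1 _ h
      rw [smul_add, smul_add, q2] at h1
      have h2 : q • g • v + v + u = (q • g • v + (v + q • u)) + (q • u + u) := by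
        rw [add_assoc, add_assoc, add_assoc, add_add_cancel_left_two]
      rw [h2, h1]
      exact F.add_mem h hqu
  · rw [mul_smul, q3] at h
    have h1 : t = (g • w + w) + (g • w + (w + t)) := by
      rw [← add_assoc (g • w), add_add_cancel_left_two]
    exact htY (h1 ▸ Y.add_mem h (e.le g5))

theorem false_of_pos (e : ExoticSpace G F u v Y)
    (hT : ∀ E : Submodule (ZMod 2) V, Nat.card E = 2 ^ (j + 2) → TranslationProp G E)
    (hF : Nat.card F = 2 ^ j) (hj : 1 ≤ j) {N : ℕ} (hN : 3 ≤ N) (hV : Nat.card V = 2 ^ N * 2 ^ j)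
    (hP : ∀ F' : Submodule (ZMod 2) V, Nat.card F' = 2 ^ j → PairTransMod G F') : False := by
  obtain ⟨g, ξ, w, g1, g2, g3, g4, g5, g6⟩ := e.exists_fix_ne hT hF
  obtain ⟨y, hyY, hy⟩ := e.exists_mem
  obtain ⟨huF, hvF, huv, -⟩ := id hy
  set D := F ⊔ Submodule.span (ZMod 2) {u} with hD
  have hDc : Nat.card D = 2 ^ (j + 1) := by rw [card_sup_span_one huF, hF, pow_succ']
  have hvD : v ∉ D := by
    rw [hD, mem_sup_span_one, not_or, add_comm v]; exact ⟨hvF, huv⟩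
  obtain ⟨F₁, h1, h2, h3⟩ := exists_submodule_card (A := Submodule.span (ZMod 2) {g • v + v})
    (B := D) (j := j) (by rwa [Submodule.span_singleton_le_iff_mem]) (by
      by_cases h0 : g • v + v = 0
      · rw [h0, Submodule.span_zero_singleton, Nat.card_unique]
        exact Nat.one_le_two_pow
      · rw [card_span_one h0]
        exact Nat.le_self_pow (by omega) 2)
    (by rw [hDc]; exact Nat.pow_le_pow_right two_pos j.le_succ)
  obtain ⟨u₁, hu₁D, hu₁⟩ := exists_mem_notMem (A := F₁) (B := D)
    (by rw [h3, hDc]; exact Nat.pow_lt_pow_right one_lt_two j.lt_succ_self)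
  have hDD : F₁ ⊔ Submodule.span (ZMod 2) {u₁} = D := by
    refine submodule_eq_of_card (sup_le h2 (by rwa [Submodule.span_singleton_le_iff_mem])) ?_
    rw [card_sup_span_one hu₁, h3, hDc, pow_succ']
  have hv₁ : v ∉ F₁ := fun h => hvD (h2 h)
  have huv₁ : u₁ + v ∉ F₁ := fun h => hvD ((Submodule.add_mem_iff_right D hu₁D).1 (h2 h))
  have hind : ∀ z, IndepMod F u v z ↔ IndepMod F₁ u₁ v z := by
    intro z
    rw [indepMod_iff, indepMod_iff, hDD]
    tauto
  rcases (hP F₁ h3).tripleTransMod_or_exotic hN (by rw [hV, h3]) with h | h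
  · obtain ⟨z, hz⟩ := e.exists_notMem
    have hz₁ := (hind z).1 (e.indepMod hz)
    obtain ⟨k, k1, k2, k3, k4⟩ := h u₁ v y u₁ v z ((hind y).1 hy) hz₁
    obtain ⟨l, l1, l2, l3, l4⟩ := hz₁.exists_correct hT h3 k2 k3 k4
    have hfix : ∀ x ∈ D, (l * k) • x = x := by
      have hfix₁ : ∀ x ∈ F₁, (l * k) • x = x := fun x hx => by rw [mul_smul, k1 x hx, l1 x hx]
      intro x hx
      rw [← hDD] at hx
      rcases mem_sup_span_one.1 hx with hx | hx
      · exact hfix₁ x hx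
      · have := hfix₁ _ hx
        rw [smul_add, mul_smul l k u₁, l2] at this
        exact add_right_cancel this
    refine hz ?_
    rw [← l4, ← mul_smul]
    refine e.smul_mem _ (fun x hx => hfix x (le_sup_left (a := F) hx)) ?_ ?_ y hyY
    · rw [hfix u (le_sup_right (a := F) (Submodule.mem_span_singleton_self u)), add_self_two]
      exact F.zero_mem
    · rw [mul_smul, l3, add_self_two]
      exact F.zero_mem
  · obtain ⟨Y₁, e₁⟩ := h u₁ v hu₁ hv₁ huv₁
    obtain rfl : Y₁ = Y := le_antisymm (e.le_of_fix hT hF e₁ (by rw [hDD]))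
      (e₁.le_of_fix hT h3 e (by rw [hDD]))
    obtain ⟨η, η1, η2⟩ := exists_dual_eq_one g6
    have h4 := e₁.rigid g (fun x hx => g1 x (h2 hx))
      (by rw [g1 u₁ hu₁D, add_self_two]; exact F₁.zero_mem)
      (h1 (Submodule.mem_span_singleton_self _)) ξ g4 g3 g5 η η1 w
    rw [map_add, h4, add_self_two] at η2
    exact zero_ne_one η2

end ExoticSpace

section LevelInduction

variable {G V : Type*} [Group G] [AddCommGroup V] [Module (ZMod 2) V] [DistribMulAction G V]
  [Finite G] [Finite V]

theorem eq_bot_of_card_eq_one {F : Submodule (ZMod 2) V} (hF : Nat.card F = 2 ^ 0) : F = ⊥ := by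
  refine (submodule_eq_of_card bot_le ?_).symm
  rw [hF, Nat.card_unique, pow_zero]

theorem PairTransMod.tripleTransMod {n j : ℕ} (hn : Nat.card V = 2 ^ n) (hjn : j + 3 ≤ n)
    (hT : ∀ E : Submodule (ZMod 2) V, Nat.card E = 2 ^ (j + 2) → TranslationProp G E)
    (hP : ∀ F : Submodule (ZMod 2) V, Nat.card F = 2 ^ j → PairTransMod G F) (hj : 1 ≤ j)
    {F : Submodule (ZMod 2) V} (hF : Nat.card F = 2 ^ j) : TripleTransMod G F := by
  have hV : Nat.card V = 2 ^ (n - j) * 2 ^ j := by rw [hn, ← pow_add]; congr 1; omega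
  refine ((hP F hF).tripleTransMod_or_exotic (N := n - j) (by omega) (by rw [hV, hF])).resolve_right
    fun h => ?_
  have htop : Nat.card (⊤ : Submodule (ZMod 2) V) = 2 ^ n := by
    rw [← hn]; exact Nat.card_congr Submodule.topEquiv.toEquiv
  obtain ⟨u, -, hu⟩ := exists_mem_notMem (A := F) (B := ⊤)
    (by rw [hF, htop]; exact Nat.pow_lt_pow_right one_lt_two (by omega))
  obtain ⟨v, -, hv⟩ := exists_mem_notMem (A := F ⊔ Submodule.span (ZMod 2) {u}) (B := ⊤)
    (by rw [card_sup_span_one hu, hF, htop, ← pow_succ']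
        exact Nat.pow_lt_pow_right one_lt_two (by omega))
  rw [mem_sup_span_one, not_or, add_comm v] at hv
  obtain ⟨Y, e⟩ := h u v hu hv.1 hv.2
  exact e.false_of_pos hT hF hj (N := n - j) (by omega) hV hP

theorem exists_smul_eq_of_tripleTransMod [FaithfulSMul G V] {n : ℕ} (hn : Nat.card V = 2 ^ n)
    (hodd : Odd n) (hn3 : 3 ≤ n) (hP : PairTransMod G (⊥ : Submodule (ZMod 2) V))
    (hT : TripleTransMod G (⊥ : Submodule (ZMod 2) V)) (φ : V ≃ₗ[ZMod 2] V) :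
    ∃ g : G, ∀ x, g • x = φ x := by
  have key : ∀ j, j + 2 ≤ n → ∀ F : Submodule (ZMod 2) V, Nat.card F = 2 ^ j →
      PairTransMod G F ∧ AntiflagTransMod G F ∧ LinearTransOn G F := by
    intro j
    induction j with
    | zero =>
      intro _ F hF
      obtain rfl := eq_bot_of_card_eq_one hF
      refine ⟨hP, antiflagTransMod_bot hP hn3 hn, fun φ => ⟨1, fun x hx => ?_⟩⟩
      rw [(Submodule.mem_bot _).1 hx, smul_zero, map_zero]
    | succ j ih =>
      intro hj
      replace ih := ih (by omega)
      have hP := fun F hF => (ih F hF).1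
      have hA := fun F hF => (ih F hF).2.1
      have hL := fun F hF => (ih F hF).2.2
      have hflag : ∀ F : Submodule (ZMod 2) V, Nat.card F = 2 ^ j → FlagTransMod G F :=
        fun F hF => (hP F hF).flagTransMod (N := n - j) (by omega) (by
          rw [hn, hF, ← pow_add]; congr 1; omega)
      have hA' : ∀ D : Submodule (ZMod 2) V, Nat.card D = 2 ^ (j + 1) → AntiflagTransMod G D :=
        fun D hD => antiflagTransMod_succ hn hodd (by omega) hA hflag hL hD
      have hT' : ∀ E : Submodule (ZMod 2) V, Nat.card E = 2 ^ (j + 2) → TranslationProp G E :=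
        fun E hE => translationProp_of_antiflag hA' hE
      intro D hD
      refine ⟨?_, hA' D hD, linearTransOn_succ hA hL hD⟩
      obtain ⟨F, x, hF, hx, rfl⟩ := exists_sup_span_one hD
      refine TripleTransMod.pairTransMod_succ ?_ hT' hF hx
      rcases Nat.eq_zero_or_pos j with rfl | hj0
      · obtain rfl := eq_bot_of_card_eq_one hF
        exact hT
      · exact PairTransMod.tripleTransMod hn (by omega) hT' hP hj0 hF
  obtain ⟨j, rfl⟩ := Nat.exists_eq_add_of_le (show 2 ≤ n by omega)
  rw [add_comm] at hn hodd hn3 key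
  replace key := key j le_rfl
  have hP := fun F hF => (key F hF).1
  have hA := fun F hF => (key F hF).2.1
  have hL := fun F hF => (key F hF).2.2
  have hA' : ∀ D : Submodule (ZMod 2) V, Nat.card D = 2 ^ (j + 1) → AntiflagTransMod G D :=
    fun D hD => antiflagTransMod_succ hn hodd le_rfl hA
      (fun F hF => (hP F hF).flagTransMod (N := 2) le_rfl (by rw [hn, hF]; ring)) hL hD
  have htop : Nat.card (⊤ : Submodule (ZMod 2) V) = 2 ^ (j + 1 + 1) := by
    rw [← hn]; exact Nat.card_congr Submodule.topEquiv.toEquiv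
  obtain ⟨g, hg⟩ := linearTransOn_succ hA' (fun D hD => linearTransOn_succ hA hL hD) htop φ
  exact ⟨g, fun x => hg x trivial⟩

end LevelInduction

section QuadraticFunctions

variable {V : Type*} [AddCommGroup V] [Module (ZMod 2) V]

/-- The space of functions spanned by the products of two linear functionals. -/
def quadFun (V : Type*) [AddCommGroup V] [Module (ZMod 2) V] : Submodule (ZMod 2) (V → ZMod 2) :=
  Submodule.span (ZMod 2) {f | ∃ ξ η : Module.Dual (ZMod 2) V, f = fun x => ξ x * η x}

theorem mul_mem_quadFun (ξ η : Module.Dual (ZMod 2) V) : (fun x => ξ x * η x) ∈ quadFun V :=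
  Submodule.subset_span ⟨ξ, η, rfl⟩

theorem dual_mem_quadFun (ξ : Module.Dual (ZMod 2) V) : (fun x => ξ x) ∈ quadFun V := by
  convert mul_mem_quadFun ξ ξ using 2 with x
  rcases zmod_two_cases (ξ x) with h | h <;> rw [h] <;> rfl

theorem comp_mem_quadFun {f : V → ZMod 2} (hf : f ∈ quadFun V) (A : V →ₗ[ZMod 2] V) :
    (fun x => f (A x)) ∈ quadFun V := by
  induction hf using Submodule.span_induction with
  | mem f hf =>
    obtain ⟨ξ, η, rfl⟩ := hf
    exact mul_mem_quadFun (ξ ∘ₗ A) (η ∘ₗ A)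
  | zero => exact Submodule.zero_mem _
  | add f g _ _ hf hg => exact Submodule.add_mem _ hf hg
  | smul c f _ hf => exact Submodule.smul_mem _ c hf

variable [Fintype V]

theorem sum_prod_dual_eq_zero {n k : ℕ} (hn : Nat.card V = 2 ^ n) (hk : k < n)
    (ξ : Fin k → Module.Dual (ZMod 2) V) : ∑ x, ∏ i, ξ i x = 0 := by
  have hrank : Module.finrank (ZMod 2) V = n := by
    have := Module.natCard_eq_pow_finrank (K := ZMod 2) (V := V)
    rw [hn, Nat.card_zmod] at this
    exact (Nat.pow_right_injective le_rfl this).symm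
  obtain ⟨e, he, he0⟩ : ∃ e ∈ LinearMap.ker (LinearMap.pi ξ), e ≠ 0 := by
    refine (Submodule.ne_bot_iff _).1 (LinearMap.ker_ne_bot_of_finrank_lt ?_)
    rwa [hrank, Module.finrank_fin_fun]
  have hξ : ∀ i, ξ i e = 0 := fun i => congrFun he i
  refine Finset.sum_involution (fun x _ => x + e) ?_ ?_ (fun _ _ => Finset.mem_univ _) ?_
  · intro x _
    simp only [map_add, hξ, add_zero]
    exact add_self_two _
  · intro x _ _ h
    exact he0 (by simpa using h)
  · intro x _
    exact add_add_cancel_two x e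

theorem sum_mul_quadFun_eq_zero {n : ℕ} (hn : Nat.card V = 2 ^ n) (h7 : 7 ≤ n)
    {f g h : V → ZMod 2} (hf : f ∈ quadFun V) (hg : g ∈ quadFun V) (hh : h ∈ quadFun V) :
    ∑ x, f x * g x * h x = 0 := by
  induction hf using Submodule.span_induction with
  | zero => simp
  | add f f' _ _ hf hf' => simp only [Pi.add_apply, add_mul, Finset.sum_add_distrib, hf, hf', add_zero]
  | smul c f _ hf => simp only [Pi.smul_apply, smul_mul_assoc, ← Finset.smul_sum, hf, smul_zero]
  | mem f hf =>
    obtain ⟨ξ₁, η₁, rfl⟩ := hf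
    induction hg using Submodule.span_induction with
    | zero => simp
    | add f f' _ _ hf hf' =>
      simp only [Pi.add_apply, add_mul, mul_add, Finset.sum_add_distrib, hf, hf', add_zero]
    | smul c f _ hf =>
      simp only [Pi.smul_apply, smul_mul_assoc, mul_smul_comm, ← Finset.smul_sum, hf, smul_zero]
    | mem g hg =>
      obtain ⟨ξ₂, η₂, rfl⟩ := hg
      induction hh using Submodule.span_induction with
      | zero => simp
      | add f f' _ _ hf hf' => simp only [Pi.add_apply, mul_add, Finset.sum_add_distrib, hf, hf', add_zero]
      | smul c f _ hf => simp only [Pi.smul_apply, mul_smul_comm, ← Finset.smul_sum, hf, smul_zero]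
      | mem h hh =>
        obtain ⟨ξ₃, η₃, rfl⟩ := hh
        rw [← sum_prod_dual_eq_zero hn (show 6 < n by omega) ![ξ₁, η₁, ξ₂, η₂, ξ₃, η₃]]
        refine Finset.sum_congr rfl fun x _ => ?_
        simp only [Fin.prod_univ_six]
        simp [mul_assoc]

theorem quadFun_exists_interpolation [DecidableEq V] : ∃ q : V → V → ZMod 2, (∀ a, q a ∈ quadFun V) ∧
    ∀ f ∈ quadFun V, ∀ x, f x = ∑ a, f a * q a x := by
  obtain ⟨π, hπ⟩ := (quadFun V).subtype.exists_leftInverse_of_injective (Submodule.ker_subtype _)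
  refine ⟨fun a => π (Pi.single a 1), fun a => (π _).2, fun f hf x => ?_⟩
  have h1 : (π f : V → ZMod 2) = f := congrArg Subtype.val (LinearMap.congr_fun hπ ⟨f, hf⟩)
  have h2 : f = ∑ a, f a • (Pi.single a 1 : V → ZMod 2) := by
    ext y
    simp [Finset.sum_apply, Pi.single_apply]
  conv_lhs => rw [← h1, h2, map_sum]
  simp [Finset.sum_apply]

/-- A function that is quadratic in each of its three variables sums to zero along the graph of a
pair of linear maps, when the dimension exceeds six. -/
theorem sum_triquadratic_eq_zero {n : ℕ} (hn : Nat.card V = 2 ^ n) (h7 : 7 ≤ n)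
    (F : V → V → V → ZMod 2) (h1 : ∀ y w, (fun x => F x y w) ∈ quadFun V)
    (h2 : ∀ x w, (fun y => F x y w) ∈ quadFun V) (h3 : ∀ x y, (fun w => F x y w) ∈ quadFun V)
    (A B : V →ₗ[ZMod 2] V) : ∑ x, F x (A x) (B x) = 0 := by
  classical
  obtain ⟨q, hq, hqf⟩ := quadFun_exists_interpolation (V := V)
  have hF : ∀ x y w, F x y w = ∑ c, ∑ b, ∑ a, F a b c * (q a x * q b y * q c w) := by
    intro x y w
    rw [hqf _ (h3 x y) w]
    refine Finset.sum_congr rfl fun c _ => ?_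
    rw [hqf _ (h2 x c) y, Finset.sum_mul]
    refine Finset.sum_congr rfl fun b _ => ?_
    rw [hqf _ (h1 b c) x, Finset.sum_mul, Finset.sum_mul]
    exact Finset.sum_congr rfl fun a _ => by ring
  rw [Finset.sum_congr rfl fun x _ => hF x (A x) (B x)]
  rw [Finset.sum_comm]
  refine Finset.sum_eq_zero fun c _ => ?_
  rw [Finset.sum_comm]
  refine Finset.sum_eq_zero fun b _ => ?_
  rw [Finset.sum_comm]
  refine Finset.sum_eq_zero fun a _ => ?_
  rw [← Finset.mul_sum, sum_mul_quadFun_eq_zero hn h7 (hq a) (comp_mem_quadFun (hq b) A)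
    (comp_mem_quadFun (hq c) B), mul_zero]

end QuadraticFunctions

section Regular

variable {Γ V V' : Type*} [Group Γ] [AddCommGroup V] [Module (ZMod 2) V]
    [AddCommGroup V'] [Module (ZMod 2) V'] [DistribMulAction Γ V] [DistribMulAction Γ V']
    {p : V →ₗ[ZMod 2] V' →ₗ[ZMod 2] ZMod 2} {N : ℕ} {T : V → V → V' → Prop}
    [Finite Γ] [Finite V] [Finite V'] {T' : V' → V' → V → Prop}

open Classical in
theorem BalancedData.indicator_mem_quadFun (b : BalancedData Γ p N T T' 2) (x y : V) :
    (fun w => if w ∈ relY p T x y then (0 : ZMod 2) else 1) ∈ quadFun V := by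
  by_cases h0 : ∃ w, w ∉ relY p T x y
  · obtain ⟨w, hw⟩ := h0
    obtain ⟨hx, hy, hxy⟩ := ne_of_notMem_relY b.left.rel hw
    have hc := b.left.cardN x y hx hy hxy
    obtain ⟨ξ, hξ, hξ0⟩ := exists_mem_notMem (A := ⊥) (B := relN T x y)
      (by rw [hc, Nat.card_unique]; norm_num)
    replace hξ0 : ξ ≠ 0 := by simpa using hξ0
    obtain ⟨η, hη, hηξ⟩ := exists_mem_notMem (A := Submodule.span (ZMod 2) {ξ}) (B := relN T x y)
      (by rw [hc, card_span_one hξ0]; norm_num)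
    rw [mem_span_one, not_or] at hηξ
    have hspan : Submodule.span (ZMod 2) {ξ, η} = relN T x y := by
      refine submodule_eq_of_card ?_ ?_
      · rw [Submodule.span_le]
        rintro _ (rfl | rfl)
        exacts [hξ, hη]
      · rw [hc, card_span_two hξ0 hηξ.1 (Ne.symm hηξ.2)]
        norm_num
    have hmem : ∀ w, w ∈ relY p T x y ↔ p w ξ = 0 ∧ p w η = 0 := by
      intro w
      constructor
      · intro hw
        have h1 : ∀ ζ ∈ relN T x y, p w ζ = 0 := by
          intro ζ hζ
          rw [← b.left.perp_relY] at hζ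
          exact hζ w hw
        exact ⟨h1 ξ hξ, h1 η hη⟩
      · rintro ⟨h1, h2⟩ ζ hζ
        have h3 : ζ ∈ relN T x y := Submodule.subset_span hζ
        rw [← hspan, mem_span_two] at h3
        change p w ζ = 0
        rcases h3 with rfl | rfl | rfl | rfl
        · exact map_zero _
        · exact h1
        · exact h2
        · rw [map_add, h1, h2, add_zero]
    convert (quadFun V).add_mem ((quadFun V).add_mem (dual_mem_quadFun (p.flip ξ))
      (dual_mem_quadFun (p.flip η))) (mul_mem_quadFun (p.flip ξ) (p.flip η)) using 1
    funext w
    simp only [hmem, Pi.add_apply, LinearMap.flip_apply]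
    generalize p w ξ = a
    generalize p w η = c
    rcases zmod_two_cases a with rfl | rfl <;> rcases zmod_two_cases c with rfl | rfl <;>
      simp only [and_self, and_true, and_false, one_ne_zero, if_true,
        if_false, add_zero, zero_add, mul_zero, mul_one]
    rfl
  · push Not at h0
    simp only [h0, if_true]
    exact Submodule.zero_mem _

theorem BalancedData.false_of_regular (b : BalancedData Γ p N T T' 2) (hN : 7 ≤ N) {g : Γ}
    (hg : ∀ v w : V, v ≠ 0 → w ≠ 0 → ∃ k : ℕ, g ^ k • v = w) : False := by
  classical
  have := Fintype.ofFinite V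
  let F : V → V → V → ZMod 2 := fun x y w => if w ∈ relY p T x y then 0 else 1
  have hswap : ∀ x y w, F x y w = F y x w := fun x y w => by
    simp only [F, mem_relY_swap b.left.two b.left.rel (x := x)]
  have hrot : ∀ x y w, F x y w = F x w y := fun x y w => by
    simp only [F, mem_relY_rotate b.left.two b.left.rel (y := y)]
  have h3 : ∀ x y, (fun w => F x y w) ∈ quadFun V := b.indicator_mem_quadFun
  have h2 : ∀ x w, (fun y => F x y w) ∈ quadFun V := fun x w => by
    simp only [hrot x _ w]; exact h3 x w
  have h1 : ∀ y w, (fun x => F x y w) ∈ quadFun V := fun y w => by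
    simp only [hswap _ y w]; exact h2 y w
  have hsmul : ∀ (k : Γ) x y w, F (k • x) (k • y) (k • w) = F x y w := fun k x y w => by
    simp only [F, smul_mem_relY b.left.rel b.left.two]
  have hzero : ∀ y w, F 0 y w = 0 := fun y w => by
    by_contra h
    have h4 : w ∉ relY p T 0 y := fun h4 => h (if_pos h4)
    exact (ne_of_notMem_relY b.left.rel h4).1 rfl
  have hcomm : ∀ (a k : ℕ) (x : V), g ^ a • g ^ k • x = g ^ k • g ^ a • x := fun a k x => by
    rw [smul_smul, smul_smul, ← pow_add, ← pow_add, add_comm]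
  have hall : ∀ (x : V) (i j : ℕ), F x (g ^ i • x) (g ^ j • x) = 0 := by
    intro x i j
    by_cases hx : x = 0
    · rw [hx, hzero]
    have hconst : ∀ v, v ≠ 0 → F v (g ^ i • v) (g ^ j • v) = F x (g ^ i • x) (g ^ j • x) := by
      intro v hv
      obtain ⟨k, rfl⟩ := hg x v hx hv
      rw [hcomm i k, hcomm j k, hsmul]
    have hsum := sum_triquadratic_eq_zero b.left.two.card hN F h1 h2 h3 (smulLinear (g ^ i))
      (smulLinear (g ^ j))
    change ∑ v, F v (g ^ i • v) (g ^ j • v) = 0 at hsum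
    rw [← Finset.add_sum_erase _ _ (Finset.mem_univ (0 : V)), hzero, zero_add,
      Finset.sum_congr rfl fun v hv => hconst v (Finset.ne_of_mem_erase hv), Finset.sum_const,
      Finset.card_erase_of_mem (Finset.mem_univ _), Finset.card_univ, ← Nat.card_eq_fintype_card,
      b.left.two.card, nsmul_eq_mul, Nat.cast_sub Nat.one_le_two_pow, Nat.cast_pow] at hsum
    rw [show ((2 : ℕ) : ZMod 2) = 0 from rfl, zero_pow (by omega), zero_sub, Nat.cast_one,
      neg_one_mul, neg_eq_zero] at hsum
    exact hsum
  obtain ⟨x, y, ξ, hT⟩ := b.left.rel.exists_rel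
  obtain ⟨hx, hy, hxy, -⟩ := b.left.rel.ne _ _ _ hT
  obtain ⟨w, hw⟩ : ∃ w, w ∉ relY p T x y := by
    by_contra hc
    push Not at hc
    have h4 : relY p T x y = ⊤ := eq_top_iff.2 fun z _ => hc z
    have h5 := b.left.cardY hx hy hxy
    rw [h4, Nat.card_congr Submodule.topEquiv.toEquiv, b.left.two.card] at h5
    have := Nat.one_le_two_pow (n := N)
    omega
  have hw0 : w ≠ 0 := fun h => hw (h ▸ Submodule.zero_mem _)
  obtain ⟨i, rfl⟩ := hg x y hx hy
  obtain ⟨j, rfl⟩ := hg x w hx hw0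
  have h4 := hall x i j
  simp only [F, if_neg hw] at h4
  exact one_ne_zero h4

end Regular

section Regular

variable {G V : Type*} [Group G] [AddCommGroup V] [Module (ZMod 2) V] [DistribMulAction G V]
  [Finite G] [Finite V]

theorem exists_smul_eq_of_pair [FaithfulSMul G V] {n : ℕ} (hn : Nat.card V = 2 ^ n)
    (hodd : Odd n) (hn3 : 3 ≤ n) {g : G}
    (hg : ∀ v w : V, v ≠ 0 → w ≠ 0 → ∃ k : ℕ, g ^ k • v = w)
    (pair : ∀ x y x' y' : V, x ≠ 0 → y ≠ 0 → x ≠ y → x' ≠ 0 → y' ≠ 0 → x' ≠ y' →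
      ∃ g : G, g • x = x' ∧ g • y = y') (φ : V ≃ₗ[ZMod 2] V) : ∃ g : G, ∀ x, g • x = φ x := by
  have hP : PairTransMod G (⊥ : Submodule (ZMod 2) V) := by
    intro u v u' v'
    simp only [Submodule.mem_bot, add_eq_zero_two]
    intro hu hv huv hu' hv' huv'
    obtain ⟨k, h1, h2⟩ := pair u v u' v' hu hv huv hu' hv' huv'
    exact ⟨k, fun x hx => by rw [hx, smul_zero], h1, h2⟩
  refine exists_smul_eq_of_tripleTransMod hn hodd hn3 hP ?_ φ
  have t : TwoTrans G (evalPairing G V) n :=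
    TwoTrans.of_pair (evalPairing_nondeg _ _) (evalPairing_smul _ _) hn hn3 pair
  rcases t.tripleTrans_or_balanced with h | ⟨T, T', b⟩
  · intro u v w u' v' w' hi hi'
    simp only [IndepMod, Submodule.mem_bot, add_eq_zero_two] at hi hi'
    obtain ⟨k, h1, h2, h3⟩ := h u v w u' v' w' hi.1 hi.2.1 hi.2.2.1
      (by rw [mem_span_two]; tauto) hi'.1 hi'.2.1 hi'.2.2.1 (by rw [mem_span_two]; tauto)
    refine ⟨k, fun x hx => ?_, ?_, ?_, ?_⟩
    · rw [(Submodule.mem_bot _).1 hx, smul_zero]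
    all_goals simp only [h1, h2, h3, add_self_two, Submodule.zero_mem]
  · have h6 := b.left.add_le b.right b.lt
    have h7 : n ≠ 6 := by rintro rfl; revert hodd; decide
    exact (b.false_of_regular (by omega) hg).elim

end Regular

section Burnside

open Polynomial

variable {p : ℕ} [Fact p.Prime]

/-- The difference operator of a finite set of translations. -/
noncomputable def shiftDiff (U : Finset (ZMod p)) (f : (ZMod p)[X]) : (ZMod p)[X] :=
  ∑ u ∈ U, taylor u f - (U.card : (ZMod p)[X]) * f

theorem eval_shiftDiff (U : Finset (ZMod p)) (f : (ZMod p)[X]) (x : ZMod p) :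
    (shiftDiff U f).eval x = ∑ u ∈ U, f.eval (x + u) - (U.card : ZMod p) * f.eval x := by
  simp only [shiftDiff, eval_sub, eval_finsetSum, taylor_eval, eval_mul, eval_natCast]

theorem coeff_shiftDiff (U : Finset (ZMod p)) (f : (ZMod p)[X]) (n : ℕ) {d : ℕ}
    (hd : f.natDegree ≤ d) : (shiftDiff U f).coeff n =
      ∑ i ∈ Finset.range d, f.coeff (i + 1 + n) * ((i + 1 + n).choose n : ZMod p) *
        ∑ u ∈ U, u ^ (i + 1) := by
  have h1 : ∀ u, (taylor u f).coeff n =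
      ∑ i ∈ Finset.range d, f.coeff (i + 1 + n) * ((i + 1 + n).choose n : ZMod p) * u ^ (i + 1) +
        f.coeff n := by
    intro u
    rw [taylor_coeff, eval_eq_sum_range' (n := d + 1)
      (lt_of_le_of_lt (natDegree_hasseDeriv_le f n) (by omega)), Finset.sum_range_succ']
    simp only [hasseDeriv_coeff, pow_zero, mul_one, zero_add, Nat.choose_self, Nat.cast_one,
      one_mul]
    congr 1
    exact Finset.sum_congr rfl fun i _ => by ring
  rw [shiftDiff, coeff_sub, finsetSum_coeff, ← C_eq_natCast, coeff_C_mul]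
  simp only [h1, Finset.sum_add_distrib, Finset.sum_const, nsmul_eq_mul, add_sub_cancel_right,
    Finset.mul_sum]
  exact Finset.sum_comm

theorem coeff_shiftDiff_eq_zero {U : Finset (ZMod p)} {k : ℕ}
    (hk : ∀ i, 1 ≤ i → i < k → ∑ u ∈ U, u ^ i = 0) {f : (ZMod p)[X]} {n : ℕ}
    (hn : f.natDegree < n + k) : (shiftDiff U f).coeff n = 0 := by
  rw [coeff_shiftDiff U f n le_rfl]
  refine Finset.sum_eq_zero fun i _ => ?_
  rcases lt_or_ge (i + 1) k with h | h
  · rw [hk _ (by omega) h, mul_zero]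
  · rw [coeff_eq_zero_of_natDegree_lt (by omega), zero_mul, zero_mul]

theorem coeff_shiftDiff_ne_zero {U : Finset (ZMod p)} {k : ℕ} (hk1 : 1 ≤ k)
    (hk : ∀ i, 1 ≤ i → i < k → ∑ u ∈ U, u ^ i = 0) (hk0 : ∑ u ∈ U, u ^ k ≠ 0)
    {f : (ZMod p)[X]} (hf : f ≠ 0) (hkf : k ≤ f.natDegree) (hfp : f.natDegree < p) :
    (shiftDiff U f).coeff (f.natDegree - k) ≠ 0 := by
  rw [coeff_shiftDiff U f _ le_rfl, Finset.sum_eq_single (k - 1)]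
  · rw [show k - 1 + 1 + (f.natDegree - k) = f.natDegree by omega, Nat.sub_add_cancel hk1]
    refine mul_ne_zero (mul_ne_zero (leadingCoeff_ne_zero.2 hf) ?_) hk0
    rw [Ne, ZMod.natCast_eq_zero_iff]
    intro h
    have h1 := (Fact.out : p.Prime).dvd_factorial.1 (h.trans (Dvd.intro _
      ((mul_assoc _ _ _).symm.trans (Nat.choose_mul_factorial_mul_factorial
        (Nat.sub_le f.natDegree k)))))
    omega
  · intro i _ hi
    rcases lt_or_gt_of_ne hi with h | h
    · rw [hk _ (by omega) (by omega), mul_zero]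
    · rw [coeff_eq_zero_of_natDegree_lt (by omega), zero_mul, zero_mul]
  · intro h
    rw [Finset.mem_range] at h
    omega

theorem exists_powerSum_ne_zero {U : Finset (ZMod p)} (hU : U.Nonempty) (h0 : (0 : ZMod p) ∉ U) :
    ∃ k, 1 ≤ k ∧ k ≤ U.card ∧ ∑ u ∈ U, u ^ k ≠ 0 := by
  classical
  by_contra! hc
  obtain ⟨v, hv⟩ := hU
  have hdeg : (∏ u ∈ U.erase v, (X - C u)).natDegree + 1 = U.card := by
    rw [natDegree_prod_of_monic _ _ fun u _ => monic_X_sub_C u]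
    simp only [natDegree_X_sub_C, Finset.sum_const, smul_eq_mul, mul_one]
    exact Finset.card_erase_add_one hv
  set g := ∏ u ∈ U.erase v, (X - C u) with hg
  have h1 : ∑ u ∈ U, u * g.eval u = 0 := by
    simp only [eval_eq_sum_range, Finset.mul_sum]
    rw [Finset.sum_comm]
    refine Finset.sum_eq_zero fun i hi => ?_
    rw [Finset.mem_range] at hi
    have h2 := hc (i + 1) (by omega) (by omega)
    rw [← mul_zero (g.coeff i), ← h2, Finset.mul_sum]
    exact Finset.sum_congr rfl fun u _ => by ring
  rw [Finset.sum_eq_single_of_mem v hv] at h1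
  · rcases mul_eq_zero.1 h1 with h | h
    · exact h0 (h ▸ hv)
    · rw [hg, eval_prod, Finset.prod_eq_zero_iff] at h
      obtain ⟨u, hu, h⟩ := h
      rw [eval_sub, eval_X, eval_C, sub_eq_zero] at h
      exact Finset.ne_of_mem_erase hu h.symm
  · intro u hu huv
    rw [hg, eval_prod, Finset.prod_eq_zero (Finset.mem_erase.2 ⟨huv, hu⟩), mul_zero]
    rw [eval_sub, eval_X, eval_C, sub_self]

theorem exists_natDegree_lt_eval_eq (F : ZMod p → ZMod p) :
    ∃ f : (ZMod p)[X], f.natDegree < p ∧ ∀ x, f.eval x = F x := by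
  classical
  refine ⟨Lagrange.interpolate Finset.univ id F, ?_, fun x =>
    Lagrange.eval_interpolate_at_node F (Set.injOn_id _) (Finset.mem_univ x)⟩
  have h := Lagrange.degree_interpolate_lt F (s := Finset.univ) (Set.injOn_id _)
  rw [Finset.card_univ, ZMod.card] at h
  by_cases h0 : Lagrange.interpolate Finset.univ id F = 0
  · rw [h0, natDegree_zero]
    exact (Fact.out : p.Prime).pos
  · exact (natDegree_lt_iff_degree_lt h0).2 h

theorem eq_of_eval_eq {f g : (ZMod p)[X]} (hf : f.natDegree < p) (hg : g.natDegree < p)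
    (h : ∀ x, f.eval x = g.eval x) : f = g := by
  rw [← sub_eq_zero]
  refine eq_zero_of_natDegree_lt_card_of_eval_eq_zero _ Function.injective_id
    (fun x => ?_) ?_
  · rw [eval_sub, id, h, sub_self]
  · rw [ZMod.card]
    exact (natDegree_sub_le f g).trans_lt (max_lt hf hg)

theorem natDegree_shiftDiff_lt {U : Finset (ZMod p)} {k : ℕ}
    (hk : ∀ i, 1 ≤ i → i < k → ∑ u ∈ U, u ^ i = 0) {f : (ZMod p)[X]} {d : ℕ} (hd : 0 < d)
    (hf : f.natDegree < d + k) : (shiftDiff U f).natDegree < d := by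
  by_contra! h
  have h1 := coeff_shiftDiff_eq_zero hk (f := f) (n := (shiftDiff U f).natDegree) (by omega)
  rw [coeff_natDegree, leadingCoeff_eq_zero] at h1
  rw [h1, natDegree_zero] at h
  omega

theorem natDegree_lt_of_shiftDiff {U : Finset (ZMod p)} {k : ℕ} (hk1 : 1 ≤ k)
    (hk : ∀ i, 1 ≤ i → i < k → ∑ u ∈ U, u ^ i = 0) (hk0 : ∑ u ∈ U, u ^ k ≠ 0)
    {f : (ZMod p)[X]} (hfp : f.natDegree < p) {d : ℕ} (h : ∀ n, d ≤ n → (shiftDiff U f).coeff n = 0) :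
    f.natDegree < d + k := by
  by_contra! hc
  have hf : f ≠ 0 := by
    rintro rfl
    rw [natDegree_zero] at hc
    omega
  exact coeff_shiftDiff_ne_zero hk1 hk hk0 hf (by omega) hfp (h _ (by omega))

theorem exists_affine_of_shift_invariant {U : Finset (ZMod p)} (hU : U.Nonempty)
    (h0 : (0 : ZMod p) ∉ U) (hcard : 2 * U.card < p) (σ : Equiv.Perm (ZMod p))
    (hσ : ∀ x u, u ∈ U → σ (x + u) - σ x ∈ U) : ∃ a b : ZMod p, ∀ x, σ x = a * x + b := by
  classical
  obtain ⟨k, ⟨hk1, hkU, hk0⟩, hmin⟩ : ∃ k, (1 ≤ k ∧ k ≤ U.card ∧ ∑ u ∈ U, u ^ k ≠ 0) ∧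
      ∀ i < k, ¬ (1 ≤ i ∧ i ≤ U.card ∧ ∑ u ∈ U, u ^ i ≠ 0) :=
    ⟨_, Nat.find_spec (exists_powerSum_ne_zero hU h0), fun _ => Nat.find_min _⟩
  have hk : ∀ i, 1 ≤ i → i < k → ∑ u ∈ U, u ^ i = 0 := fun i h1 h2 => by
    have := hmin i h2
    by_contra h
    exact this ⟨h1, by omega, h⟩
  have hcomm : ∀ f g : (ZMod p)[X], (∀ x, g.eval x = f.eval (σ x)) →
      ∀ x, (shiftDiff U g).eval x = (shiftDiff U f).eval (σ x) := by
    intro f g hfg x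
    rw [eval_shiftDiff, eval_shiftDiff, hfg]
    congr 1
    simp only [hfg]
    refine Finset.sum_nbij (fun u => σ (x + u) - σ x) (fun u hu => hσ x u hu) ?_ ?_ ?_
    · intro u _ v _ huv
      exact add_left_cancel (σ.injective (sub_left_injective huv))
    · refine Finset.surjOn_of_injOn_of_card_le _ (fun u hu => hσ x u hu) ?_ le_rfl
      intro u _ v _ huv
      exact add_left_cancel (σ.injective (sub_left_injective huv))
    · intro u _
      rw [add_sub_cancel]
  have hinv : ∀ f g : (ZMod p)[X], g.natDegree < p → (∀ x, g.eval x = f.eval (σ x)) →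
      f.natDegree < k → g.natDegree < k := by
    intro f g hg hfg hf
    have hf0 : shiftDiff U f = 0 := by
      ext n
      rw [coeff_zero]
      exact coeff_shiftDiff_eq_zero hk (by omega)
    have hg0 : shiftDiff U g = 0 := by
      refine eq_of_eval_eq (natDegree_shiftDiff_lt hk (by omega) (by omega))
        (by rw [natDegree_zero]; omega) fun x => ?_
      rw [hcomm f g hfg, hf0, eval_zero, eval_zero]
    have := natDegree_lt_of_shiftDiff hk1 hk hk0 hg (d := 0) fun n _ => by rw [hg0, coeff_zero]
    omega
  have hinv2 : ∀ f g : (ZMod p)[X], g.natDegree < p → (∀ x, g.eval x = f.eval (σ x)) →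
      f.natDegree < k + k → g.natDegree < k + k := by
    intro f g hg hfg hf
    refine natDegree_lt_of_shiftDiff hk1 hk hk0 hg fun n hn => ?_
    exact coeff_eq_zero_of_natDegree_lt (lt_of_lt_of_le (hinv (shiftDiff U f) (shiftDiff U g)
      (natDegree_shiftDiff_lt hk (by omega) (by omega)) (hcomm f g hfg)
      (natDegree_shiftDiff_lt hk (by omega) hf)) hn)
  obtain ⟨g, hgp, hg⟩ := exists_natDegree_lt_eval_eq σ
  have hgX : ∀ x, g.eval x = (X : (ZMod p)[X]).eval (σ x) := fun x => by rw [hg, eval_X]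
  have hg1 : g.natDegree ≤ 1 := by
    rcases hk1.eq_or_lt with rfl | hk2
    · have := hinv2 X g hgp hgX (by rw [natDegree_X]; omega)
      omega
    · have h1 := hinv X g hgp hgX (by rw [natDegree_X]; omega)
      by_contra! hm
      set m := g.natDegree
      obtain ⟨j, hj, hjm⟩ : ∃ j, k ≤ j * m ∧ ∀ i < j, ¬ k ≤ i * m :=
        have h : ∃ j, k ≤ j * m := ⟨k, Nat.le_mul_of_pos_right _ (by omega)⟩
        ⟨_, Nat.find_spec h, fun _ => Nat.find_min h⟩
      have hjk : j < k := by
        by_contra! hc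
        have := hjm (k - 1) (by omega)
        have h2 : (k - 1) * 2 ≤ (k - 1) * m := Nat.mul_le_mul_left _ hm
        omega
      have hj0 : j ≠ 0 := by
        rintro rfl
        rw [zero_mul] at hj
        omega
      have h3 := hjm (j - 1) (by omega)
      have h4 : (j - 1) * m + m = j * m := by
        rw [← Nat.succ_mul, Nat.succ_eq_add_one, Nat.sub_add_cancel (by omega)]
      have h5 := hinv (X ^ j) (g ^ j) (by rw [natDegree_pow]; change j * m < p; omega)
        (fun x => by rw [eval_pow, eval_pow, hgX]) (by rw [natDegree_X_pow]; exact hjk)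
      rw [natDegree_pow] at h5
      change j * m < k at h5
      omega
  refine ⟨g.coeff 1, g.coeff 0, fun x => ?_⟩
  rw [← hg x, eval_eq_sum_range' (n := 2) (by omega), Finset.sum_range_succ, Finset.sum_range_one]
  ring

end Burnside

section Burnside

variable {p : ℕ} [Fact p.Prime] {G Ω : Type*} [Group G] [MulAction G Ω]

theorem pow_val_smul {e : ZMod p → Ω} {g : G} (he : ∀ i, g • e i = e (i + 1)) (k i : ZMod p) :
    g ^ k.val • e i = e (i + k) := by
  have h : ∀ m : ℕ, g ^ m • e i = e (i + m) := by
    intro m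
    induction m with
    | zero => rw [pow_zero, one_smul, Nat.cast_zero, add_zero]
    | succ m ih => rw [pow_succ', mul_smul, ih, he, Nat.cast_succ, add_assoc]
  rw [h, ZMod.natCast_zmod_val]

/-- Burnside's theorem on transitive groups of prime degree. -/
theorem exists_smul_pair_or_affine (e : ZMod p ≃ Ω) {g : G} (he : ∀ i, g • e i = e (i + 1)) :
    (∀ x y x' y' : Ω, x ≠ y → x' ≠ y' → ∃ h : G, h • x = x' ∧ h • y = y') ∨
      ∀ h : G, ∃ a b : ZMod p, ∀ i, h • e i = e (a * i + b) := by
  classical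
  have hpow := pow_val_smul he
  let O : Finset (ZMod p) := {d | ∃ h : G, h • e 0 = e 0 ∧ h • e 1 = e d}
  have hO : ∀ d, d ∈ O ↔ ∃ h : G, h • e 0 = e 0 ∧ h • e 1 = e d := fun d => by
    simp only [O, Finset.mem_filter, Finset.mem_univ, true_and]
  have hO1 : 1 ∈ O := (hO 1).2 ⟨1, one_smul _ _, one_smul _ _⟩
  have hO0 : 0 ∉ O := by
    rw [hO]
    rintro ⟨h, h1, h2⟩
    have := e.injective (smul_left_cancel h (h1.trans h2.symm))
    exact zero_ne_one this
  have hinv : ∀ (h : G) (d d' : ZMod p), h • e 0 = e 0 → h • e d = e d' → (d ∈ O ↔ d' ∈ O) := by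
    intro h d d' h1 h2
    rw [hO, hO]
    constructor
    · rintro ⟨k, h3, h4⟩
      exact ⟨h * k, by rw [mul_smul, h3, h1], by rw [mul_smul, h4, h2]⟩
    · rintro ⟨k, h3, h4⟩
      exact ⟨h⁻¹ * k, by rw [mul_smul, h3, inv_smul_eq_iff, h1],
        by rw [mul_smul, h4, inv_smul_eq_iff, h2]⟩
  by_cases hall : ∀ d, d ≠ 0 → d ∈ O
  · left
    have key : ∀ i j i' j' : ZMod p, i ≠ j → i' ≠ j' →
        ∃ h : G, h • e i = e i' ∧ h • e j = e j' := by
      intro i j i' j' hij hij'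
      obtain ⟨h, h1, h2⟩ := (hO _).1 (hall (j - i) (sub_ne_zero.2 hij.symm))
      obtain ⟨h', h1', h2'⟩ := (hO _).1 (hall (j' - i') (sub_ne_zero.2 hij'.symm))
      refine ⟨g ^ i'.val * h' * h⁻¹ * g ^ (-i).val, ?_, ?_⟩
      · rw [mul_smul, hpow, add_neg_cancel, mul_smul, inv_smul_eq_iff.2 h1.symm, mul_smul, h1',
          hpow, zero_add]
      · rw [mul_smul, hpow, ← sub_eq_add_neg, mul_smul, inv_smul_eq_iff.2 h2.symm, mul_smul, h2',
          hpow, sub_add_cancel]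
    intro x y x' y' hxy hxy'
    obtain ⟨h, h1, h2⟩ := key (e.symm x) (e.symm y) (e.symm x') (e.symm y')
      (e.symm.injective.ne hxy) (e.symm.injective.ne hxy')
    simp only [Equiv.apply_symm_apply] at h1 h2
    exact ⟨h, h1, h2⟩
  · right
    push Not at hall
    obtain ⟨c, hc0, hcO⟩ := hall
    obtain ⟨U, hU, h0, hcard, hUinv⟩ : ∃ U : Finset (ZMod p), U.Nonempty ∧ 0 ∉ U ∧
        2 * U.card < p ∧ ∀ (h : G) (d d' : ZMod p), h • e 0 = e 0 → h • e d = e d' →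
          d ∈ U → d' ∈ U := by
      have hcard : O.card + ((Finset.univ.erase 0) \ O).card = p - 1 := by
        rw [add_comm, Finset.card_sdiff_add_card_eq_card
          (fun d hd => Finset.mem_erase.2 ⟨by rintro rfl; exact hO0 hd, Finset.mem_univ _⟩),
          Finset.card_erase_of_mem (Finset.mem_univ _), Finset.card_univ, ZMod.card]
      have hp := (Fact.out : p.Prime).pos
      rcases le_total O.card ((Finset.univ.erase 0) \ O).card with h | h
      · exact ⟨O, ⟨1, hO1⟩, hO0, by omega, fun h d d' h1 h2 => (hinv h d d' h1 h2).1⟩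
      · refine ⟨(Finset.univ.erase 0) \ O, ⟨c, ?_⟩, ?_, by omega, fun h d d' h1 h2 => ?_⟩
        · simp [hc0, hcO]
        · simp
        · simp only [Finset.mem_sdiff, Finset.mem_erase, Finset.mem_univ, and_true,
            hinv h d d' h1 h2]
          rintro ⟨h3, h4⟩
          refine ⟨?_, h4⟩
          rintro rfl
          exact h3 (e.injective (smul_left_cancel h (h2.trans h1.symm)))
    intro h
    let σ : Equiv.Perm (ZMod p) := (e.trans (MulAction.toPerm h)).trans e.symm
    have hσ : ∀ i, h • e i = e (σ i) := fun i => (e.apply_symm_apply _).symm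
    obtain ⟨a, b, hab⟩ := exists_affine_of_shift_invariant hU h0 hcard σ fun x u hu => by
      refine hUinv (g ^ (-σ x).val * h * g ^ x.val) u _ ?_ ?_ hu
      · rw [mul_smul, hpow, zero_add, mul_smul, hσ, hpow, add_neg_cancel]
      · rw [mul_smul, hpow, mul_smul, hσ, hpow, add_comm u, sub_eq_add_neg]
    exact ⟨a, b, fun i => by rw [hσ, hab]⟩

end Burnside

section SemilinearNormalizer

variable {G V : Type*} [Group G] [AddCommGroup V] [Module (ZMod 2) V] [DistribMulAction G V]
  [Finite V]

theorem card_algEquiv_of_isDomain (A : Type*) [CommRing A] [IsDomain A] [Finite A]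
    [Algebra (ZMod 2) A] : Nat.card (A ≃ₐ[ZMod 2] A) = Module.finrank (ZMod 2) A := by
  let := (Finite.isField_of_domain A).toField
  exact IsGalois.card_aut_eq_finrank (ZMod 2) A

theorem smulLinear_mul (g h : G) : (smulLinear (g * h) : Module.End (ZMod 2) V) =
    smulLinear g * smulLinear h :=
  LinearMap.ext fun x => mul_smul g h x

theorem smulLinear_one : (smulLinear (1 : G) : Module.End (ZMod 2) V) = 1 :=
  LinearMap.ext fun x => one_smul G x

theorem smulLinear_pow (g : G) (k : ℕ) : (smulLinear (g ^ k) : Module.End (ZMod 2) V) =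
    smulLinear g ^ k := by
  induction k with
  | zero => rw [pow_zero, pow_zero, smulLinear_one]
  | succ k ih => rw [pow_succ, pow_succ, smulLinear_mul, ih]

theorem conj_smulLinear_mem {g h : G} {a : ℕ} (ha : h * g = g ^ a * h)
    {x : Module.End (ZMod 2) V} (hx : x ∈ Algebra.adjoin (ZMod 2) {smulLinear g}) :
    smulLinear h * x * smulLinear h⁻¹ ∈
      Algebra.adjoin (ZMod 2) {(smulLinear g : Module.End (ZMod 2) V)} := by
  have hinv : (smulLinear h⁻¹ * smulLinear h : Module.End (ZMod 2) V) = 1 := by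
    rw [← smulLinear_mul, inv_mul_cancel, smulLinear_one]
  have hinv' : (smulLinear h * smulLinear h⁻¹ : Module.End (ZMod 2) V) = 1 := by
    rw [← smulLinear_mul, mul_inv_cancel, smulLinear_one]
  induction hx using Algebra.adjoin_induction with
  | mem x hx =>
    rw [Set.mem_singleton_iff.1 hx, ← smulLinear_mul, ha, smulLinear_mul, mul_assoc,
      hinv', mul_one, smulLinear_pow]
    exact pow_mem (Algebra.subset_adjoin (Set.mem_singleton _)) a
  | algebraMap r =>
    rw [← Algebra.commutes r, mul_assoc, hinv', mul_one]
    exact Subalgebra.algebraMap_mem _ r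
  | add x y _ _ hx hy =>
    rw [mul_add, add_mul]
    exact add_mem hx hy
  | mul x y _ _ hx hy =>
    have := mul_mem hx hy
    rwa [mul_assoc (smulLinear h * x), ← mul_assoc (smulLinear h⁻¹), ← mul_assoc (smulLinear h⁻¹),
      hinv, one_mul, ← mul_assoc, mul_assoc _ x] at this

/-- Conjugation by the group as a representation on the algebra generated by a normalized
element. -/
def conjAlgHom {g : G} (hnorm : ∀ h : G, ∃ a : ℕ, h * g = g ^ a * h) :
    G →* (Algebra.adjoin (ZMod 2) {(smulLinear g : Module.End (ZMod 2) V)} →ₐ[ZMod 2]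
      Algebra.adjoin (ZMod 2) {(smulLinear g : Module.End (ZMod 2) V)}) where
  toFun h :=
    { toFun := fun x => ⟨smulLinear h * x.1 * smulLinear h⁻¹,
        conj_smulLinear_mem (hnorm h).choose_spec x.2⟩
      map_one' := Subtype.ext <| by
        change smulLinear h * 1 * smulLinear h⁻¹ = 1
        rw [mul_one, ← smulLinear_mul, mul_inv_cancel, smulLinear_one]
      map_mul' := fun x y => Subtype.ext <| LinearMap.ext fun v => by
        change h • x.1 (y.1 (h⁻¹ • v)) = h • x.1 (h⁻¹ • h • y.1 (h⁻¹ • v))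
        rw [inv_smul_smul]
      map_zero' := Subtype.ext <| LinearMap.ext fun v => smul_zero h
      map_add' := fun x y => Subtype.ext <| LinearMap.ext fun v => smul_add h _ _
      commutes' := fun r => Subtype.ext <| by
        change smulLinear h * algebraMap (ZMod 2) (Module.End (ZMod 2) V) r * smulLinear h⁻¹ =
          algebraMap (ZMod 2) (Module.End (ZMod 2) V) r
        rw [← Algebra.commutes r, mul_assoc, ← smulLinear_mul, mul_inv_cancel, smulLinear_one,
          mul_one] }
  map_one' := AlgHom.ext fun x => Subtype.ext <| by
    change smulLinear 1 * x.1 * smulLinear (1 : G)⁻¹ = x.1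
    rw [inv_one, smulLinear_one, one_mul, mul_one]
  map_mul' h k := AlgHom.ext fun x => Subtype.ext <| by
    change smulLinear (h * k) * x.1 * smulLinear (h * k)⁻¹ =
      smulLinear h * (smulLinear k * x.1 * smulLinear k⁻¹) * smulLinear h⁻¹
    rw [mul_inv_rev, smulLinear_mul, smulLinear_mul]
    simp only [mul_assoc]

theorem zpowers_normal_and_index_dvd [FaithfulSMul G V] [Nontrivial V] {n : ℕ}
    (hn : Nat.card V = 2 ^ n) {g : G}
    (hg : ∀ v w : V, v ≠ 0 → w ≠ 0 → ∃ k : ℕ, g ^ k • v = w)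
    (hnorm : ∀ h : G, ∃ a : ℕ, h * g = g ^ a * h) :
    (Subgroup.zpowers g).Normal ∧ (Subgroup.zpowers g).index ∣ n := by
  obtain ⟨v₀, hv₀⟩ := exists_ne (0 : V)
  let s : Module.End (ZMod 2) V := smulLinear g
  let A := Algebra.adjoin (ZMod 2) {s}
  have hs : s ∈ A := Algebra.subset_adjoin (Set.mem_singleton _)
  have hcommA : ∀ x ∈ A, ∀ y ∈ A, x * y = y * x := fun x hx y hy =>
    congrArg Subtype.val (mul_comm' (⟨x, hx⟩ : A) ⟨y, hy⟩)
  have hinj : ∀ x ∈ A, x v₀ = 0 → x = 0 := by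
    intro x hx h
    ext v
    by_cases hv : v = 0
    · rw [hv, map_zero, map_zero]
    obtain ⟨k, rfl⟩ := hg v₀ v hv₀ hv
    have h1 := LinearMap.congr_fun (hcommA x hx _ (pow_mem hs k)) v₀
    rw [← smulLinear_pow] at h1
    change x (g ^ k • v₀) = g ^ k • x v₀ at h1
    rw [h1, h, smul_zero, LinearMap.zero_apply]
  let : CommRing A := { (inferInstance : Ring A) with mul_comm := mul_comm' }
  have : Finite (Module.End (ZMod 2) V) := Finite.of_injective _ DFunLike.coe_injective
  have : Finite A := inferInstance
  have : IsDomain A := by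
    have : Nontrivial A := inferInstance
    have : NoZeroDivisors A := ⟨fun {x y} hxy => by
      by_contra! hc
      have hy : y.1 v₀ ≠ 0 := fun h => hc.2 (Subtype.ext (hinj _ y.2 h))
      obtain ⟨k, hk⟩ := hg v₀ (y.1 v₀) hv₀ hy
      refine hc.1 (Subtype.ext (hinj _ x.2 ?_))
      have h1 := LinearMap.congr_fun (hcommA x.1 x.2 _ (pow_mem hs k)) v₀
      rw [← smulLinear_pow] at h1
      change x.1 (g ^ k • v₀) = g ^ k • x.1 v₀ at h1
      have h2 : x.1 (y.1 v₀) = 0 := LinearMap.congr_fun (congrArg Subtype.val hxy) v₀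
      rw [← hk, h1] at h2
      rw [← inv_smul_smul (g ^ k) (x.1 v₀), h2, smul_zero]⟩
    exact NoZeroDivisors.to_isDomain A
  have hrank : Module.finrank (ZMod 2) A = n := by
    have hbij : Function.Bijective ((LinearMap.applyₗ v₀ : Module.End (ZMod 2) V →ₗ[ZMod 2] V) ∘ₗ
        A.val.toLinearMap) := by
      constructor
      · rw [← LinearMap.ker_eq_bot, LinearMap.ker_eq_bot']
        exact fun x hx => Subtype.ext (hinj _ x.2 hx)
      · intro w
        by_cases hw : w = 0
        · exact ⟨0, by rw [hw, map_zero]⟩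
        obtain ⟨k, rfl⟩ := hg v₀ w hv₀ hw
        refine ⟨⟨s ^ k, pow_mem hs k⟩, ?_⟩
        change (s ^ k) v₀ = _
        rw [← smulLinear_pow]
        rfl
    rw [(LinearEquiv.ofBijective _ hbij).finrank_eq]
    have := Module.natCard_eq_pow_finrank (K := ZMod 2) (V := V)
    rw [hn, Nat.card_zmod] at this
    exact (Nat.pow_right_injective le_rfl this).symm
  have hcard := card_algEquiv_of_isDomain A
  rw [hrank] at hcard
  let f : G →* (A ≃ₐ[ZMod 2] A) :=
    (AlgEquiv.algHomUnitsEquiv _ _).toMonoidHom.comp (conjAlgHom hnorm).toHomUnits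
  have hf : ∀ h, f h = 1 ↔ ∀ x : A, conjAlgHom hnorm h x = x := by
    intro h
    constructor
    · intro h1 x
      exact DFunLike.congr_fun h1 x
    · intro h1
      exact AlgEquiv.ext h1
  have hker : f.ker = Subgroup.zpowers g := by
    ext h
    rw [MonoidHom.mem_ker, hf]
    constructor
    · intro h1
      have h2 : ∀ k : ℕ, ∀ v : V, h • g ^ k • v = g ^ k • h • v := by
        intro k v
        have h3 := LinearMap.congr_fun (congrArg Subtype.val (h1 ⟨s ^ k, pow_mem hs k⟩)) (h • v)
        change h • (s ^ k) (h⁻¹ • h • v) = (s ^ k) (h • v) at h3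
        rw [inv_smul_smul, ← smulLinear_pow] at h3
        exact h3
      obtain ⟨k, hk⟩ := hg v₀ (h • v₀) hv₀ fun h2 => hv₀ <| by
        rw [← inv_smul_smul h v₀, h2, smul_zero]
      have h3 : h = g ^ k := by
        refine FaithfulSMul.eq_of_smul_eq_smul (α := V) fun v => ?_
        by_cases hv : v = 0
        · rw [hv, smul_zero, smul_zero]
        obtain ⟨m, rfl⟩ := hg v₀ v hv₀ hv
        rw [h2, ← hk, smul_smul, smul_smul, ← pow_add, ← pow_add, add_comm]
      exact h3 ▸ Subgroup.npow_mem_zpowers g k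
    · rintro ⟨k, rfl⟩ x
      have h1 : ∀ x : A, conjAlgHom hnorm g x = x := by
        intro x
        refine Subtype.ext ?_
        change smulLinear g * x.1 * smulLinear g⁻¹ = x.1
        rw [hcommA _ hs _ x.2, mul_assoc, ← smulLinear_mul, mul_inv_cancel, smulLinear_one,
          mul_one]
      have h2 : f (g ^ k) = 1 := by rw [map_zpow, (hf g).2 h1, one_zpow]
      exact (hf _).1 h2 x
  rw [← hker]
  refine ⟨inferInstance, ?_⟩
  rw [Subgroup.index_ker, ← hcard]
  exact Subgroup.card_subgroup_dvd_card _

end SemilinearNormalizer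

section PrimeCycle

variable {G V : Type*} [Group G] [AddCommGroup V] [Module (ZMod 2) V] [DistribMulAction G V]
  [Finite V]

/-- The action on nonzero vectors. -/
@[reducible] def nonzeroAction : MulAction G {v : V // v ≠ 0} where
  smul g v := ⟨g • v.1, fun h => v.2 <| by rw [← inv_smul_smul g v.1, h, smul_zero]⟩
  one_smul v := Subtype.ext (one_smul G v.1)
  mul_smul g h v := Subtype.ext (mul_smul g h v.1)

theorem card_nonzero {n : ℕ} (hn : Nat.card V = 2 ^ n) :
    Nat.card {v : V // v ≠ 0} = 2 ^ n - 1 := by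
  classical
  have := Fintype.ofFinite V
  rw [Nat.card_eq_fintype_card, Fintype.card_subtype_compl, Fintype.card_subtype_eq,
    ← Nat.card_eq_fintype_card, hn]

theorem exists_equiv_nonzero [FaithfulSMul G V] {n p : ℕ} [hp : Fact p.Prime]
    (hn : Nat.card V = 2 ^ n) (hpn : 2 ^ n - 1 = p) {g : G} (hg : orderOf g = p) :
    ∃ e : ZMod p ≃ {v : V // v ≠ 0}, ∀ i, g • (e i : V) = e (i + 1) := by
  have hg1 : g ≠ 1 := by
    rintro rfl
    rw [orderOf_one] at hg
    exact hp.out.one_lt.ne hg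
  obtain ⟨x, hx⟩ : ∃ x : V, g • x ≠ x := by
    by_contra! hc
    exact hg1 (FaithfulSMul.eq_of_smul_eq_smul (α := V) fun v => by rw [hc, one_smul])
  have hx0 : ∀ k : ℕ, g ^ k • x ≠ 0 := fun k h => hx <| by
    have h1 : x = 0 := by rw [← inv_smul_smul (g ^ k) x, h, smul_zero]
    rw [h1, smul_zero]
  have hper : MulAction.period g x = p := by
    rcases hp.out.eq_one_or_self_of_dvd _ (hg ▸ MulAction.period_dvd_orderOf g x) with h | h
    · refine (hx ?_).elim
      have := MulAction.pow_smul_eq_iff_period_dvd.2 h.dvd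
      rwa [pow_one] at this
    · exact h
  let f : ZMod p → {v : V // v ≠ 0} := fun i => ⟨g ^ i.val • x, hx0 _⟩
  have key : ∀ i j : ZMod p, f i = f j → i.val ≤ j.val → i = j := by
    intro i j hij hle
    have h1 : g ^ i.val • x = g ^ j.val • x := congrArg Subtype.val hij
    rw [← Nat.add_sub_of_le hle, pow_add, mul_smul, smul_left_cancel_iff, eq_comm,
      MulAction.pow_smul_eq_iff_period_dvd, hper] at h1
    have := Nat.eq_zero_of_dvd_of_lt h1 ((Nat.sub_le _ _).trans_lt (ZMod.val_lt j))
    exact ZMod.val_injective p (by omega)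
  have hinj : Function.Injective f := fun i j hij =>
    (le_total i.val j.val).elim (key i j hij) fun h => (key j i hij.symm h).symm
  refine ⟨Equiv.ofBijective f (hinj.bijective_of_nat_card_le
    (by rw [card_nonzero hn, hpn, Nat.card_zmod])), fun i => ?_⟩
  change g • g ^ i.val • x = g ^ (i + 1).val • x
  rw [smul_smul, ← pow_succ']
  congr 1
  rw [pow_eq_pow_iff_modEq, hg, ZMod.val_add, ZMod.val_one'' hp.out.one_lt.ne']
  exact (Nat.mod_modEq _ _).symm

theorem exists_pow_smul_eq_of_orderOf [FaithfulSMul G V] {n p : ℕ} [hp : Fact p.Prime]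
    (hn : Nat.card V = 2 ^ n) (hpn : 2 ^ n - 1 = p) {g : G} (hg : orderOf g = p) (v w : V)
    (hv : v ≠ 0) (hw : w ≠ 0) : ∃ k : ℕ, g ^ k • v = w := by
  obtain ⟨e, he⟩ := exists_equiv_nonzero hn hpn hg
  let : MulAction G {v : V // v ≠ 0} := nonzeroAction
  have he' : ∀ i, g • e i = e (i + 1) := fun i => Subtype.ext (he i)
  refine ⟨(e.symm ⟨w, hw⟩ - e.symm ⟨v, hv⟩).val, ?_⟩
  have := pow_val_smul he' (e.symm ⟨w, hw⟩ - e.symm ⟨v, hv⟩) (e.symm ⟨v, hv⟩)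
  rw [add_sub_cancel, Equiv.apply_symm_apply, Equiv.apply_symm_apply] at this
  exact congrArg Subtype.val this

theorem dvd_card_of_transitive [Finite G] {n : ℕ} (hn : Nat.card V = 2 ^ n) [Nontrivial V]
    (h : ∀ v w : V, v ≠ 0 → w ≠ 0 → ∃ g : G, g • v = w) : 2 ^ n - 1 ∣ Nat.card G := by
  obtain ⟨v, hv⟩ := exists_ne (0 : V)
  let : MulAction G {v : V // v ≠ 0} := nonzeroAction
  have h1 : MulAction.orbit G (⟨v, hv⟩ : {v : V // v ≠ 0}) = Set.univ :=
    Set.eq_univ_of_forall fun w => (h v w.1 hv w.2).imp fun g hg => Subtype.ext hg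
  rw [← card_nonzero hn, ← Set.ncard_univ, ← h1, ← MulAction.index_stabilizer]
  exact Subgroup.index_dvd_card _

theorem exists_smul_eq_of_pair_two {n : ℕ} (hn : Nat.card V = 2 ^ n) (h2 : n = 2)
    (pair : ∀ x y x' y' : V, x ≠ 0 → y ≠ 0 → x ≠ y → x' ≠ 0 → y' ≠ 0 → x' ≠ y' →
      ∃ g : G, g • x = x' ∧ g • y = y') (φ : V ≃ₗ[ZMod 2] V) : ∃ g : G, ∀ x, g • x = φ x := by
  subst h2
  have : Nontrivial V := Finite.one_lt_card_iff_nontrivial.1 (by omega)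
  obtain ⟨x, hx⟩ := exists_ne (0 : V)
  obtain ⟨y, hy, hyx⟩ := exists_ne_two (by omega) x
  obtain ⟨g, h1, h2⟩ := pair x y (φ x) (φ y) hx hy hyx.symm (φ.map_ne_zero_iff.2 hx)
    (φ.map_ne_zero_iff.2 hy) (φ.injective.ne hyx.symm)
  have hspan : Submodule.span (ZMod 2) {x, y} = ⊤ := by
    refine submodule_eq_of_card le_top ?_
    rw [card_span_two hx hy hyx.symm, Nat.card_congr Submodule.topEquiv.toEquiv, hn]
    norm_num
  refine ⟨g, fun z => ?_⟩
  have hz : z ∈ Submodule.span (ZMod 2) {x, y} := hspan ▸ Submodule.mem_top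
  rcases mem_span_two.1 hz with rfl | rfl | rfl | rfl
  · rw [smul_zero, map_zero]
  · exact h1
  · exact h2
  · rw [smul_add, h1, h2, map_add]

theorem linear_or_index_dvd [FaithfulSMul G V] [Nontrivial V] [Finite G] {n p : ℕ}
    [hp : Fact p.Prime] (hn2 : 2 ≤ n) (hn : Nat.card V = 2 ^ n) (hpn : 2 ^ n - 1 = p) {g : G}
    (hg : orderOf g = p) :
    (∀ φ : V ≃ₗ[ZMod 2] V, ∃ g : G, ∀ x, g • x = φ x) ∨
      ((Subgroup.zpowers g).Normal ∧ (Subgroup.zpowers g).index ∣ n) := by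
  obtain ⟨e, he⟩ := exists_equiv_nonzero hn hpn hg
  have hreg := exists_pow_smul_eq_of_orderOf hn hpn hg
  let : MulAction G {v : V // v ≠ 0} := nonzeroAction
  have he' : ∀ i, g • e i = e (i + 1) := fun i => Subtype.ext (he i)
  rcases exists_smul_pair_or_affine e he' with h | h
  · left
    have pair : ∀ x y x' y' : V, x ≠ 0 → y ≠ 0 → x ≠ y → x' ≠ 0 → y' ≠ 0 → x' ≠ y' →
        ∃ g : G, g • x = x' ∧ g • y = y' := by
      intro x y x' y' hx hy hxy hx' hy' hxy'
      obtain ⟨k, h1, h2⟩ := h ⟨x, hx⟩ ⟨y, hy⟩ ⟨x', hx'⟩ ⟨y', hy'⟩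
        (fun h => hxy (congrArg Subtype.val h)) (fun h => hxy' (congrArg Subtype.val h))
      exact ⟨k, congrArg Subtype.val h1, congrArg Subtype.val h2⟩
    rcases hn2.eq_or_lt with h2 | h3
    · exact exists_smul_eq_of_pair_two hn h2.symm pair
    · have hnp : n.Prime := Nat.Prime.of_mersenne (p := n) (by rw [mersenne, hpn]; exact hp.out)
      exact exists_smul_eq_of_pair hn (hnp.odd_of_ne_two (by omega)) h3 hreg pair
  · right
    refine zpowers_normal_and_index_dvd hn hreg fun k => ?_
    obtain ⟨a, b, hab⟩ := h k
    refine ⟨a.val, FaithfulSMul.eq_of_smul_eq_smul (α := V) fun v => ?_⟩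
    by_cases hv : v = 0
    · rw [hv, smul_zero, smul_zero]
    obtain ⟨i, hi⟩ := e.surjective ⟨v, hv⟩
    have h1 : (k * g) • e i = (g ^ a.val * k) • e i := by
      rw [mul_smul, he', hab, mul_smul, hab, pow_val_smul he', mul_add, mul_one]
      congr 1
      ring
    rw [hi] at h1
    exact congrArg Subtype.val h1

end PrimeCycle

theorem transitive_on_nonzero_iff
    (n : ℕ) (hn : 2 ≤ n) (hprime : Nat.Prime (2 ^ n - 1))
    (H : Subgroup (LinearMap.GeneralLinearGroup (ZMod 2) (Fin n → ZMod 2))) :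
    (∀ v w : Fin n → ZMod 2, v ≠ 0 → w ≠ 0 → ∃ h ∈ H, h.val v = w) ↔
      (H = ⊤ ∨
       (IsCyclic H ∧ Nat.card H = 2 ^ n - 1) ∨
       (Nat.card H = n * (2 ^ n - 1) ∧
        ∃ C : Subgroup H, C.Normal ∧ IsCyclic C ∧ Nat.card C = 2 ^ n - 1)) := by
  have hV : Nat.card (Fin n → ZMod 2) = 2 ^ n := by
    rw [Nat.card_fun, Nat.card_zmod, Nat.card_fin]
  have : Fact (2 ^ n - 1).Prime := ⟨hprime⟩
  have : NeZero n := ⟨by omega⟩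
  have : Nontrivial (Fin n → ZMod 2) := inferInstance
  have : Finite (LinearMap.GeneralLinearGroup (ZMod 2) (Fin n → ZMod 2)) :=
    Finite.of_injective (fun u (x : Fin n → ZMod 2) => u.val x) fun u u' h =>
      Units.ext (DFunLike.coe_injective h)
  have hcauchy : 2 ^ n - 1 ∣ Nat.card H →
      ∀ v w : Fin n → ZMod 2, v ≠ 0 → w ≠ 0 → ∃ h ∈ H, h.val v = w := by
    intro hd v w hv hw
    obtain ⟨g, hg⟩ := exists_prime_orderOf_dvd_card' (G := H) (2 ^ n - 1) hd
    obtain ⟨k, hk⟩ := exists_pow_smul_eq_of_orderOf hV rfl hg v w hv hw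
    exact ⟨(g ^ k).1, (g ^ k).2, hk⟩
  constructor
  · intro h
    obtain ⟨g, hg⟩ := exists_prime_orderOf_dvd_card' (G := H) (2 ^ n - 1)
      (dvd_card_of_transitive hV fun v w hv hw => by
        obtain ⟨k, hk, hkv⟩ := h v w hv hw
        exact ⟨⟨k, hk⟩, hkv⟩)
    have hcard := (Subgroup.zpowers g).card_mul_index
    rw [Nat.card_zpowers, hg] at hcard
    rcases linear_or_index_dvd hn hV rfl hg with h1 | ⟨h1, h2⟩
    · left
      rw [eq_top_iff]
      intro u _
      obtain ⟨k, hk⟩ := h1 u.toLinearEquiv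
      have : u = k.1 := Units.ext (LinearMap.ext fun x => (hk x).symm)
      exact this ▸ k.2
    · right
      have hnp : n.Prime := Nat.Prime.of_mersenne (p := n) hprime
      rcases hnp.eq_one_or_self_of_dvd _ h2 with h3 | h3
      · left
        rw [h3, mul_one] at hcard
        exact ⟨isCyclic_of_prime_card hcard.symm, hcard.symm⟩
      · right
        rw [h3, mul_comm] at hcard
        exact ⟨hcard.symm, _, h1, inferInstance, by rw [Nat.card_zpowers, hg]⟩
  · rintro (rfl | ⟨-, h⟩ | ⟨h, -⟩)
    · intro v w hv hw
      obtain ⟨φ, hφ, -⟩ := exists_linearEquiv_map (A := (⊤ : Submodule (ZMod 2) (Fin n → ZMod 2)))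
        rfl (Submodule.mem_top (x := v)) (Submodule.mem_top (x := w)) hv hw
      exact ⟨LinearMap.GeneralLinearGroup.ofLinearEquiv φ, Subgroup.mem_top _, hφ⟩
    · exact hcauchy h.symm.dvd
    · exact hcauchy (h ▸ Dvd.intro_left n rfl)
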